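/- Let M ≥ 0 and 2M ≤ l ≤ n, and define I_{l,M} := V̄_{l,M}E_{l,M}B_{l−2M}V̄_{l,M}*. Then I_{l,M} = Σ_{m=M}^{⌊l/2⌋} V_{l,m}·Ã_{l−2m}·V̄_{l,m}*; in particular I_{l,M} is spanned over R by the elements α_{i₁,j₁,l−1}^{s₁}⋯α_{i_m,j_m,l−2m+1}^{s_m}·χ·(α_{g_m,h_m,l−2m}^{t_m})*⋯(α_{g₁,h₁,l−2}^{t₁})* with m ≥ M, i₁ > i₂ > ⋯ > i_m, g_m < g_{m−1} < ⋯ < g₁, 1 ≤ i_p ≤ j_p ≤ l−2p+1, 1 ≤ g_p ≤ h_p ≤ l−2p+1, s_p, t_p ∈ P, and χ ∈ Ã_{l−2m}. -/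

import Mathlib

/-!
Cyclotomic BMW algebra `B_n^k(R)`, presented as the quotient of the free `R`-algebra on
generators `Y, Y⁻¹, Xᵢ, Xᵢ⁻¹ (1 ≤ i ≤ n-1), eᵢ (1 ≤ i ≤ n-1)` by the defining relations.
Generators with out-of-range indices are identified with `1` (resp. `0` for the `eᵢ`),
so that the quotient is exactly the cyclotomic BMW algebra.
-/

inductive BMWGen : Type
  | Y : BMWGen
  | Yinv : BMWGen
  | X : ℕ → BMWGen
  | Xinv : ℕ → BMWGen
  | E : ℕ → BMWGen

namespace CBMW

/-- The parameters of a cyclotomic BMW algebra: `n`, `k`, units `q, λ, q₀` and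
families `qc` (the `qᵢ`, with `qc 0 = q₀`) and `A` (the `Aᵢ`). -/
structure Params (R : Type) [CommRing R] where
  n : ℕ
  k : ℕ
  q : Rˣ
  lam : Rˣ
  q0 : Rˣ
  qc : ℕ → R
  A : ℕ → R

variable {R : Type} [CommRing R]

abbrev F (R : Type) [CommRing R] := FreeAlgebra R BMWGen

def fY : F R := FreeAlgebra.ι R BMWGen.Y
def fYi : F R := FreeAlgebra.ι R BMWGen.Yinv
def fX (i : ℕ) : F R := FreeAlgebra.ι R (BMWGen.X i)
def fXi (i : ℕ) : F R := FreeAlgebra.ι R (BMWGen.Xinv i)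
def fE (i : ℕ) : F R := FreeAlgebra.ι R (BMWGen.E i)

/-- `δ = q - q⁻¹`. -/
def Params.delta (P : Params R) : R := (P.q : R) - ((P.q⁻¹ : Rˣ) : R)

/-- `λ⁻¹` as an element of `R`. -/
def Params.laminv (P : Params R) : R := ((P.lam⁻¹ : Rˣ) : R)

/-- The defining relations of the cyclotomic BMW algebra. -/
inductive Rel (P : Params R) : F R → F R → Prop
  | X_inv_right {i : ℕ} (h1 : 1 ≤ i) (h2 : i ≤ P.n - 1) : Rel P (fX i * fXi i) 1
  | X_inv_left {i : ℕ} (h1 : 1 ≤ i) (h2 : i ≤ P.n - 1) : Rel P (fXi i * fX i) 1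
  | Y_inv_right : Rel P (fY * fYi) 1
  | Y_inv_left : Rel P (fYi * fY) 1
  | X_invalid {i : ℕ} (h : i = 0 ∨ P.n - 1 < i) : Rel P (fX i) 1
  | Xi_invalid {i : ℕ} (h : i = 0 ∨ P.n - 1 < i) : Rel P (fXi i) 1
  | E_invalid {i : ℕ} (h : i = 0 ∨ P.n - 1 < i) : Rel P (fE i) 0
  | skein {i : ℕ} (h1 : 1 ≤ i) (h2 : i ≤ P.n - 1) :
      Rel P (fX i - fXi i) (P.delta • ((1 : F R) - fE i))
  | XX_far {i j : ℕ} (h1 : 1 ≤ i) (h2 : i ≤ P.n - 1) (h3 : 1 ≤ j) (h4 : j ≤ P.n - 1)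
      (h : i + 2 ≤ j ∨ j + 2 ≤ i) : Rel P (fX i * fX j) (fX j * fX i)
  | braid {i : ℕ} (h1 : 1 ≤ i) (h2 : i + 1 ≤ P.n - 1) :
      Rel P (fX i * fX (i+1) * fX i) (fX (i+1) * fX i * fX (i+1))
  | XE_far {i j : ℕ} (h1 : 1 ≤ i) (h2 : i ≤ P.n - 1) (h3 : 1 ≤ j) (h4 : j ≤ P.n - 1)
      (h : i + 2 ≤ j ∨ j + 2 ≤ i) : Rel P (fX i * fE j) (fE j * fX i)
  | EE_far {i j : ℕ} (h1 : 1 ≤ i) (h2 : i ≤ P.n - 1) (h3 : 1 ≤ j) (h4 : j ≤ P.n - 1)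
      (h : i + 2 ≤ j ∨ j + 2 ≤ i) : Rel P (fE i * fE j) (fE j * fE i)
  | untwist_right {i : ℕ} (h1 : 1 ≤ i) (h2 : i ≤ P.n - 1) :
      Rel P (fX i * fE i) ((P.lam : R) • fE i)
  | untwist_left {i : ℕ} (h1 : 1 ≤ i) (h2 : i ≤ P.n - 1) :
      Rel P (fE i * fX i) ((P.lam : R) • fE i)
  | XXE {i j : ℕ} (h1 : 1 ≤ i) (h2 : i ≤ P.n - 1) (h3 : 1 ≤ j) (h4 : j ≤ P.n - 1)
      (h : j = i + 1 ∨ i = j + 1) : Rel P (fX i * fX j * fE i) (fE j * fE i)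
  | EXX {i j : ℕ} (h1 : 1 ≤ i) (h2 : i ≤ P.n - 1) (h3 : 1 ≤ j) (h4 : j ≤ P.n - 1)
      (h : j = i + 1 ∨ i = j + 1) : Rel P (fE j * fE i) (fE j * fX i * fX j)
  | EEE_up {i : ℕ} (h1 : 1 ≤ i) (h2 : i + 1 ≤ P.n - 1) :
      Rel P (fE i * fE (i+1) * fE i) (fE i)
  | EEE_down {i : ℕ} (h1 : 1 ≤ i) (h2 : i + 1 ≤ P.n - 1) :
      Rel P (fE (i+1) * fE i * fE (i+1)) (fE (i+1))
  | E_sq {i : ℕ} (h1 : 1 ≤ i) (h2 : i ≤ P.n - 1) : Rel P (fE i * fE i) (P.A 0 • fE i)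
  | cyclo : Rel P (fY ^ P.k) (∑ i ∈ Finset.range P.k, P.qc i • fY ^ i)
  | braidB (h : 2 ≤ P.n) :
      Rel P (fX 1 * fY * fX 1 * fY) (fY * fX 1 * fY * fX 1)
  | YX_comm {i : ℕ} (h1 : 2 ≤ i) (h2 : i ≤ P.n - 1) : Rel P (fY * fX i) (fX i * fY)
  | YE_comm {i : ℕ} (h1 : 2 ≤ i) (h2 : i ≤ P.n - 1) : Rel P (fY * fE i) (fE i * fY)
  | YXYE (h : 2 ≤ P.n) : Rel P (fY * fX 1 * fY * fE 1) (P.laminv • fE 1)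
  | EYXY (h : 2 ≤ P.n) : Rel P (fE 1 * (fY * fX 1 * fY)) (P.laminv • fE 1)
  | EYE {m : ℕ} (h : 2 ≤ P.n) (hm : m ≤ P.k - 1) :
      Rel P (fE 1 * fY ^ m * fE 1) (P.A m • fE 1)

/-- The cyclotomic BMW algebra `B_n^k(R)`. -/
abbrev Alg (P : Params R) := RingQuot (Rel P)

def pr (P : Params R) : F R →ₐ[R] Alg P := RingQuot.mkAlgHom R (Rel P)

/-- The generator `Y`. -/
def Yg (P : Params R) : Alg P := pr P fY
/-- The generator `Y⁻¹`. -/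
def Ygi (P : Params R) : Alg P := pr P fYi
/-- The generator `Xᵢ`. -/
def Xg (P : Params R) (i : ℕ) : Alg P := pr P (fX i)
/-- The generator `Xᵢ⁻¹`. -/
def Xgi (P : Params R) (i : ℕ) : Alg P := pr P (fXi i)
/-- The generator `eᵢ`. -/
def Eg (P : Params R) (i : ℕ) : Alg P := pr P (fE i)

/-- `X₁ X₂ ⋯ X_m`. -/
def upX (P : Params R) : ℕ → Alg P
  | 0 => 1
  | m + 1 => upX P m * Xg P (m + 1)

/-- `X_m ⋯ X₂ X₁`. -/
def downX (P : Params R) : ℕ → Alg P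
  | 0 => 1
  | m + 1 => Xg P (m + 1) * downX P m

/-- `X₁⁻¹ X₂⁻¹ ⋯ X_m⁻¹`. -/
def upXi (P : Params R) : ℕ → Alg P
  | 0 => 1
  | m + 1 => upXi P m * Xgi P (m + 1)

/-- `X_m⁻¹ ⋯ X₂⁻¹ X₁⁻¹`. -/
def downXi (P : Params R) : ℕ → Alg P
  | 0 => 1
  | m + 1 => Xgi P (m + 1) * downXi P m

/-- `Yᵢ' = X_{i-1} ⋯ X₁ Y X₁ ⋯ X_{i-1}`. -/
def Yp (P : Params R) (i : ℕ) : Alg P := downX P (i - 1) * Yg P * upX P (i - 1)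

/-- `(Yᵢ')⁻¹ = X_{i-1}⁻¹ ⋯ X₁⁻¹ Y⁻¹ X₁⁻¹ ⋯ X_{i-1}⁻¹`. -/
def YpInv (P : Params R) (i : ℕ) : Alg P := downXi P (i - 1) * Ygi P * upXi P (i - 1)

/-- `(Yᵢ')^p` for an integer exponent `p`. -/
def Ypow (P : Params R) (i : ℕ) (p : ℤ) : Alg P :=
  if 0 ≤ p then Yp P i ^ p.toNat else YpInv P i ^ (-p).toNat

/-- `Y^{s 1} (Y₂')^{s 2} ⋯ (Y_m')^{s m}`. -/
def YpowProd (P : Params R) (s : ℕ → ℤ) : ℕ → Alg P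
  | 0 => 1
  | m + 1 => YpowProd P s m * Ypow P (m + 1) (s (m + 1))

/-- The subalgebra `B_l` generated by `Y^{±1}, X₁^{±1}, …, X_{l-1}^{±1}, e₁, …, e_{l-1}`. -/
def Bsub (P : Params R) (l : ℕ) : Subalgebra R (Alg P) :=
  Algebra.adjoin R
    ({Yg P, Ygi P} ∪
      {x | ∃ i, 1 ≤ i ∧ i + 1 ≤ l ∧ (x = Xg P i ∨ x = Xgi P i ∨ x = Eg P i)})

/-- `α_{ijl}^p = (Yᵢ')^p Xᵢ ⋯ X_{j-1} e_j ⋯ e_l`. -/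
def alpha (P : Params R) (i j l : ℕ) (p : ℤ) : Alg P :=
  Ypow P i p * ((List.range' i (j - i)).map fun t => Xg P t).prod *
    ((List.range' j (l + 1 - j)).map fun t => Eg P t).prod

/-- The set `P = {⌊k/2⌋ - (k-1), …, ⌊k/2⌋}` of `k` consecutive integers. -/
def Pset (k : ℕ) : Set ℤ := {p | (↑(k / 2) : ℤ) - ((k : ℤ) - 1) ≤ p ∧ p ≤ (↑(k / 2) : ℤ)}

/-- `α_{i₁,j₁,l-1}^{s₁} ⋯ α_{i_m,j_m,l-2m+1}^{s_m}`. -/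
def alphaChain (P : Params R) (l : ℕ) (ii jj : ℕ → ℕ) (ss : ℕ → ℤ) : ℕ → Alg P
  | 0 => 1
  | m + 1 => alphaChain P l ii jj ss m *
      alpha P (ii (m + 1)) (jj (m + 1)) (l + 1 - 2 * (m + 1)) (ss (m + 1))

/-- `α_{i₁,j₁,l-2}^{s₁} ⋯ α_{i_m,j_m,l-2m}^{s_m}`. -/
def alphaChainBar (P : Params R) (l : ℕ) (ii jj : ℕ → ℕ) (ss : ℕ → ℤ) : ℕ → Alg P
  | 0 => 1
  | m + 1 => alphaChainBar P l ii jj ss m *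
      alpha P (ii (m + 1)) (jj (m + 1)) (l - 2 * (m + 1)) (ss (m + 1))

/-- `E_{l,m} = e_{l-1} e_{l-3} ⋯ e_{l-2m+1}`. -/
def Echain (P : Params R) (l : ℕ) : ℕ → Alg P
  | 0 => 1
  | m + 1 => Echain P l m * Eg P (l + 1 - 2 * (m + 1))

/-- The set `V_{l,m}^g`. -/
def Vg (P : Params R) (l m : ℕ) : Set (Alg P) :=
  {x | ∃ ii jj : ℕ → ℕ, ∃ ss : ℕ → ℤ,
    (∀ t, 1 ≤ t → t ≤ m →
      1 ≤ ii t ∧ ii t ≤ jj t ∧ jj t ≤ l + 1 - 2 * t ∧ ss t ∈ Pset P.k) ∧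
    x = alphaChain P l ii jj ss m}

/-- The set `V_{l,m}`. -/
def V (P : Params R) (l m : ℕ) : Set (Alg P) :=
  {x | ∃ ii jj : ℕ → ℕ, ∃ ss : ℕ → ℤ,
    (∀ t, 1 ≤ t → t ≤ m →
      1 ≤ ii t ∧ ii t ≤ jj t ∧ jj t ≤ l + 1 - 2 * t ∧ ss t ∈ Pset P.k) ∧
    (∀ t, 1 ≤ t → t + 1 ≤ m → ii (t + 1) < ii t) ∧
    x = alphaChain P l ii jj ss m}

/-- The set `V̄_{l,m}`. -/
def Vbar (P : Params R) (l m : ℕ) : Set (Alg P) :=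
  {x | ∃ ii jj : ℕ → ℕ, ∃ ss : ℕ → ℤ,
    (∀ t, 1 ≤ t → t ≤ m →
      1 ≤ ii t ∧ ii t ≤ jj t ∧ jj t ≤ l + 1 - 2 * t ∧ ss t ∈ Pset P.k) ∧
    (∀ t, 1 ≤ t → t + 1 ≤ m → ii (t + 1) < ii t) ∧
    x = alphaChainBar P l ii jj ss m}

end CBMW

open CBMW

namespace CBMW

section

variable {R : Type} [CommRing R] (P : Params R)

theorem pr_rel {a b : F R} (h : Rel P a b) : pr P a = pr P b :=
  RingQuot.mkAlgHom_rel R h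

theorem Xg_mul_Xgi (i : ℕ) : Xg P i * Xgi P i = 1 := by
  by_cases h : 1 ≤ i ∧ i ≤ P.n - 1
  · simpa [Xg, Xgi] using pr_rel P (Rel.X_inv_right h.1 h.2)
  · have h' : i = 0 ∨ P.n - 1 < i := by omega
    have h1 := pr_rel P (Rel.X_invalid h')
    have h2 := pr_rel P (Rel.Xi_invalid h')
    simp [Xg, Xgi, h1, h2]

theorem Xgi_mul_Xg (i : ℕ) : Xgi P i * Xg P i = 1 := by
  by_cases h : 1 ≤ i ∧ i ≤ P.n - 1
  · simpa [Xg, Xgi] using pr_rel P (Rel.X_inv_left h.1 h.2)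
  · have h' : i = 0 ∨ P.n - 1 < i := by omega
    have h1 := pr_rel P (Rel.X_invalid h')
    have h2 := pr_rel P (Rel.Xi_invalid h')
    simp [Xg, Xgi, h1, h2]

theorem Yg_mul_Ygi : Yg P * Ygi P = 1 := by
  simpa [Yg, Ygi] using pr_rel P Rel.Y_inv_right

theorem Ygi_mul_Yg : Ygi P * Yg P = 1 := by
  simpa [Yg, Ygi] using pr_rel P Rel.Y_inv_left

theorem Xg_eq_one {i : ℕ} (h : i = 0 ∨ P.n - 1 < i) : Xg P i = 1 := by
  simpa [Xg] using pr_rel P (Rel.X_invalid h)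

theorem Eg_eq_zero {i : ℕ} (h : i = 0 ∨ P.n - 1 < i) : Eg P i = 0 := by
  simpa [Eg] using pr_rel P (Rel.E_invalid h)

/-- The generator `Xᵢ` as a unit. -/
def xu (i : ℕ) : (Alg P)ˣ := ⟨Xg P i, Xgi P i, Xg_mul_Xgi P i, Xgi_mul_Xg P i⟩

/-- The generator `Y` as a unit. -/
def yu : (Alg P)ˣ := ⟨Yg P, Ygi P, Yg_mul_Ygi P, Ygi_mul_Yg P⟩

theorem commute_Xg_Xg {i j : ℕ} (h : i + 2 ≤ j ∨ j + 2 ≤ i) : Commute (Xg P i) (Xg P j) := by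
  by_cases hi : i = 0 ∨ P.n - 1 < i
  · rw [Xg_eq_one P hi]; exact Commute.one_left _
  by_cases hj : j = 0 ∨ P.n - 1 < j
  · rw [Xg_eq_one P hj]; exact Commute.one_right _
  unfold Commute SemiconjBy
  simpa [Xg] using pr_rel P
    (Rel.XX_far (i := i) (j := j) (by omega) (by omega) (by omega) (by omega) h)

theorem commute_Xg_Eg {i j : ℕ} (h : i + 2 ≤ j ∨ j + 2 ≤ i) : Commute (Xg P i) (Eg P j) := by
  by_cases hi : i = 0 ∨ P.n - 1 < i
  · rw [Xg_eq_one P hi]; exact Commute.one_left _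
  by_cases hj : j = 0 ∨ P.n - 1 < j
  · rw [Eg_eq_zero P hj]; exact Commute.zero_right _
  unfold Commute SemiconjBy
  simpa [Xg, Eg] using pr_rel P
    (Rel.XE_far (i := i) (j := j) (by omega) (by omega) (by omega) (by omega) h)

theorem commute_Eg_Eg {i j : ℕ} (h : i + 2 ≤ j ∨ j + 2 ≤ i) : Commute (Eg P i) (Eg P j) := by
  by_cases hi : i = 0 ∨ P.n - 1 < i
  · rw [Eg_eq_zero P hi]; exact Commute.zero_left _
  by_cases hj : j = 0 ∨ P.n - 1 < j
  · rw [Eg_eq_zero P hj]; exact Commute.zero_right _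
  unfold Commute SemiconjBy
  simpa [Eg] using pr_rel P
    (Rel.EE_far (i := i) (j := j) (by omega) (by omega) (by omega) (by omega) h)

theorem commute_Xgi_of_commute {i : ℕ} {a : Alg P} (h : Commute a (Xg P i)) :
    Commute a (Xgi P i) :=
  (Commute.units_inv_right (u := xu P i) h : _)

theorem commute_Yg_Xg {i : ℕ} (h : 2 ≤ i) : Commute (Yg P) (Xg P i) := by
  by_cases hi : i = 0 ∨ P.n - 1 < i
  · rw [Xg_eq_one P hi]; exact Commute.one_right _
  unfold Commute SemiconjBy
  simpa [Xg, Yg] using pr_rel P (Rel.YX_comm (i := i) h (by omega))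

theorem commute_Yg_Eg {i : ℕ} (h : 2 ≤ i) : Commute (Yg P) (Eg P i) := by
  by_cases hi : i = 0 ∨ P.n - 1 < i
  · rw [Eg_eq_zero P hi]; exact Commute.zero_right _
  unfold Commute SemiconjBy
  simpa [Eg, Yg] using pr_rel P (Rel.YE_comm (i := i) h (by omega))

section
variable {P}
variable {i j : ℕ} (h1 : 1 ≤ i) (h2 : i + 1 ≤ P.n)
include h1 h2

theorem skein_rel : Xg P i - Xgi P i = P.delta • (1 - Eg P i) := by
  simpa [Xg, Xgi, Eg] using pr_rel P (Rel.skein h1 (by omega))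

theorem Xg_mul_Eg : Xg P i * Eg P i = (P.lam : R) • Eg P i := by
  simpa [Xg, Eg] using pr_rel P (Rel.untwist_right h1 (by omega))

theorem Eg_mul_Xg : Eg P i * Xg P i = (P.lam : R) • Eg P i := by
  simpa [Xg, Eg] using pr_rel P (Rel.untwist_left h1 (by omega))

theorem Xgi_mul_Eg : Xgi P i * Eg P i = P.laminv • Eg P i := by
  have h := congrArg (Xgi P i * P.laminv • ·) (Xg_mul_Eg h1 h2)
  simpa [Params.laminv, smul_smul, ← mul_assoc, Xgi_mul_Xg] using h.symm

end

section
variable {P}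
variable {i j : ℕ} (h1 : 1 ≤ i) (h2 : i + 1 ≤ P.n) (h3 : 1 ≤ j) (h4 : j + 1 ≤ P.n)
  (h : j = i + 1 ∨ i = j + 1)

theorem Xg_braid (h1 : 1 ≤ i) (h2 : i + 2 ≤ P.n) :
    Xg P i * Xg P (i + 1) * Xg P i = Xg P (i + 1) * Xg P i * Xg P (i + 1) := by
  simpa [Xg] using pr_rel P (Rel.braid h1 (by omega))

include h1 h2 h3 h4 h

theorem Xg_Xg_Eg : Xg P i * Xg P j * Eg P i = Eg P j * Eg P i := by
  simpa [Xg, Eg] using pr_rel P (Rel.XXE h1 (by omega) h3 (by omega) h)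

theorem Eg_Xg_Xg : Eg P j * Xg P i * Xg P j = Eg P j * Eg P i := by
  simpa [Xg, Eg] using (pr_rel P (Rel.EXX h1 (by omega) h3 (by omega) h)).symm

theorem Eg_Eg_Eg : Eg P i * Eg P j * Eg P i = Eg P i := by
  rcases h with rfl | rfl
  · simpa [Eg] using pr_rel P (Rel.EEE_up h1 (by omega))
  · simpa [Eg] using pr_rel P (Rel.EEE_down h3 (by omega))

/-- `e_j X_i X_j = X_i X_j e_i`. -/
theorem Eg_Xg_Xg_comm : Eg P j * Xg P i * Xg P j = Xg P i * Xg P j * Eg P i := by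
  rw [Eg_Xg_Xg h1 h2 h3 h4 h, Xg_Xg_Eg h1 h2 h3 h4 h]

theorem Xg_Eg_eq : Xg P j * Eg P i = Xgi P i * Eg P j * Eg P i := by
  rw [mul_assoc, ← Xg_Xg_Eg h1 h2 h3 h4 h, mul_assoc, ← mul_assoc, Xgi_mul_Xg, one_mul]

theorem Xg_Eg_Eg : Xg P j * Eg P i * Eg P j = Xgi P i * Eg P j := by
  rw [Xg_Eg_eq h1 h2 h3 h4 h, mul_assoc, mul_assoc, ← mul_assoc (Eg P j),
    Eg_Eg_Eg h3 h4 h1 h2 h.symm]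

theorem Eg_Xg_eq : Eg P j * Xg P i = Eg P j * Eg P i * Xgi P j := by
  rw [← Eg_Xg_Xg h1 h2 h3 h4 h, mul_assoc, Xg_mul_Xgi, mul_one]

theorem Eg_Eg_Xg : Eg P i * Eg P j * Xg P i = Eg P i * Xgi P j := by
  rw [mul_assoc, Eg_Xg_eq h1 h2 h3 h4 h, ← mul_assoc, ← mul_assoc, Eg_Eg_Eg h1 h2 h3 h4 h]

theorem Xgi_Eg_eq : Xgi P j * Eg P i = Xg P i * Eg P j * Eg P i := by
  have h1 := Xg_Eg_Eg h3 h4 h1 h2 h.symm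
  exact h1.symm

theorem Eg_Xgi_eq : Eg P j * Xgi P i = Eg P j * Eg P i * Xg P j :=
  (Eg_Eg_Xg h3 h4 h1 h2 h.symm).symm

theorem Eg_Xg_Eg : Eg P j * Xg P i * Eg P j = P.laminv • Eg P j := by
  rw [Eg_Xg_eq h1 h2 h3 h4 h, mul_assoc, Xgi_mul_Eg h3 h4, mul_smul_comm,
    Eg_Eg_Eg h3 h4 h1 h2 h.symm]

end

theorem Yp_one : Yp P 1 = Yg P := by simp [Yp, downX, upX]

theorem Yp_succ {i : ℕ} (h : 1 ≤ i) : Yp P (i + 1) = Xg P i * Yp P i * Xg P i := by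
  obtain ⟨i, rfl⟩ := Nat.exists_eq_add_of_le' h
  simp [Yp, downX, upX, mul_assoc]

theorem YpInv_succ {i : ℕ} (h : 1 ≤ i) : YpInv P (i + 1) = Xgi P i * YpInv P i * Xgi P i := by
  obtain ⟨i, rfl⟩ := Nat.exists_eq_add_of_le' h
  simp [YpInv, downXi, upXi, mul_assoc]

theorem Yp_mul_YpInv (i : ℕ) : Yp P i * YpInv P i = 1 := by
  obtain h | h : i ≤ 1 ∨ 1 ≤ i := by omega
  · have : i - 1 = 0 := by omega
    simp [Yp, YpInv, this, downX, upX, downXi, upXi, Yg_mul_Ygi]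
  · induction i, h using Nat.le_induction with
    | base => simp [Yp, YpInv, downX, upX, downXi, upXi, Yg_mul_Ygi]
    | succ i hi ih =>
      rw [Yp_succ P hi, YpInv_succ P hi]
      have := Xg_mul_Xgi P i
      grind

theorem YpInv_mul_Yp (i : ℕ) : YpInv P i * Yp P i = 1 := by
  obtain h | h : i ≤ 1 ∨ 1 ≤ i := by omega
  · have : i - 1 = 0 := by omega
    simp [Yp, YpInv, this, downX, upX, downXi, upXi, Ygi_mul_Yg]
  · induction i, h using Nat.le_induction with
    | base => simp [Yp, YpInv, downX, upX, downXi, upXi, Ygi_mul_Yg]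
    | succ i hi ih =>
      rw [Yp_succ P hi, YpInv_succ P hi]
      have := Xgi_mul_Xg P i
      grind

/-- `Yᵢ'` as a unit. -/
def ypu (i : ℕ) : (Alg P)ˣ := ⟨Yp P i, YpInv P i, Yp_mul_YpInv P i, YpInv_mul_Yp P i⟩

theorem Ypow_eq (i : ℕ) (p : ℤ) : Ypow P i p = ((ypu P i ^ p : (Alg P)ˣ) : Alg P) := by
  unfold Ypow
  split_ifs with h
  · lift p to ℕ using h
    simp [ypu]
  · obtain ⟨m, rfl⟩ : ∃ m : ℕ, p = -m := ⟨(-p).toNat, by omega⟩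
    simp only [neg_neg, Int.toNat_natCast, zpow_neg, zpow_natCast]
    rw [← inv_pow, Units.val_pow_eq_pow_val]
    rfl

theorem Ypow_zero (i : ℕ) : Ypow P i 0 = 1 := by simp [Ypow_eq]

theorem Ypow_one (i : ℕ) : Ypow P i 1 = Yp P i := by simp [Ypow_eq, ypu]

theorem Ypow_neg_one (i : ℕ) : Ypow P i (-1) = YpInv P i := by
  simp [Ypow]

theorem Ypow_add (i : ℕ) (p q : ℤ) : Ypow P i (p + q) = Ypow P i p * Ypow P i q := by
  simp [Ypow_eq, zpow_add]

theorem commute_Ypow {i : ℕ} {a : Alg P} (h : Commute a (Yp P i)) (p : ℤ) :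
    Commute a (Ypow P i p) := by
  rw [Ypow_eq]
  exact Commute.units_zpow_right (u := ypu P i) h p

theorem commute_Yp_Xg_of_lt {i a : ℕ} (h : i < a) (hi : 1 ≤ i) : Commute (Xg P a) (Yp P i) := by
  induction i, hi using Nat.le_induction with
  | base => rw [Yp_one]; exact (commute_Yg_Xg P h).symm
  | succ i hi ih =>
    rw [Yp_succ P hi]
    have h1 := commute_Xg_Xg P (i := a) (j := i) (by omega)
    exact (h1.mul_right (ih (by omega))).mul_right h1

theorem commute_Yp_Eg_of_lt {i a : ℕ} (h : i < a) (hi : 1 ≤ i) : Commute (Eg P a) (Yp P i) := by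
  induction i, hi using Nat.le_induction with
  | base => rw [Yp_one]; exact (commute_Yg_Eg P h).symm
  | succ i hi ih =>
    rw [Yp_succ P hi]
    have h1 := (commute_Xg_Eg P (i := i) (j := a) (by omega)).symm
    exact (h1.mul_right (ih (by omega))).mul_right h1

theorem commute_Yp_Xg_of_gt {i a : ℕ} (h : a + 2 ≤ i) (ha : 1 ≤ a) (hi : i ≤ P.n) :
    Commute (Xg P a) (Yp P i) := by
  induction i, h using Nat.le_induction with
  | base =>
    rw [Yp_succ P (by omega), Yp_succ P ha]
    have h1 := Xg_braid (P := P) (i := a) ha (by omega)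
    have h2 := commute_Yp_Xg_of_lt P (i := a) (a := a + 1) (by omega) ha
    unfold Commute SemiconjBy at *
    linear_combination (norm := noncomm_ring) h1 * (Yp P a * Xg P a * Xg P (a + 1))
      + Xg P (a + 1) * Xg P a * h2 * (Xg P a * Xg P (a + 1))
      - Xg P (a + 1) * Xg P a * Yp P a * h1
  | succ i hi' ih =>
    rw [Yp_succ P (by omega)]
    have h1 := commute_Xg_Xg P (i := a) (j := i) (by omega)
    exact (h1.mul_right (ih (by omega))).mul_right h1

theorem commute_Yp_Eg_of_gt {i a : ℕ} (h : a + 2 ≤ i) (ha : 1 ≤ a) (hi : i ≤ P.n) :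
    Commute (Eg P a) (Yp P i) := by
  induction i, h using Nat.le_induction with
  | base =>
    rw [Yp_succ P (by omega), Yp_succ P ha]
    have h1 := Eg_Xg_Xg_comm (P := P) (i := a + 1) (j := a) (by omega) (by omega) ha (by omega)
      (by omega)
    have h3 := Eg_Xg_Xg_comm (P := P) (i := a) (j := a + 1) (by omega) (by omega) (by omega)
      (by omega) (by omega)
    have h2 := commute_Yp_Eg_of_lt P (i := a) (a := a + 1) (by omega) ha
    unfold Commute SemiconjBy at *
    linear_combination (norm := noncomm_ring) h1 * (Yp P a * Xg P a * Xg P (a + 1))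
      + Xg P (a + 1) * Xg P a * h2 * (Xg P a * Xg P (a + 1))
      + Xg P (a + 1) * Xg P a * Yp P a * h3
  | succ i hi' ih =>
    rw [Yp_succ P (by omega)]
    have h1 := (commute_Xg_Eg P (i := i) (j := a) (by omega)).symm
    exact (h1.mul_right (ih (by omega))).mul_right h1

theorem commute_Yp_Yg {i : ℕ} (h : 1 ≤ i) (hi : i ≤ P.n) : Commute (Yg P) (Yp P i) := by
  induction i, h using Nat.le_induction with
  | base => rw [Yp_one]
  | succ i hi' ih =>
    obtain rfl | h := hi'.eq_or_lt
    · rw [Yp_succ P le_rfl, Yp_one]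
      have : Xg P 1 * Yg P * Xg P 1 * Yg P = Yg P * Xg P 1 * Yg P * Xg P 1 := by
        simpa [Xg, Yg] using pr_rel P (Rel.braidB hi)
      unfold Commute SemiconjBy
      grind
    · rw [Yp_succ P (by omega)]
      have h1 := commute_Yg_Xg P (i := i) (by omega)
      exact (h1.mul_right (ih (by omega))).mul_right h1

theorem Xgi_eq_Xg_of_lt {i : ℕ} (h : i = 0 ∨ P.n - 1 < i) : Xgi P i = 1 := by
  simpa [Xgi] using pr_rel P (Rel.Xi_invalid h)

/-- `Xᵢ⁻¹` lies in every submodule containing `1`, `Xᵢ` and `eᵢ`. -/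
theorem Xgi_eq (i : ℕ) : ∃ c : R, Xgi P i = Xg P i - c • (1 - Eg P i) := by
  by_cases hi : i = 0 ∨ P.n - 1 < i
  · exact ⟨0, by simp [Xgi_eq_Xg_of_lt P hi, Xg_eq_one P hi]⟩
  · exact ⟨P.delta, by rw [← skein_rel (by omega) (by omega)]; abel⟩

/-- The elements whose left multiplication preserves a submodule. -/
def lstab {A : Type*} [Ring A] [Algebra R A] (N : Submodule R A) : Subalgebra R A where
  carrier := {b | ∀ x ∈ N, b * x ∈ N}
  mul_mem' := fun ha hb x hx => by rw [mul_assoc]; exact ha _ (hb _ hx)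
  add_mem' := fun ha hb x hx => by rw [add_mul]; exact N.add_mem (ha _ hx) (hb _ hx)
  algebraMap_mem' := fun r x hx => by rw [← Algebra.smul_def]; exact N.smul_mem _ hx

theorem mem_lstab_span {A : Type*} [Ring A] [Algebra R A] {s : Set A} {b : A}
    (h : ∀ x ∈ s, b * x ∈ Submodule.span R s) : b ∈ lstab (Submodule.span R s) := by
  intro x hx
  induction hx using Submodule.span_induction with
  | mem x hx => exact h x hx
  | zero => simp
  | add x y _ _ hx hy => rw [mul_add]; exact Submodule.add_mem _ hx hy
  | smul c x _ hx => rw [mul_smul_comm]; exact Submodule.smul_mem _ _ hx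

variable {P}

theorem Bsub_le {m : ℕ} {S : Subalgebra R (Alg P)} (hY : Yg P ∈ S) (hYi : Ygi P ∈ S)
    (hX : ∀ a, 1 ≤ a → a + 1 ≤ m → Xg P a ∈ S) (hE : ∀ a, 1 ≤ a → a + 1 ≤ m → Eg P a ∈ S) :
    Bsub P m ≤ S := by
  refine Algebra.adjoin_le ?_
  rintro x ((rfl | rfl) | ⟨a, h1, h2, rfl | rfl | rfl⟩)
  · exact hY
  · exact hYi
  · exact hX a h1 h2
  · obtain ⟨c, hc⟩ := Xgi_eq P a
    rw [hc]
    exact S.sub_mem (hX a h1 h2) (S.smul_mem (S.sub_mem S.one_mem (hE a h1 h2)) c)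
  · exact hE a h1 h2

theorem Yg_mem (m : ℕ) : Yg P ∈ Bsub P m := Algebra.subset_adjoin (by simp)

theorem Ygi_mem (m : ℕ) : Ygi P ∈ Bsub P m := Algebra.subset_adjoin (by simp)

theorem Xg_mem {m a : ℕ} (h1 : 1 ≤ a) (h2 : a + 1 ≤ m) : Xg P a ∈ Bsub P m :=
  Algebra.subset_adjoin (Or.inr ⟨a, h1, h2, by simp⟩)

theorem Xgi_mem {m a : ℕ} (h1 : 1 ≤ a) (h2 : a + 1 ≤ m) : Xgi P a ∈ Bsub P m :=
  Algebra.subset_adjoin (Or.inr ⟨a, h1, h2, by simp⟩)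

theorem Eg_mem {m a : ℕ} (h1 : 1 ≤ a) (h2 : a + 1 ≤ m) : Eg P a ∈ Bsub P m :=
  Algebra.subset_adjoin (Or.inr ⟨a, h1, h2, by simp⟩)

theorem Bsub_mono {m m' : ℕ} (h : m ≤ m') : Bsub P m ≤ Bsub P m' :=
  Bsub_le (Yg_mem _) (Ygi_mem _) (fun _ h1 _ => Xg_mem h1 (by omega))
    (fun _ h1 _ => Eg_mem h1 (by omega))

theorem Ypow_mem_of {S : Subalgebra R (Alg P)} {i : ℕ} (h : Yp P i ∈ S) (h' : YpInv P i ∈ S)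
    (p : ℤ) : Ypow P i p ∈ S := by
  unfold Ypow
  split_ifs
  · exact S.pow_mem h _
  · exact S.pow_mem h' _

theorem Ypow_mem {i m : ℕ} (h1 : 1 ≤ i) (h : i ≤ m) (p : ℤ) : Ypow P i p ∈ Bsub P m := by
  have : ∀ i, 1 ≤ i → i ≤ m → Yp P i ∈ Bsub P m ∧ YpInv P i ∈ Bsub P m := by
    intro i h1
    induction i, h1 using Nat.le_induction with
    | base =>
      intro _
      rw [Yp_one]
      exact ⟨Yg_mem _, by simpa [YpInv, downXi, upXi] using Ygi_mem m⟩
    | succ i hi ih =>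
      intro h
      obtain ⟨h3, h4⟩ := ih (by omega)
      rw [Yp_succ P hi, YpInv_succ P hi]
      have h5 := Xg_mem (P := P) hi h
      have h6 := Xgi_mem (P := P) hi h
      exact ⟨mul_mem (mul_mem h5 h3) h5, mul_mem (mul_mem h6 h4) h6⟩
  exact Ypow_mem_of (this i h1 h).1 (this i h1 h).2 p

theorem commute_of_mem_Bsub {m : ℕ} {z b : Alg P} (hY : Commute z (Yg P))
    (hX : ∀ a, 1 ≤ a → a + 1 ≤ m → Commute z (Xg P a))
    (hE : ∀ a, 1 ≤ a → a + 1 ≤ m → Commute z (Eg P a)) (hb : b ∈ Bsub P m) : Commute z b := by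
  have : Bsub P m ≤ Subalgebra.centralizer R {z} := by
    have key : ∀ x, Commute z x → x ∈ Subalgebra.centralizer R {z} := fun x hx => by
      rw [Subalgebra.mem_centralizer_iff]
      rintro _ rfl
      exact hx
    exact Bsub_le (key _ hY) (key _ (Commute.units_inv_right (u := yu P) hY :))
      (fun a h1 h2 => key _ (hX a h1 h2)) (fun a h1 h2 => key _ (hE a h1 h2))
  exact (Subalgebra.mem_centralizer_iff R).1 (this hb) z rfl

theorem commute_Xg_of_mem_Bsub {m a : ℕ} {b : Alg P} (h : m + 1 ≤ a) (ha : 2 ≤ a)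
    (hb : b ∈ Bsub P m) : Commute (Xg P a) b :=
  commute_of_mem_Bsub (commute_Yg_Xg P ha).symm
    (fun _ _ _ => commute_Xg_Xg P (by omega)) (fun _ _ _ => commute_Xg_Eg P (by omega)) hb

theorem commute_Eg_of_mem_Bsub {m a : ℕ} {b : Alg P} (h : m + 1 ≤ a) (ha : 2 ≤ a)
    (hb : b ∈ Bsub P m) : Commute (Eg P a) b :=
  commute_of_mem_Bsub (commute_Yg_Eg P ha).symm
    (fun _ _ _ => (commute_Xg_Eg P (by omega)).symm) (fun _ _ _ => commute_Eg_Eg P (by omega)) hb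

theorem commute_Ypow_of_mem_Bsub {m i : ℕ} {b : Alg P} (h : m + 1 ≤ i) (hi : i ≤ P.n) (p : ℤ)
    (hb : b ∈ Bsub P m) : Commute b (Ypow P i p) := by
  refine commute_Ypow P (commute_of_mem_Bsub (commute_Yp_Yg P (by omega) hi).symm
    (fun a h1 h2 => (commute_Yp_Xg_of_gt P (by omega) h1 hi).symm)
    (fun a h1 h2 => (commute_Yp_Eg_of_gt P (by omega) h1 hi).symm) hb).symm p

theorem commute_Ypow_Ypow {i j : ℕ} (hi : 1 ≤ i) (hj : 1 ≤ j) (hi' : i ≤ P.n) (hj' : j ≤ P.n)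
    (p q : ℤ) : Commute (Ypow P i p) (Ypow P j q) := by
  obtain h | h | h := lt_trichotomy i j
  · exact commute_Ypow_of_mem_Bsub (m := i) h hj' q (Ypow_mem hi le_rfl p)
  · subst h
    rw [Ypow_eq, Ypow_eq]
    exact ((Commute.refl (ypu P i)).zpow_zpow p q).map (Units.coeHom _)
  · exact (commute_Ypow_of_mem_Bsub (m := j) h hi' p (Ypow_mem hj le_rfl q)).symm

theorem Yp_Xg_Yp_Eg {i : ℕ} (h1 : 1 ≤ i) (h2 : i + 1 ≤ P.n) :
    Yp P i * Xg P i * Yp P i * Eg P i = P.laminv • Eg P i := by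
  induction i, h1 using Nat.le_induction with
  | base =>
    rw [Yp_one]
    simpa [Xg, Yg, Eg] using pr_rel P (Rel.YXYE h2)
  | succ i hi ih =>
    have ih := ih (by omega)
    have hE := Xg_Xg_Eg (P := P) (i := i + 1) (j := i) (by omega) h2 hi (by omega) (by omega)
    have hB := Xg_braid (P := P) hi h2
    have hXY := commute_Yp_Xg_of_lt P (i := i) (a := i + 1) (by omega) hi
    have hEE := Xg_Xg_Eg (P := P) hi (by omega) (by omega) h2 (by omega)
    have heee := Eg_Eg_Eg (P := P) (i := i + 1) (j := i) (by omega) h2 hi (by omega) (by omega)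
    unfold Commute SemiconjBy at hXY
    rw [Yp_succ P hi]
    calc _ = Xg P i * Xg P (i + 1) * (Yp P i * Xg P i * Yp P i * Eg P i) * Eg P (i + 1) := by
            linear_combination (norm := noncomm_ring)
              Xg P i * Yp P i * hB * (Yp P i * Xg P i * Eg P (i + 1))
              - Xg P i * hXY * (Xg P i * Xg P (i + 1) * Yp P i * Xg P i * Eg P (i + 1))
              + Xg P i * Xg P (i + 1) * Yp P i * Xg P i * hXY * (Xg P i * Eg P (i + 1))
              + Xg P i * Xg P (i + 1) * Yp P i * Xg P i * Yp P i * hE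
      _ = _ := by
            rw [ih, mul_smul_comm, smul_mul_assoc, hEE, heee]

theorem Eg_Yp_Xg_Yp {i : ℕ} (h1 : 1 ≤ i) (h2 : i + 1 ≤ P.n) :
    Eg P i * (Yp P i * Xg P i * Yp P i) = P.laminv • Eg P i := by
  induction i, h1 using Nat.le_induction with
  | base =>
    rw [Yp_one]
    simpa [Xg, Yg, Eg] using pr_rel P (Rel.EYXY h2)
  | succ i hi ih =>
    have ih := ih (by omega)
    have hE := Eg_Xg_Xg (P := P) (i := i) (j := i + 1) hi (by omega) (by omega) h2 (by omega)
    have hB := Xg_braid (P := P) hi h2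
    have hXY := commute_Yp_Xg_of_lt P (i := i) (a := i + 1) (by omega) hi
    have hEE := Eg_Xg_Xg (P := P) (i := i + 1) (j := i) (by omega) h2 hi (by omega) (by omega)
    have heee := Eg_Eg_Eg (P := P) (i := i + 1) (j := i) (by omega) h2 hi (by omega) (by omega)
    unfold Commute SemiconjBy at hXY
    rw [Yp_succ P hi]
    calc _ = Eg P (i + 1) * (Eg P i * (Yp P i * Xg P i * Yp P i)) * Xg P (i + 1) * Xg P i := by
            linear_combination (norm := noncomm_ring)
              Eg P (i + 1) * Xg P i * Yp P i * hB * (Yp P i * Xg P i)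
              - Eg P (i + 1) * Xg P i * hXY * (Xg P i * Xg P (i + 1) * Yp P i * Xg P i)
              + Eg P (i + 1) * Xg P i * Xg P (i + 1) * Yp P i * Xg P i * hXY * Xg P i
              + hE * (Yp P i * Xg P i * Yp P i * Xg P (i + 1) * Xg P i)
      _ = _ := by
            rw [ih, mul_smul_comm, smul_mul_assoc, smul_mul_assoc, mul_assoc, mul_assoc,
              ← mul_assoc (Eg P i), hEE, ← mul_assoc, heee]

theorem Yp_succ_mul_Eg {i : ℕ} (h1 : 1 ≤ i) (h2 : i + 1 ≤ P.n) :
    Yp P (i + 1) * Eg P i = YpInv P i * Eg P i := by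
  rw [← one_mul (Yp P (i + 1) * _), ← YpInv_mul_Yp P i, mul_assoc, Yp_succ P h1,
    mul_assoc _ _ (Eg P i), Xg_mul_Eg h1 h2]
  simp only [mul_smul_comm]
  rw [mul_assoc, ← mul_assoc (Yp P i), ← mul_assoc (Yp P i * _), Yp_Xg_Yp_Eg h1 h2, mul_smul_comm, smul_smul, Params.laminv,
    Units.mul_inv, one_smul]

theorem Eg_mul_Yp_succ {i : ℕ} (h1 : 1 ≤ i) (h2 : i + 1 ≤ P.n) :
    Eg P i * Yp P (i + 1) = Eg P i * YpInv P i := by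
  rw [← mul_one (Eg P i * Yp P (i + 1)), ← Yp_mul_YpInv P i, Yp_succ P h1, ← mul_assoc,
    ← mul_assoc, ← mul_assoc, Eg_mul_Xg h1 h2]
  simp only [smul_mul_assoc]
  rw [mul_assoc (Eg P i), mul_assoc (Eg P i), Eg_Yp_Xg_Yp h1 h2, smul_mul_assoc, smul_smul,
    Params.laminv, Units.mul_inv, one_smul]

theorem Ypow_succ_mul_Eg {i : ℕ} (h1 : 1 ≤ i) (h2 : i + 1 ≤ P.n) (p : ℤ) :
    Ypow P (i + 1) p * Eg P i = Ypow P i (-p) * Eg P i := by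
  have hc := commute_Ypow_Ypow (P := P) h1 (by omega : 1 ≤ i + 1) (by omega) h2
  have h := Yp_succ_mul_Eg h1 h2
  rw [← Ypow_one, ← Ypow_neg_one] at h
  have h' : Ypow P (i + 1) (-1) * Eg P i = Ypow P i 1 * Eg P i := by
    have h3 := congrArg (Ypow P i 1 * Ypow P (i + 1) (-1) * ·) h
    simp only [mul_assoc] at h3
    rw [← mul_assoc (Ypow P (i + 1) (-1)), ← Ypow_add, ← mul_assoc (Ypow P (i + 1) (-1)),
      ((hc (-1) (-1)).eq).symm, mul_assoc, ← mul_assoc (Ypow P i 1) (Ypow P i (-1)), ← Ypow_add P i 1] at h3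
    simpa [Ypow_zero] using h3.symm
  induction p using Int.induction_on with
  | zero => simp [Ypow_zero]
  | succ p ih =>
    rw [Ypow_add, mul_assoc, h, ← mul_assoc, ((hc _ _).eq).symm, mul_assoc, ih, ← mul_assoc,
      ← Ypow_add]
    congr 2; ring
  | pred p ih =>
    rw [sub_eq_add_neg, Ypow_add, mul_assoc, h', ← mul_assoc, ((hc _ _).eq).symm, mul_assoc, ih,
      ← mul_assoc, ← Ypow_add]
    congr 2; ring

theorem Eg_mul_Ypow_succ {i : ℕ} (h1 : 1 ≤ i) (h2 : i + 1 ≤ P.n) (p : ℤ) :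
    Eg P i * Ypow P (i + 1) p = Eg P i * Ypow P i (-p) := by
  have hc := commute_Ypow_Ypow (P := P) h1 (by omega : 1 ≤ i + 1) (by omega) h2
  have h := Eg_mul_Yp_succ h1 h2
  rw [← Ypow_one, ← Ypow_neg_one] at h
  have h' : Eg P i * Ypow P (i + 1) (-1) = Eg P i * Ypow P i 1 := by
    have h3 := congrArg (· * (Ypow P (i + 1) (-1) * Ypow P i 1)) h
    simp only [mul_assoc] at h3
    rw [← mul_assoc (Ypow P (i + 1) 1), ← Ypow_add, ← mul_assoc (Ypow P i (-1)),
      (hc (-1) (-1)).eq, mul_assoc, ← Ypow_add] at h3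
    simpa [Ypow_zero] using h3.symm
  induction p using Int.induction_on with
  | zero => simp [Ypow_zero]
  | succ p ih =>
    rw [add_comm (p : ℤ), Ypow_add, ← mul_assoc, h, mul_assoc, (hc _ _).eq, ← mul_assoc, ih,
      mul_assoc, ← Ypow_add]
    congr 2; ring
  | pred p ih =>
    rw [sub_eq_add_neg, add_comm (-(p : ℤ)), Ypow_add, ← mul_assoc, h', mul_assoc, (hc _ _).eq,
      ← mul_assoc, ih, mul_assoc, ← Ypow_add]
    congr 2; ring

section
variable {A : Type*} [Ring A] [Algebra R A]

theorem mul_mul_mem_of_mem_span {N : Submodule R A} {S : Set A} {a b x : A}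
    (h : ∀ z ∈ S, a * z * b ∈ N) (hx : x ∈ Submodule.span R S) : a * x * b ∈ N :=
  (Submodule.span_le (p := N.comap (LinearMap.mulLeftRight R (a, b)))).2 h hx

theorem mem_mul_of_mem_span {N : Submodule R A} {S : Set A} {a x : A}
    (h : ∀ z ∈ S, a * z ∈ N) (hx : x ∈ Submodule.span R S) : a * x ∈ N :=
  (Submodule.span_le (p := N.comap (LinearMap.mulLeft R a))).2 h hx

theorem mul_mem_of_mem_span {N : Submodule R A} {S : Set A} {b x : A}
    (h : ∀ z ∈ S, z * b ∈ N) (hx : x ∈ Submodule.span R S) : x * b ∈ N :=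
  (Submodule.span_le (p := N.comap (LinearMap.mulRight R b))).2 h hx

/-- Moving `x` past a power of `y` when `x y = y' (x + d)`. -/
theorem exists_mul_zpow_eq (y y' : Aˣ) (x d : A) (h : x * y = y' * (x + d)) (p : ℤ) :
    ∃ s ∈ Submodule.span R {z : A | ∃ a b : ℤ, a + b = p ∧ (1 ≤ a ∧ a ≤ p ∨ p < a ∧ a ≤ 0) ∧
        z = ((y' ^ a : Aˣ) : A) * d * ((y ^ b : Aˣ) : A)},
      x * ((y ^ p : Aˣ) : A) = ((y' ^ p : Aˣ) : A) * x + s := by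
  induction p using Int.induction_on with
  | zero => exact ⟨0, Submodule.zero_mem _, by simp⟩
  | succ p ih =>
    obtain ⟨s, hs, e⟩ := ih
    refine ⟨((y' ^ (p + 1 : ℤ) : Aˣ) : A) * d + s * y, Submodule.add_mem _ ?_ ?_, ?_⟩
    · exact Submodule.subset_span ⟨p + 1, 0, by omega, by omega, by simp⟩
    · refine mul_mem_of_mem_span ?_ hs
      rintro _ ⟨a, b, h1, h2, rfl⟩
      refine Submodule.subset_span ⟨a, b + 1, by omega, by omega, ?_⟩
      rw [zpow_add_one, Units.val_mul, ← mul_assoc]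
    · rw [zpow_add_one, Units.val_mul, ← mul_assoc, e, zpow_add_one, Units.val_mul, add_mul,
        mul_assoc, h]
      simp only [mul_add, mul_assoc, add_assoc]
  | pred p ih =>
    obtain ⟨s, hs, e⟩ := ih
    have h' : x * ((y⁻¹ : Aˣ) : A) = ((y'⁻¹ : Aˣ) : A) * x - d * ((y⁻¹ : Aˣ) : A) := by
      have := congrArg (fun z => ((y'⁻¹ : Aˣ) : A) * z * ((y⁻¹ : Aˣ) : A)) h
      simp only [mul_assoc, Units.mul_inv, Units.inv_mul_cancel_left, add_mul, mul_one] at this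
      rw [this]; abel
    refine ⟨-(((y' ^ (-p : ℤ) : Aˣ) : A) * d * ((y⁻¹ : Aˣ) : A)) + s * ((y⁻¹ : Aˣ) : A),
      Submodule.add_mem _ (Submodule.neg_mem _ ?_) ?_, ?_⟩
    · exact Submodule.subset_span ⟨-p, -1, by omega, by omega, by simp⟩
    · refine mul_mem_of_mem_span ?_ hs
      rintro _ ⟨a, b, h1, h2, rfl⟩
      refine Submodule.subset_span ⟨a, b - 1, by omega, by omega, ?_⟩
      rw [zpow_sub_one, Units.val_mul, ← mul_assoc]
    · rw [zpow_sub_one, Units.val_mul, ← mul_assoc, e, zpow_sub_one, Units.val_mul, add_mul,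
        mul_assoc, h']
      simp only [mul_sub, mul_assoc]
      abel

end

end

section

variable {R : Type} [CommRing R] {P : Params R}

/-- The span of the elements `Yᵢ^a w Yⱼ^b` with `w ∈ {1, e_g}`, `a + b = p` and `C a`. -/
def YwY (P : Params R) (i j g : ℕ) (p : ℤ) (C : ℤ → Prop) : Submodule R (Alg P) :=
  Submodule.span R {z | ∃ a b : ℤ, ∃ w, (w = 1 ∨ w = Eg P g) ∧ a + b = p ∧ C a ∧
    z = Ypow P i a * w * Ypow P j b}

theorem mem_YwY {i j g : ℕ} {a b p : ℤ} {C : ℤ → Prop} (h : a + b = p) (hC : C a) (c : R) :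
    Ypow P i a * (c • (1 - Eg P g)) * Ypow P j b ∈ YwY P i j g p C := by
  rw [mul_smul_comm, smul_mul_assoc, mul_sub, sub_mul]
  exact Submodule.smul_mem _ _ (Submodule.sub_mem _
    (Submodule.subset_span ⟨a, b, 1, Or.inl rfl, h, hC, rfl⟩)
    (Submodule.subset_span ⟨a, b, _, Or.inr rfl, h, hC, rfl⟩))

section
variable {g : ℕ} (h1 : 1 ≤ g) (h2 : g + 1 ≤ P.n)
include h1 h2

theorem neg_delta_smul : (-P.delta) • (1 - Eg P g) = Xgi P g - Xg P g :=
  (neg_smul (M := Alg P) P.delta (1 - Eg P g)).trans (by rw [← skein_rel h1 h2]; abel)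

theorem Xg_mul_Ypow (p : ℤ) :
    ∃ s ∈ YwY P (g + 1) g g p (fun a => 1 ≤ a ∧ a ≤ p ∨ p < a ∧ a ≤ 0),
      Xg P g * Ypow P g p = Ypow P (g + 1) p * Xg P g + s := by
  obtain ⟨s, hs, e⟩ := exists_mul_zpow_eq (R := R) (ypu P g) (ypu P (g + 1)) (Xg P g)
    ((-P.delta) • (1 - Eg P g)) (by
      change Xg P g * Yp P g = Yp P (g + 1) * _
      rw [neg_delta_smul h1 h2, Yp_succ P h1]
      simp [mul_assoc, Xg_mul_Xgi]) p
  refine ⟨s, Submodule.span_le.2 ?_ hs, by simpa only [Ypow_eq] using e⟩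
  rintro _ ⟨a, b, h3, h4, rfl⟩
  rw [← Ypow_eq, ← Ypow_eq]
  exact mem_YwY h3 h4 _

theorem Ypow_mul_Xg (p : ℤ) :
    ∃ s ∈ YwY P g (g + 1) g p (fun a => p ≤ a ∧ a ≤ -1 ∨ 0 ≤ a ∧ a < p),
      Ypow P g p * Xg P g = Xg P g * Ypow P (g + 1) p + s := by
  obtain ⟨s, hs, e⟩ := exists_mul_zpow_eq (R := R) (ypu P (g + 1))⁻¹ (ypu P g)⁻¹ (Xg P g)
    ((-P.delta) • (1 - Eg P g)) (by
      change Xg P g * YpInv P (g + 1) = YpInv P g * _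
      rw [neg_delta_smul h1 h2, YpInv_succ P h1]
      simp [← mul_assoc, Xg_mul_Xgi]) (-p)
  refine ⟨-s, Submodule.neg_mem _ (Submodule.span_le.2 ?_ hs), ?_⟩
  · rintro _ ⟨a, b, h3, h4, rfl⟩
    rw [inv_zpow', inv_zpow', ← Ypow_eq, ← Ypow_eq]
    exact mem_YwY (by omega) (by omega) _
  · rw [inv_zpow', inv_zpow', neg_neg, ← Ypow_eq, ← Ypow_eq] at e
    rw [e]; abel

theorem Xgi_mul_Ypow (p : ℤ) (hp : 0 ≤ p) :
    ∃ s ∈ YwY P (g + 1) g g p (fun a => 0 ≤ a ∧ a < p),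
      Xgi P g * Ypow P g p = Ypow P (g + 1) p * Xgi P g + s := by
  have hs := skein_rel h1 h2
  obtain ⟨s, hs, e⟩ := exists_mul_zpow_eq (R := R) (ypu P g)⁻¹ (ypu P (g + 1))⁻¹ (Xgi P g)
    (P.delta • (1 - Eg P g)) (by
      change Xgi P g * YpInv P g = YpInv P (g + 1) * _
      rw [← hs, YpInv_succ P h1]
      simp [mul_assoc, Xgi_mul_Xg]) (-p)
  refine ⟨s, Submodule.span_le.2 ?_ hs, ?_⟩
  · rintro _ ⟨a, b, h3, h4, rfl⟩
    rw [inv_zpow', inv_zpow', ← Ypow_eq, ← Ypow_eq]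
    exact mem_YwY (by omega) (by omega) _
  · rwa [inv_zpow', inv_zpow', neg_neg, ← Ypow_eq, ← Ypow_eq] at e

end

theorem Ypow_one_mem_span (hk : 1 ≤ P.k) (hq0 : P.qc 0 = (P.q0 : R)) (lo p : ℤ) :
    Ypow P 1 p ∈ Submodule.span R {z | ∃ s : ℤ, lo ≤ s ∧ s < lo + P.k ∧ z = Ypow P 1 s} := by
  set N := Submodule.span R {z | ∃ s : ℤ, lo ≤ s ∧ s < lo + P.k ∧ z = Ypow P 1 s} with hN
  have mem : ∀ s : ℤ, lo ≤ s → s < lo + P.k → Ypow P 1 s ∈ N := fun s h1 h2 =>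
    Submodule.subset_span ⟨s, h1, h2, rfl⟩
  have cyc : ∀ t : ℤ, Ypow P 1 (P.k + t) =
      ∑ i ∈ Finset.range P.k, P.qc i • Ypow P 1 (i + t) := by
    intro t
    have h : Yg P ^ P.k = ∑ i ∈ Finset.range P.k, P.qc i • Yg P ^ i := by
      simpa [Yg] using pr_rel P Rel.cyclo
    have h' : ∀ i : ℕ, Ypow P 1 i = Yg P ^ i := fun i => by simp [Ypow, Yp_one]
    rw [Ypow_add, h', h, Finset.sum_mul]
    exact Finset.sum_congr rfl fun i _ => by rw [Ypow_add, h', smul_mul_assoc]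
  have up : Ypow P 1 1 ∈ lstab N := by
    refine mem_lstab_span ?_
    rintro _ ⟨s, h1, h2, rfl⟩
    rw [← Ypow_add]
    by_cases h : 1 + s < lo + P.k
    · exact mem _ (by omega) h
    · rw [show 1 + s = P.k + lo by omega, cyc]
      exact Submodule.sum_mem _ fun i hi => Submodule.smul_mem _ _
        (mem _ (by omega) (by have := Finset.mem_range.1 hi; omega))
  have down : Ypow P 1 (-1) ∈ lstab N := by
    refine mem_lstab_span ?_
    rintro _ ⟨s, h1, h2, rfl⟩
    rw [← Ypow_add]
    by_cases h : lo ≤ -1 + s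
    · exact mem _ h (by omega)
    · obtain rfl : s = lo := by omega
      have h3 := cyc (-1 + s)
      obtain ⟨k, hk'⟩ : ∃ k, P.k = k + 1 := ⟨P.k - 1, by omega⟩
      rw [hk', Finset.sum_range_succ', hq0] at h3
      have h4 : Ypow P 1 (-1 + s) = ((P.q0⁻¹ : Rˣ) : R) • (Ypow P 1 ((k + 1 : ℕ) + (-1 + s)) -
          ∑ i ∈ Finset.range k, P.qc (i + 1) • Ypow P 1 ((i + 1 : ℕ) + (-1 + s))) := by
        rw [h3]
        simp [smul_smul]
      rw [h4]
      refine Submodule.smul_mem _ _ (Submodule.sub_mem _ (mem _ (by push_cast; omega)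
        (by push_cast; omega)) (Submodule.sum_mem _ fun i hi => Submodule.smul_mem _ _
          (mem _ (by push_cast; omega) (by have := Finset.mem_range.1 hi; push_cast; omega))))
  have key : Ypow P 1 (p - lo) ∈ lstab N :=
    Ypow_mem_of (by rwa [Ypow_one] at up) (by rwa [Ypow_neg_one] at down) _
  have := key _ (mem lo le_rfl (by omega))
  rwa [← Ypow_add, sub_add_cancel] at this

/-- The submodule `S e_i`. -/
def BE (S : Subalgebra R (Alg P)) (i : ℕ) : Submodule R (Alg P) :=
  (Subalgebra.toSubmodule S).map (LinearMap.mulRight R (Eg P i))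

theorem mul_Eg_mem_BE {S : Subalgebra R (Alg P)} {i : ℕ} {b : Alg P} (hb : b ∈ S) :
    b * Eg P i ∈ BE S i :=
  ⟨b, hb, rfl⟩

theorem mul_mem_BE {S : Subalgebra R (Alg P)} {i : ℕ} {b x : Alg P} (hb : b ∈ S)
    (hx : x ∈ BE S i) : b * x ∈ BE S i := by
  obtain ⟨c, hc, rfl⟩ := hx
  rw [LinearMap.mulRight_apply, ← mul_assoc]
  exact mul_Eg_mem_BE (mul_mem hb hc)

/-- The coefficient algebra of `e_i`: the scalars for `i = 1`, and `B_{i-1}` otherwise. -/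
def coeffAlg (P : Params R) (i : ℕ) : Subalgebra R (Alg P) := if i = 1 then ⊥ else Bsub P (i - 1)

theorem coeffAlg_succ {i : ℕ} (h : 1 ≤ i) : coeffAlg P (i + 1) = Bsub P i := by
  simp [coeffAlg, show i ≠ 0 by omega]

theorem coeffAlg_le (i : ℕ) : coeffAlg P i ≤ Bsub P (i - 1) := by
  unfold coeffAlg
  split_ifs
  · exact bot_le
  · exact le_rfl

theorem commute_Eg_of_mem_coeffAlg {i t : ℕ} {b : Alg P} (hb : b ∈ coeffAlg P i) (hi : 1 ≤ i)
    (h : i ≤ t) : Commute (Eg P t) b := by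
  unfold coeffAlg at hb
  split_ifs at hb with h1
  · obtain ⟨c, rfl⟩ := Algebra.mem_bot.1 hb
    exact (Algebra.commutes c _).symm
  · exact commute_Eg_of_mem_Bsub (by omega) (by omega) hb

theorem commute_Eg_of_mem_Bsub_pred {i : ℕ} {b : Alg P} (h : 1 ≤ i) (hb : b ∈ Bsub P i) :
    Commute (Eg P (i + 1)) b :=
  commute_Eg_of_mem_Bsub (by omega) (by omega) hb

/-- The span of `Yᵢ^c b eᵢ` with `|c| ≤ d` and `b` in the coefficient algebra. -/
def YBE (P : Params R) (i : ℕ) (d : ℤ) : Submodule R (Alg P) :=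
  Submodule.span R {z | ∃ c : ℤ, ∃ b ∈ coeffAlg P i, |c| ≤ d ∧ z = Ypow P i c * b * Eg P i}

/-- Pieces `e_i Yᵢ^p e_i` are multiples of `e_i`. -/
def EYE (P : Params R) (i : ℕ) : Prop := ∀ p : ℤ, Eg P i * Ypow P i p * Eg P i ∈ BE (coeffAlg P i) i

theorem Eg_Eg {i : ℕ} (h1 : 1 ≤ i) (h2 : i + 1 ≤ P.n) : Eg P i * Eg P i = P.A 0 • Eg P i := by
  simpa [Eg] using pr_rel P (Rel.E_sq h1 (by omega))

section
variable {i : ℕ} (h1 : 1 ≤ i) (h2 : i + 1 ≤ P.n)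
include h1 h2

theorem Xg_Ypow_Eg_mem (H : EYE P i) (s : ℤ) : Xg P i * Ypow P i s * Eg P i ∈ YBE P i |s| := by
  obtain ⟨t, ht, e⟩ := Xg_mul_Ypow h1 h2 s
  rw [e, add_mul, mul_assoc, Xg_mul_Eg h1 h2, mul_smul_comm, Ypow_succ_mul_Eg h1 h2]
  have mem : ∀ (c : ℤ) (b : Alg P), b ∈ coeffAlg P i → |c| ≤ |s| →
      Ypow P i c * b * Eg P i ∈ YBE P i |s| :=
    fun c b hb hc => Submodule.subset_span ⟨c, b, hb, hc, rfl⟩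
  have mem1 : ∀ (c : ℤ), |c| ≤ |s| → Ypow P i c * Eg P i ∈ YBE P i |s| := fun c hc => by
    simpa using mem c 1 (one_mem _) hc
  refine Submodule.add_mem _ (Submodule.smul_mem _ _ (mem1 _ (by simp))) ?_
  refine mul_mem_of_mem_span ?_ ht
  rintro _ ⟨a, b, w, rfl | rfl, hab, hC, rfl⟩
  · rw [mul_one, (commute_Ypow_Ypow (by omega) h1 h2 (by omega) a b).eq, mul_assoc,
      Ypow_succ_mul_Eg h1 h2, ← mul_assoc, ← Ypow_add]
    exact mem1 _ (by grind)
  · obtain ⟨c, hc, e⟩ := H b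
    rw [LinearMap.mulRight_apply] at e
    rw [mul_assoc, mul_assoc, ← mul_assoc (Eg P i), ← e, ← mul_assoc,
      ← (commute_Ypow_of_mem_Bsub (i := i + 1) (m := i - 1) (by omega) h2 a (coeffAlg_le i hc)).eq, mul_assoc,
      Ypow_succ_mul_Eg h1 h2, ← mul_assoc,
      (commute_Ypow_of_mem_Bsub (i := i) (m := i - 1) (by omega) (by omega) _ (coeffAlg_le i hc)).eq]
    exact mem _ _ hc (by grind)

end

theorem YBE_le {i : ℕ} (h1 : 1 ≤ i) (d : ℤ) : YBE P i d ≤ BE (Bsub P i) i := by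
  refine Submodule.span_le.2 ?_
  rintro _ ⟨c, b, hb, -, rfl⟩
  exact mul_Eg_mem_BE (mul_mem (Ypow_mem h1 le_rfl c) (Bsub_mono (by omega) (coeffAlg_le i hb)))

theorem EYE_one (hk : 1 ≤ P.k) (hq0 : P.qc 0 = (P.q0 : R)) (h2 : 2 ≤ P.n) : EYE P 1 := by
  intro p
  refine mul_mul_mem_of_mem_span ?_ (Ypow_one_mem_span hk hq0 0 p)
  rintro _ ⟨s, h3, h4, rfl⟩
  lift s to ℕ using h3
  have : Eg P 1 * Ypow P 1 s * Eg P 1 = P.A s • Eg P 1 := by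
    have h' : Ypow P 1 s = Yg P ^ s := by simp [Ypow, Yp_one]
    rw [h']
    simpa [Eg, Yg] using pr_rel P (Rel.EYE h2 (m := s) (by omega))
  rw [this]
  exact Submodule.smul_mem _ _ (by simpa using mul_Eg_mem_BE (one_mem _))

section
variable {i : ℕ} (h1 : 1 ≤ i) (h2 : i + 1 ≤ P.n)
include h1 h2

theorem Xgi_Ypow_Eg_mem (H : EYE P i) (s : ℤ) : Xgi P i * Ypow P i s * Eg P i ∈ YBE P i |s| := by
  have mem1 : Ypow P i s * Eg P i ∈ YBE P i |s| :=
    Submodule.subset_span ⟨s, 1, one_mem _, le_rfl, by simp⟩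
  obtain ⟨c, hc⟩ := Xgi_eq P i
  rw [hc, sub_mul, sub_mul, smul_mul_assoc, smul_mul_assoc, sub_mul, sub_mul, one_mul]
  refine Submodule.sub_mem _ (Xg_Ypow_Eg_mem h1 h2 H s)
    (Submodule.smul_mem _ _ (Submodule.sub_mem _ mem1 ?_))
  obtain ⟨b, hb, e⟩ := H s
  rw [← e]
  exact Submodule.subset_span ⟨0, b, hb, by simp, by simp [Ypow_zero]⟩

end

section
variable {i : ℕ} (h1 : 1 ≤ i) (h2 : i + 2 ≤ P.n)
include h1

theorem mul_Eg_mul_mem_BE {b : Alg P} (hb : b ∈ BE (Bsub P i) (i + 1)) {y : Alg P} (hy : y ∈ Bsub P i) :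
    b * y ∈ BE (Bsub P i) (i + 1) := by
  obtain ⟨c, hc, rfl⟩ := hb
  rw [LinearMap.mulRight_apply, mul_assoc, (commute_Eg_of_mem_Bsub_pred h1 hy).eq, ← mul_assoc]
  exact mul_Eg_mem_BE (mul_mem hc hy)

include h2

/-- Conjugation by `Xᵢ^{±1}` between two `e_{i+1}`. -/
theorem Eg_conj_Eg (H : EYE P i) (p : ℤ) :
    Eg P (i + 1) * (Xg P i * Ypow P i p * Xgi P i) * Eg P (i + 1) ∈ BE (Bsub P i) (i + 1) ∧
    Eg P (i + 1) * (Xgi P i * Ypow P i p * Xg P i) * Eg P (i + 1) ∈ BE (Bsub P i) (i + 1) := by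
  have h4 : i + 1 = i + 1 ∨ i = i + 1 + 1 := Or.inl rfl
  have e1 := Eg_Xg_eq h1 (by omega) (by omega : 1 ≤ i + 1) h2 h4
  have e2 := Eg_Xgi_eq h1 (by omega) (by omega : 1 ≤ i + 1) h2 h4
  have e3 := Xg_Eg_eq (by omega : 1 ≤ i + 1) h2 h1 (by omega) h4.symm
  have e4 := Xgi_Eg_eq (by omega : 1 ≤ i + 1) h2 h1 (by omega) h4.symm
  have hc := (commute_Ypow P (commute_Yp_Xg_of_lt P (i := i) (a := i + 1) (by omega) h1) p).eq
  have e5 : Xg P (i + 1) * Xgi P (i + 1) = 1 := Xg_mul_Xgi P _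
  have e6 : Xgi P (i + 1) * Xg P (i + 1) = 1 := Xgi_mul_Xg P _
  have key : Eg P (i + 1) * (Eg P i * Ypow P i p * Eg P i) * Eg P (i + 1) ∈ BE (Bsub P i) (i + 1) := by
    obtain ⟨b, hb, e⟩ := H p
    rw [← e, LinearMap.mulRight_apply, ← mul_assoc,
      (commute_Eg_of_mem_Bsub (a := i + 1) (m := i - 1) (by omega) (by omega) (coeffAlg_le i hb)).eq, mul_assoc,
      mul_assoc, ← mul_assoc (Eg P (i + 1)),
      Eg_Eg_Eg (by omega : 1 ≤ i + 1) h2 h1 (by omega) h4.symm]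
    exact mul_Eg_mem_BE (Bsub_mono (by omega) (coeffAlg_le i hb))
  constructor
  · convert key using 1
    have hc' := congrArg (Xgi P (i + 1) * ·) hc
    linear_combination (norm := noncomm_ring)
      e1 * (Ypow P i p * Xgi P i * Eg P (i + 1))
      + Eg P (i + 1) * Eg P i * Xgi P (i + 1) * Ypow P i p * e4
      - Eg P (i + 1) * Eg P i * Xgi P (i + 1) * hc * (Eg P i * Eg P (i + 1))
      + Eg P (i + 1) * Eg P i * e6 * (Ypow P i p * Eg P i * Eg P (i + 1))
  · convert key using 1
    linear_combination (norm := noncomm_ring)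
      e2 * (Ypow P i p * Xg P i * Eg P (i + 1))
      + Eg P (i + 1) * Eg P i * Xg P (i + 1) * Ypow P i p * e3
      + Eg P (i + 1) * Eg P i * hc * (Xgi P (i + 1) * Eg P i * Eg P (i + 1))
      + Eg P (i + 1) * Eg P i * Ypow P i p * e5 * (Eg P i * Eg P (i + 1))

/-- If the lower powers absorb then so does `e_{i+1} Y_{i+1}^a Xᵢ^{±1} e_{i+1}`. -/
theorem Eg_Ypow_X_Eg_mem {d : ℤ}
    (IH : ∀ c : ℤ, |c| < d → Eg P (i + 1) * Ypow P (i + 1) c * Eg P (i + 1) ∈ BE (Bsub P i) (i + 1))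
    {a : ℤ} (ha : |a| < d) :
    Eg P (i + 1) * Ypow P (i + 1) a * Xg P i * Eg P (i + 1) ∈ BE (Bsub P i) (i + 1) ∧
    Eg P (i + 1) * Ypow P (i + 1) a * Xgi P i * Eg P (i + 1) ∈ BE (Bsub P i) (i + 1) := by
  have hE : ∀ y ∈ Bsub P i, Eg P (i + 1) * y = y * Eg P (i + 1) := fun y hy =>
    (commute_Eg_of_mem_Bsub_pred h1 hy).eq
  have hmid : ∀ c d : ℤ, Eg P (i + 1) * (Ypow P (i + 1) c * Eg P i * Ypow P i d) * Eg P (i + 1)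
      ∈ BE (Bsub P i) (i + 1) := by
    intro c d
    have hd := hE _ (Ypow_mem h1 le_rfl d)
    have hc := hE _ (Ypow_mem h1 le_rfl (-c))
    have h5 := Eg_Eg_Eg (P := P) (by omega : 1 ≤ i + 1) h2 h1 (by omega) (Or.inr rfl)
    rw [Ypow_succ_mul_Eg h1 (by omega)]
    have : Eg P (i + 1) * (Ypow P i (-c) * Eg P i * Ypow P i d) * Eg P (i + 1) =
        Ypow P i (-c) * Ypow P i d * Eg P (i + 1) := by
      linear_combination (norm := noncomm_ring) hc * (Eg P i * Ypow P i d * Eg P (i + 1))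
        - Ypow P i (-c) * Eg P (i + 1) * Eg P i * hd + Ypow P i (-c) * h5 * Ypow P i d
        + Ypow P i (-c) * hd
    rw [this]
    exact mul_Eg_mem_BE (mul_mem (Ypow_mem h1 le_rfl _) (Ypow_mem h1 le_rfl _))
  have hX : Eg P (i + 1) * Ypow P (i + 1) a * Xg P i * Eg P (i + 1) ∈ BE (Bsub P i) (i + 1) := by
    obtain ⟨t, ht, e⟩ := Xg_mul_Ypow h1 (by omega : i + 1 ≤ P.n) a
    rw [mul_assoc (Eg P (i + 1)), eq_sub_of_add_eq e.symm, mul_sub, sub_mul]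
    refine Submodule.sub_mem _ ?_ (mul_mul_mem_of_mem_span ?_ ht)
    · rw [mul_assoc, mul_assoc, ← hE _ (Ypow_mem h1 le_rfl a), ← mul_assoc, ← mul_assoc,
        Eg_Xg_Eg h1 (by omega) (by omega : 1 ≤ i + 1) h2 (Or.inl rfl), smul_mul_assoc,
        hE _ (Ypow_mem h1 le_rfl a)]
      exact Submodule.smul_mem _ _ (mul_Eg_mem_BE (Ypow_mem h1 le_rfl a))
    · rintro _ ⟨c, d', w, rfl | rfl, hab, hC, rfl⟩
      · rw [mul_one, mul_assoc, mul_assoc, ← hE _ (Ypow_mem h1 le_rfl d'), ← mul_assoc,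
          ← mul_assoc]
        exact mul_Eg_mul_mem_BE h1 (IH c (by grind)) (Ypow_mem h1 le_rfl d')
      · exact hmid c d'
  refine ⟨hX, ?_⟩
  obtain ⟨c, hc⟩ := Xgi_eq P i
  rw [hc, mul_sub, sub_mul, mul_smul_comm, smul_mul_assoc, mul_sub, sub_mul, mul_one]
  refine Submodule.sub_mem _ hX (Submodule.smul_mem _ _ (Submodule.sub_mem _ (IH a ha) ?_))
  simpa [Ypow_zero, mul_assoc] using hmid a 0

theorem Eg_Ypow_Eg_X_Eg_mem (H : EYE P i) (a b : ℤ) :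
    Eg P (i + 1) * (Ypow P (i + 1) a * Eg P i * Ypow P i b) * Xg P i * Eg P (i + 1)
      ∈ BE (Bsub P i) (i + 1) ∧
    Eg P (i + 1) * (Ypow P (i + 1) a * Eg P i * Ypow P i b) * Xgi P i * Eg P (i + 1)
      ∈ BE (Bsub P i) (i + 1) := by
  have h4 : i + 1 = i + 1 ∨ i = i + 1 + 1 := Or.inl rfl
  have e1 := Eg_Xg_eq h1 (by omega) (by omega : 1 ≤ i + 1) h2 h4
  have e2 := Eg_Xgi_eq h1 (by omega) (by omega : 1 ≤ i + 1) h2 h4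
  have e3 := Xg_Eg_eq (by omega : 1 ≤ i + 1) h2 h1 (by omega) h4.symm
  have e4 := Xgi_Eg_eq (by omega : 1 ≤ i + 1) h2 h1 (by omega) h4.symm
  have hc := (commute_Ypow P (commute_Yp_Xg_of_lt P (i := i) (a := i + 1) (by omega) h1) b).eq
  have hci : Xgi P (i + 1) * Ypow P i b = Ypow P i b * Xgi P (i + 1) :=
    (commute_Xgi_of_commute P (show Commute (Ypow P i b) (Xg P (i + 1)) from hc.symm)).eq.symm
  have ha := (commute_Eg_of_mem_Bsub_pred (P := P) h1 (Ypow_mem h1 le_rfl (-a))).eq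
  have key : ∀ x ∈ YBE P i |b|, Ypow P i (-a) * Eg P (i + 1) * x * Eg P (i + 1) ∈
      BE (Bsub P i) (i + 1) := by
    intro x hx
    obtain ⟨y, hy, rfl⟩ := YBE_le h1 _ hx
    rw [LinearMap.mulRight_apply, mul_assoc, mul_assoc, ← mul_assoc (Eg P (i + 1)),
      ← mul_assoc (Eg P (i + 1)), (commute_Eg_of_mem_Bsub_pred h1 hy).eq, mul_assoc, mul_assoc,
      ← mul_assoc (Eg P (i + 1)),
      Eg_Eg_Eg (by omega : 1 ≤ i + 1) h2 h1 (by omega) h4.symm, ← mul_assoc]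
    exact mul_Eg_mem_BE (mul_mem (Ypow_mem h1 le_rfl _) hy)
  rw [Ypow_succ_mul_Eg h1 (by omega)]
  constructor
  · convert key _ (Xg_Ypow_Eg_mem h1 (by omega) H b) using 1
    linear_combination (norm := noncomm_ring)
      ha * (Eg P i * Ypow P i b * Xg P i * Eg P (i + 1))
      + Ypow P i (-a) * Eg P (i + 1) * Eg P i * Ypow P i b * e3
      - Ypow P i (-a) * Eg P (i + 1) * Eg P i * hci * (Eg P i * Eg P (i + 1))
      - Ypow P i (-a) * e1 * (Ypow P i b * Eg P i * Eg P (i + 1))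
  · convert key _ (Xgi_Ypow_Eg_mem h1 (by omega) H b) using 1
    linear_combination (norm := noncomm_ring)
      ha * (Eg P i * Ypow P i b * Xgi P i * Eg P (i + 1))
      + Ypow P i (-a) * Eg P (i + 1) * Eg P i * Ypow P i b * e4
      - Ypow P i (-a) * Eg P (i + 1) * Eg P i * hc * (Eg P i * Eg P (i + 1))
      - Ypow P i (-a) * e2 * (Ypow P i b * Eg P i * Eg P (i + 1))

theorem EYE_succ (H : EYE P i) : EYE P (i + 1) := by
  unfold EYE
  rw [coeffAlg_succ h1]
  have key : ∀ d : ℕ, ∀ p : ℤ, |p| = d →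
      Eg P (i + 1) * Ypow P (i + 1) p * Eg P (i + 1) ∈ BE (Bsub P i) (i + 1) := by
    intro d
    induction d using Nat.strong_induction_on with
    | _ d IHd =>
    intro p hp
    have IH : ∀ c : ℤ, |c| < |p| →
        Eg P (i + 1) * Ypow P (i + 1) c * Eg P (i + 1) ∈ BE (Bsub P i) (i + 1) := fun c hc =>
      IHd c.natAbs (by grind) c (Int.abs_eq_natAbs c)
    have hE : ∀ b : ℤ, Eg P (i + 1) * Ypow P i b = Ypow P i b * Eg P (i + 1) := fun b =>
      (commute_Eg_of_mem_Bsub_pred h1 (Ypow_mem h1 le_rfl b)).eq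
    have hYY : ∀ a b : ℤ, Ypow P (i + 1) a * Ypow P i b = Ypow P i b * Ypow P (i + 1) a :=
      fun a b => (commute_Ypow_Ypow (by omega) h1 (by omega) (by omega) a b).eq
    obtain rfl | hp0 | hp0 : p = 0 ∨ 0 < p ∨ p < 0 := by omega
    · rw [Ypow_zero, mul_one, Eg_Eg (by omega) h2]
      exact Submodule.smul_mem _ _ (by simpa using mul_Eg_mem_BE (one_mem _))
    · obtain ⟨t, ht, e⟩ := Xgi_mul_Ypow h1 (by omega : i + 1 ≤ P.n) p hp0.le
      have e' : Ypow P (i + 1) p = Xgi P i * Ypow P i p * Xg P i - t * Xg P i := by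
        rw [e, add_mul, mul_assoc, Xgi_mul_Xg, mul_one, add_sub_cancel_right]
      rw [e', mul_sub, sub_mul, ← mul_assoc (Eg P (i + 1)) t]
      refine Submodule.sub_mem _ (Eg_conj_Eg h1 h2 H p).2 ?_
      rw [mul_assoc]
      refine mul_mul_mem_of_mem_span ?_ ht
      rintro _ ⟨a, b, w, rfl | rfl, hab, hC, rfl⟩
      · have := mul_mem_BE (Ypow_mem h1 le_rfl b)
          (Eg_Ypow_X_Eg_mem h1 h2 IH (a := a) (by grind)).1
        rw [mul_one, hYY, ← mul_assoc (Eg P (i + 1)), hE]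
        simpa only [mul_assoc] using this
      · simpa only [mul_assoc] using (Eg_Ypow_Eg_X_Eg_mem h1 h2 H a b).1
    · obtain ⟨t, ht, e⟩ := Xg_mul_Ypow h1 (by omega : i + 1 ≤ P.n) p
      have e' : Ypow P (i + 1) p = Xg P i * Ypow P i p * Xgi P i - t * Xgi P i := by
        rw [e, add_mul, mul_assoc, Xg_mul_Xgi, mul_one, add_sub_cancel_right]
      rw [e', mul_sub, sub_mul, ← mul_assoc (Eg P (i + 1)) t]
      refine Submodule.sub_mem _ (Eg_conj_Eg h1 h2 H p).1 ?_
      rw [mul_assoc]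
      refine mul_mul_mem_of_mem_span ?_ ht
      rintro _ ⟨a, b, w, rfl | rfl, hab, hC, rfl⟩
      · have := mul_mem_BE (Ypow_mem h1 le_rfl b)
          (Eg_Ypow_X_Eg_mem h1 h2 IH (a := a) (by grind)).2
        rw [mul_one, hYY, ← mul_assoc (Eg P (i + 1)), hE]
        simpa only [mul_assoc] using this
      · simpa only [mul_assoc] using (Eg_Ypow_Eg_X_Eg_mem h1 h2 H a b).2
  exact fun p => key p.natAbs p (Int.abs_eq_natAbs p)

end

theorem EYE_of_le (hk : 1 ≤ P.k) (hq0 : P.qc 0 = (P.q0 : R)) {i : ℕ} (h1 : 1 ≤ i)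
    (h2 : i + 1 ≤ P.n) : EYE P i := by
  induction i, h1 using Nat.le_induction with
  | base => exact EYE_one hk hq0 h2
  | succ i hi ih => exact EYE_succ hi h2 (ih (by omega))

section
variable {A : Type*} [Monoid A]

/-- The ordered product `f i * f (i+1) * ⋯ * f (j-1)`. -/
def seg (f : ℕ → A) (i j : ℕ) : A := ((List.range' i (j - i)).map f).prod

theorem seg_of_le (f : ℕ → A) {i j : ℕ} (h : j ≤ i) : seg f i j = 1 := by
  simp [seg, Nat.sub_eq_zero_of_le h]

@[simp] theorem seg_self (f : ℕ → A) (i : ℕ) : seg f i i = 1 := seg_of_le f le_rfl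

theorem seg_succ_left (f : ℕ → A) {i j : ℕ} (h : i < j) : seg f i j = f i * seg f (i + 1) j := by
  simp [seg, show j - i = (j - (i + 1)) + 1 by omega, List.range'_succ]

theorem seg_mul_seg (f : ℕ → A) {i j k : ℕ} (h : i ≤ j) (h' : j ≤ k) :
    seg f i j * seg f j k = seg f i k := by
  simp only [seg, ← List.prod_append, ← List.map_append]
  congr 2
  have := List.range'_append (s := i) (m := j - i) (n := k - j) (step := 1)
  rw [show i + 1 * (j - i) = j by omega, show j - i + (k - j) = k - i by omega] at this
  exact this

theorem seg_succ_right (f : ℕ → A) {i j : ℕ} (h : i ≤ j) : seg f i (j + 1) = seg f i j * f j := by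
  rw [← seg_mul_seg f h (Nat.le_succ j), seg_succ_left f (Nat.lt_succ_self j), seg_self, mul_one]

theorem seg_commute {f : ℕ → A} {z : A} {i j : ℕ} (h : ∀ a, i ≤ a → a < j → Commute z (f a)) :
    Commute z (seg f i j) := by
  unfold seg
  refine Commute.list_prod_right _ _ fun x hx => ?_
  obtain ⟨a, ha, rfl⟩ := List.mem_map.1 hx
  rw [List.mem_range'_1] at ha
  exact h a ha.1 (by omega)

end

theorem seg_mem {S : Subalgebra R (Alg P)} {f : ℕ → Alg P} {i j : ℕ}
    (h : ∀ a, i ≤ a → a < j → f a ∈ S) : seg f i j ∈ S := by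
  refine Subalgebra.list_prod_mem S fun x hx => ?_
  obtain ⟨a, ha, rfl⟩ := List.mem_map.1 hx
  rw [List.mem_range'_1] at ha
  exact h a ha.1 (by omega)

/-- The subalgebra generated by `X_a`, `X_a⁻¹`, `e_a` for `g ≤ a < m`. -/
def segAlg (P : Params R) (g m : ℕ) : Subalgebra R (Alg P) :=
  Algebra.adjoin R {x | ∃ a, g ≤ a ∧ a + 1 ≤ m ∧ (x = Xg P a ∨ x = Xgi P a ∨ x = Eg P a)}

theorem segAlg_le {g m : ℕ} {S : Subalgebra R (Alg P)}
    (hX : ∀ a, g ≤ a → a + 1 ≤ m → Xg P a ∈ S) (hE : ∀ a, g ≤ a → a + 1 ≤ m → Eg P a ∈ S) :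
    segAlg P g m ≤ S := by
  refine Algebra.adjoin_le ?_
  rintro x ⟨a, h1, h2, rfl | rfl | rfl⟩
  · exact hX a h1 h2
  · obtain ⟨c, hc⟩ := Xgi_eq P a
    rw [hc]
    exact sub_mem (hX a h1 h2) (S.smul_mem (sub_mem (one_mem _) (hE a h1 h2)) _)
  · exact hE a h1 h2

theorem segAlg_mono {g g' m m' : ℕ} (h : g' ≤ g) (h' : m ≤ m') : segAlg P g m ≤ segAlg P g' m' :=
  Algebra.adjoin_mono fun _ ⟨a, h1, h2, h3⟩ => ⟨a, by omega, by omega, h3⟩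

theorem Xgi_mem_segAlg {g m a : ℕ} (h1 : g ≤ a) (h2 : a + 1 ≤ m) : Xgi P a ∈ segAlg P g m :=
  Algebra.subset_adjoin ⟨a, h1, h2, by simp⟩

theorem segAlg_le_Bsub {g m : ℕ} (h : 1 ≤ g) : segAlg P g m ≤ Bsub P m :=
  segAlg_le (fun _ h1 h2 => Xg_mem (by omega) h2) (fun _ h1 h2 => Eg_mem (by omega) h2)

/-- The families `X` and `e` of generators. -/
def IsXE (P : Params R) (z : ℕ → Alg P) : Prop := z = Xg P ∨ z = Eg P

theorem isXE_Xg : IsXE P (Xg P) := Or.inl rfl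
theorem isXE_Eg : IsXE P (Eg P) := Or.inr rfl

theorem IsXE.commute {z w : ℕ → Alg P} (hz : IsXE P z) (hw : IsXE P w) {i j : ℕ}
    (h : i + 2 ≤ j ∨ j + 2 ≤ i) : Commute (z i) (w j) := by
  obtain rfl | rfl := hz <;> obtain rfl | rfl := hw
  · exact commute_Xg_Xg P h
  · exact commute_Xg_Eg P h
  · exact (commute_Xg_Eg P h.symm).symm
  · exact commute_Eg_Eg P h

theorem IsXE.mem {z : ℕ → Alg P} (hz : IsXE P z) {m a : ℕ} (h1 : 1 ≤ a) (h2 : a + 1 ≤ m) :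
    z a ∈ Bsub P m := by
  obtain rfl | rfl := hz
  · exact Xg_mem h1 h2
  · exact Eg_mem h1 h2

theorem IsXE.commute_of_mem_Bsub {z : ℕ → Alg P} (hz : IsXE P z) {m a : ℕ} {b : Alg P}
    (h : m + 1 ≤ a) (ha : 2 ≤ a) (hb : b ∈ Bsub P m) : Commute (z a) b := by
  obtain rfl | rfl := hz
  · exact commute_Xg_of_mem_Bsub h ha hb
  · exact commute_Eg_of_mem_Bsub h ha hb

theorem IsXE.commute_Ypow_of_lt {z : ℕ → Alg P} (hz : IsXE P z) {i a : ℕ} (h : i < a)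
    (h1 : 1 ≤ i) (p : ℤ) : Commute (z a) (Ypow P i p) :=
  hz.commute_of_mem_Bsub (m := i) (by omega) (by omega) (Ypow_mem h1 le_rfl p)

theorem IsXE.commute_Ypow_of_gt {z : ℕ → Alg P} (hz : IsXE P z) {i a : ℕ} (h : a + 2 ≤ i)
    (h1 : 1 ≤ a) (hi : i ≤ P.n) (p : ℤ) : Commute (z a) (Ypow P i p) :=
  commute_Ypow_of_mem_Bsub (m := a + 1) (by omega) hi p (hz.mem h1 le_rfl)

theorem IsXE.shift_E {z : ℕ → Alg P} (hz : IsXE P z) {j a m : ℕ} (h1 : 1 ≤ j) (h2 : j ≤ a)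
    (h3 : a + 3 ≤ m) (hm : m ≤ P.n) :
    z (a + 2) * seg (Eg P) j m = seg (Eg P) j m * z a := by
  have key : z (a + 2) * (Eg P a * (Eg P (a + 1) * Eg P (a + 2)))
      = Eg P a * (Eg P (a + 1) * Eg P (a + 2)) * z a := by
    have c : Commute (Eg P (a + 2)) (Eg P a) := commute_Eg_Eg P (by omega)
    have h12 : a + 1 = a + 2 + 1 ∨ a + 2 = a + 1 + 1 := by omega
    have h01 : a + 1 = a + 1 ∨ a = a + 1 + 1 := by omega
    obtain rfl | rfl := hz
    · have c1 : Commute (Xg P (a + 2)) (Eg P a) := commute_Xg_Eg P (by omega)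
      have c2 : Commute (Eg P (a + 2)) (Xg P a) := (commute_Xg_Eg P (by omega)).symm
      have e1 := Xg_Eg_Eg (P := P) (i := a + 1) (j := a + 2) (by omega) (by omega) (by omega)
        (by omega) (by omega)
      have e2 := Eg_Eg_Xg (P := P) (i := a) (j := a + 1) (by omega) (by omega) (by omega)
        (by omega) (by omega)
      linear_combination (norm := noncomm_ring) c1.eq * Eg P (a + 1) * Eg P (a + 2)
        + Eg P a * e1 - e2 * Eg P (a + 2) - Eg P a * Eg P (a + 1) * c2.eq
    · have e1 := Eg_Eg_Eg (P := P) (i := a + 2) (j := a + 1) (by omega) (by omega) (by omega)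
        (by omega) (by omega)
      have e2 := Eg_Eg_Eg (P := P) (i := a) (j := a + 1) (by omega) (by omega) (by omega)
        (by omega) (by omega)
      linear_combination (norm := noncomm_ring) c.eq * Eg P (a + 1) * Eg P (a + 2)
        + Eg P a * e1 - e2 * Eg P (a + 2) - Eg P a * Eg P (a + 1) * c.eq
  rw [← seg_mul_seg (Eg P) h2 (show a ≤ m by omega), seg_succ_left _ (show a < m by omega),
    seg_succ_left _ (show a + 1 < m by omega), seg_succ_left _ (show a + 1 + 1 < m by omega)]
  have c1 : Commute (z (a + 2)) (seg (Eg P) j a) :=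
    seg_commute fun b _ _ => hz.commute isXE_Eg (by omega)
  have c2 : Commute (z a) (seg (Eg P) (a + 1 + 1 + 1) m) :=
    seg_commute fun b _ _ => hz.commute isXE_Eg (by omega)
  linear_combination (norm := noncomm_ring)
    c1.eq * Eg P a * Eg P (a + 1) * Eg P (a + 2) * seg (Eg P) (a + 1 + 1 + 1) m
    + seg (Eg P) j a * key * seg (Eg P) (a + 1 + 1 + 1) m
    + seg (Eg P) j a * Eg P a * Eg P (a + 1) * Eg P (a + 2) * c2.eq

theorem IsXE.shift_X {z : ℕ → Alg P} (hz : IsXE P z) {i a j : ℕ} (h1 : 1 ≤ i) (h2 : i ≤ a)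
    (h3 : a + 2 ≤ j) (hj : j ≤ P.n) :
    z (a + 1) * seg (Xg P) i j = seg (Xg P) i j * z a := by
  have key : z (a + 1) * (Xg P a * Xg P (a + 1)) = Xg P a * Xg P (a + 1) * z a := by
    obtain rfl | rfl := hz
    · have := Xg_braid (P := P) (i := a) (by omega) (by omega)
      linear_combination (norm := noncomm_ring) -this
    · have := Eg_Xg_Xg_comm (P := P) (i := a) (j := a + 1) (by omega) (by omega) (by omega)
        (by omega) (by omega)
      linear_combination (norm := noncomm_ring) this
  rw [← seg_mul_seg (Xg P) h2 (show a ≤ j by omega), seg_succ_left _ (show a < j by omega),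
    seg_succ_left _ (show a + 1 < j by omega)]
  have c1 : Commute (z (a + 1)) (seg (Xg P) i a) :=
    seg_commute fun b _ _ => hz.commute isXE_Xg (by omega)
  have c2 : Commute (z a) (seg (Xg P) (a + 1 + 1) j) :=
    seg_commute fun b _ _ => hz.commute isXE_Xg (by omega)
  linear_combination (norm := noncomm_ring)
    c1.eq * Xg P a * Xg P (a + 1) * seg (Xg P) (a + 1 + 1) j
    + seg (Xg P) i a * key * seg (Xg P) (a + 1 + 1) j
    + seg (Xg P) i a * Xg P a * Xg P (a + 1) * c2.eq

/-- The chain `α` whose last factor is `e_{m-1}`. -/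
def al (P : Params R) (m i j : ℕ) (s : ℤ) : Alg P :=
  Ypow P i s * seg (Xg P) i j * seg (Eg P) j m

theorem alpha_eq_al (i j l : ℕ) (s : ℤ) : alpha P i j l s = al P (l + 1) i j s := rfl

theorem Ypow_mul_al {m i : ℕ} (j : ℕ) (p s : ℤ) :
    Ypow P i p * al P m i j s = al P m i j (p + s) := by
  rw [al, al, Ypow_add, mul_assoc, mul_assoc, mul_assoc]

theorem al_zero (m i j : ℕ) : al P m i j 0 = seg (Xg P) i j * seg (Eg P) j m := by
  rw [al, Ypow_zero, one_mul]

theorem al_eq (m i j : ℕ) (s : ℤ) : al P m i j s = Ypow P i s * al P m i j 0 := by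
  rw [Ypow_mul_al, add_zero]

theorem al_self (m i : ℕ) (s : ℤ) : al P m i i s = Ypow P i s * seg (Eg P) i m := by
  rw [al, seg_self, mul_one]

theorem al_zero_succ {m i j : ℕ} (h : i < j) : al P m i j 0 = Xg P i * al P m (i + 1) j 0 := by
  rw [al_zero, al_zero, seg_succ_left _ h, mul_assoc]

theorem al_self_succ {m i : ℕ} (h : i < m) : al P m i i 0 = Eg P i * al P m (i + 1) (i + 1) 0 := by
  rw [al_self, al_self, seg_succ_left _ h, Ypow_zero, Ypow_zero, one_mul, one_mul]

theorem al_mem {m i j : ℕ} (h1 : 1 ≤ i) (h2 : i ≤ j) (h3 : j ≤ m) (s : ℤ) :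
    al P m i j s ∈ Bsub P m :=
  mul_mem (mul_mem (Ypow_mem h1 (by omega) s) (seg_mem fun _ _ _ => Xg_mem (by omega) (by omega)))
    (seg_mem fun _ _ _ => Eg_mem (by omega) (by omega))

theorem commute_al_zero {z : Alg P} {m i j : ℕ} (hX : ∀ a, i ≤ a → a < j → Commute z (Xg P a))
    (hE : ∀ a, j ≤ a → a < m → Commute z (Eg P a)) : Commute z (al P m i j 0) := by
  rw [al_zero]
  exact (seg_commute hX).mul_right (seg_commute hE)

theorem commute_al_zero_of_mem_Bsub {b : Alg P} {m i j t : ℕ} (ht : 1 ≤ t) (hb : b ∈ Bsub P t)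
    (h1 : t < i) (h2 : i ≤ j) : Commute b (al P m i j 0) :=
  commute_al_zero (fun _ _ _ => (commute_Xg_of_mem_Bsub (m := t) (by omega) (by omega) hb).symm)
    (fun _ _ _ => (commute_Eg_of_mem_Bsub (m := t) (by omega) (by omega) hb).symm)

theorem commute_al_of_mem_Bsub {b : Alg P} {m i j t : ℕ} (ht : 1 ≤ t) (hb : b ∈ Bsub P t)
    (h1 : t < i) (h2 : i ≤ j) (hi : i ≤ P.n) (s : ℤ) : Commute b (al P m i j s) := by
  rw [al_eq]
  exact (commute_Ypow_of_mem_Bsub (m := t) (by omega) hi s hb).mul_right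
    (commute_al_zero_of_mem_Bsub ht hb h1 h2)

theorem commute_al_of_mem_coeffAlg {b : Alg P} {m i : ℕ} (h1 : 1 ≤ i) (hb : b ∈ coeffAlg P i) :
    Commute b (al P m i i 0) :=
  commute_al_zero (fun _ _ _ => by omega)
    (fun _ h _ => (commute_Eg_of_mem_coeffAlg hb h1 h).symm)

theorem Eg_mul_al_succ {m i j : ℕ} (h1 : 1 ≤ i) (h2 : i + 1 ≤ j) (h3 : j + 1 ≤ m) (hm : m ≤ P.n) :
    ∃ β ∈ segAlg P i (m - 2), Eg P i * al P m (i + 1) j 0 = al P m i i 0 * β := by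
  obtain ⟨d, rfl⟩ := Nat.exists_eq_add_of_le h2
  induction d generalizing i with
  | zero => exact ⟨1, one_mem _, by rw [mul_one, add_zero, al_self_succ (i := i) (by omega)]⟩
  | succ d ih =>
    obtain ⟨β, hβ, e⟩ := ih (i := i + 1) (by omega) (by omega) (by omega)
    refine ⟨β * Xgi P i, mul_mem (segAlg_mono (by omega) le_rfl hβ)
      (Xgi_mem_segAlg le_rfl (by omega)), ?_⟩
    have e1 := Eg_Xg_eq (P := P) (j := i) (i := i + 1) (by omega) (by omega) (by omega)
      (by omega) (by omega)
    have c : Commute (al P m (i + 2) (i + 1 + (d + 1)) 0) (Xgi P i) :=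
      commute_Xgi_of_commute P (commute_al_zero (fun _ _ _ => commute_Xg_Xg P (by omega))
        (fun _ _ _ => commute_Xg_Eg P (by omega))).symm
    rw [show i + 1 + 1 + d = i + 1 + (d + 1) by omega] at e
    rw [al_zero_succ (by omega), al_self_succ (by omega)]
    linear_combination (norm := noncomm_ring) e1 * al P m (i + 2) (i + 1 + (d + 1)) 0
      - Eg P i * Eg P (i + 1) * c.eq + Eg P i * e * Xgi P i

/-- The span of the products `α_{i,j,r+1}^s b` with `C i s` and `b ∈ Q`. -/
def alSpan (P : Params R) (r : ℕ) (C : ℕ → ℤ → Prop) (Q : Set (Alg P)) : Submodule R (Alg P) :=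
  Submodule.span R {z | ∃ i j : ℕ, ∃ s : ℤ, ∃ b ∈ Q, 1 ≤ i ∧ i ≤ j ∧ j ≤ r + 1 ∧ C i s ∧
    z = al P (r + 2) i j s * b}

theorem al_mul_mem {r i j : ℕ} {s : ℤ} {C : ℕ → ℤ → Prop} {Q : Set (Alg P)} {b : Alg P}
    (h1 : 1 ≤ i) (h2 : i ≤ j) (h3 : j ≤ r + 1) (hC : C i s) (hb : b ∈ Q) :
    al P (r + 2) i j s * b ∈ alSpan P r C Q :=
  Submodule.subset_span ⟨i, j, s, b, hb, h1, h2, h3, hC, rfl⟩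

theorem alSpan_mono {r : ℕ} {C C' : ℕ → ℤ → Prop} {Q Q' : Set (Alg P)}
    (hC : ∀ i s, 1 ≤ i → i ≤ r + 1 → C i s → C' i s) (hQ : Q ⊆ Q') :
    alSpan P r C Q ≤ alSpan P r C' Q' :=
  Submodule.span_mono fun _ ⟨i, j, s, b, hb, h1, h2, h3, h4, h5⟩ =>
    ⟨i, j, s, b, hQ hb, h1, h2, h3, hC i s h1 (by omega) h4, h5⟩

theorem mul_mem_alSpan {r : ℕ} {C : ℕ → ℤ → Prop} {Q Q' : Set (Alg P)} {x b : Alg P}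
    (hx : x ∈ alSpan P r C Q) (hb : ∀ c ∈ Q, c * b ∈ Q') : x * b ∈ alSpan P r C Q' := by
  refine mul_mem_of_mem_span ?_ hx
  rintro _ ⟨i, j, s, c, hc, h1, h2, h3, hC, rfl⟩
  rw [mul_assoc]
  exact al_mul_mem h1 h2 h3 hC (hb c hc)

/-- The constraint on the pairs `(i', c)` for which `α_{i',j'}^c` occurs in `z_a α_{i,j}^s`,
where `z_a` is `X_a` or `e_a`. -/
def ActCond (a i : ℕ) (s : ℤ) (i' : ℕ) (c : ℤ) : Prop :=
  min i a ≤ i' ∧ i' ≤ max i (a + 1) ∧ |c| ≤ |s| ∧ (a < i' → min 0 s ≤ c ∧ c ≤ max 0 s)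

theorem ActCond.refl {a i : ℕ} (s : ℤ) : ActCond a i s i s :=
  ⟨by omega, by omega, le_rfl, fun _ => by omega⟩

theorem actCond_of_abs_le {a i : ℕ} {s c : ℤ} (h : |c| ≤ |s|) : ActCond a i s a c :=
  ⟨by omega, by omega, h, fun h => absurd h (lt_irrefl _)⟩

theorem actCond_zero {a i : ℕ} (s : ℤ) : ActCond a i s a 0 :=
  actCond_of_abs_le (by simp)

theorem IsXE.mul_Ypow_Eg_mem {z : ℕ → Alg P} (hz : IsXE P z)
    (H : ∀ i, 1 ≤ i → i + 1 ≤ P.n → EYE P i) {i : ℕ} (h1 : 1 ≤ i)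
    (h2 : i + 1 ≤ P.n) (s : ℤ) : z i * Ypow P i s * Eg P i ∈ YBE P i |s| := by
  obtain rfl | rfl := hz
  · exact Xg_Ypow_Eg_mem h1 h2 (H i h1 h2) s
  · obtain ⟨b, hb, e⟩ := H i h1 h2 s
    refine Submodule.subset_span ⟨0, b, hb, by simp, ?_⟩
    rw [← e, LinearMap.mulRight_apply, Ypow_zero, one_mul]

section
variable {r : ℕ} (hr : r + 2 ≤ P.n)
include hr

theorem Eg_mul_al {a j : ℕ} (h1 : 1 ≤ a) (h2 : a + 1 ≤ j) (h3 : j ≤ r + 1) (s : ℤ) :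
    ∃ γ ∈ Bsub P r, Eg P a * al P (r + 2) (a + 1) j s = al P (r + 2) a a 0 * γ := by
  obtain ⟨β, hβ, e⟩ := Eg_mul_al_succ (P := P) (m := r + 2) h1 h2 (by omega) hr
  refine ⟨β * Ypow P a (-s), mul_mem (segAlg_le_Bsub h1 hβ) (Ypow_mem h1 (by omega) _), ?_⟩
  have c := commute_al_zero_of_mem_Bsub (P := P) (m := r + 2) h1 (Ypow_mem h1 le_rfl (-s))
    (Nat.lt_succ_self a) h2
  rw [al_eq, ← mul_assoc, Eg_mul_Ypow_succ h1 (by omega), mul_assoc, c.eq, ← mul_assoc, e,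
    mul_assoc]

theorem Xg_mul_al_succ {a j : ℕ} (h1 : 1 ≤ a) (h2 : a + 1 ≤ j) (h3 : j ≤ r + 1) (s : ℤ) :
    Xg P a * al P (r + 2) (a + 1) j s ∈ alSpan P r (ActCond a a s) (Bsub P r) := by
  obtain ⟨t, ht, e⟩ := Ypow_mul_Xg h1 (by omega : a + 1 ≤ P.n) s
  have e' : Xg P a * al P (r + 2) (a + 1) j s
      = al P (r + 2) a j s - t * al P (r + 2) (a + 1) j 0 := by
    rw [al_eq, al_eq (i := a), al_zero_succ (i := a) (by omega)]
    linear_combination (norm := noncomm_ring) - e * al P (r + 2) (a + 1) j 0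
  rw [e']
  refine sub_mem ?_ (mul_mem_of_mem_span ?_ ht)
  · rw [← mul_one (al P (r + 2) a j s)]
    exact al_mul_mem h1 (by omega) h3 (ActCond.refl s) (one_mem _)
  · rintro _ ⟨c, d, w, hw | hw, hcd, hC, rfl⟩
    · have c1 := commute_al_of_mem_Bsub (P := P) (m := r + 2) h1 (Ypow_mem h1 le_rfl c)
        (Nat.lt_succ_self a) h2 (by omega) d
      rw [hw, mul_one, mul_assoc, ← al_eq, c1.eq]
      refine al_mul_mem (by omega) h2 h3 ⟨by omega, by omega, ?_, fun _ => by omega⟩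
        (Ypow_mem h1 (by omega) c)
      grind
    · obtain ⟨γ, hγ, e1⟩ := Eg_mul_al hr h1 h2 h3 d
      rw [hw, mul_assoc, mul_assoc, ← al_eq, e1, ← mul_assoc, ← al_eq]
      exact al_mul_mem h1 le_rfl (by omega) (actCond_of_abs_le (by grind)) hγ

variable {z : ℕ → Alg P} (hz : IsXE P z)
include hz

theorem IsXE.mul_al_succ {a j : ℕ} (h1 : 1 ≤ a) (h2 : a + 1 ≤ j) (h3 : j ≤ r + 1) (s : ℤ) :
    z a * al P (r + 2) (a + 1) j s ∈ alSpan P r (ActCond a a s) (Bsub P r) := by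
  obtain rfl | rfl := hz
  · exact Xg_mul_al_succ hr h1 h2 h3 s
  · obtain ⟨γ, hγ, e⟩ := Eg_mul_al hr h1 h2 h3 s
    rw [e]
    exact al_mul_mem h1 le_rfl (by omega) (actCond_zero s) hγ

theorem IsXE.mul_Ypow_al_mem (H : ∀ i, 1 ≤ i → i + 1 ≤ P.n → EYE P i) {i : ℕ} (h1 : 1 ≤ i)
    (h3 : i ≤ r + 1) {s c : ℤ} (hc : |c| ≤ |s|) {γ : Alg P} (hγ : γ ∈ Bsub P r) :
    z i * Ypow P i c * (al P (r + 2) i i 0 * γ) ∈ alSpan P r (ActCond i i s) (Bsub P r) := by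
  rw [al_self, Ypow_zero, one_mul, seg_succ_left _ (by omega), mul_assoc (Eg P i),
    ← mul_assoc (z i * _)]
  refine mul_mem_of_mem_span ?_ (hz.mul_Ypow_Eg_mem H h1 (by omega) c)
  rintro _ ⟨d, b, hb, hd, rfl⟩
  have c1 := commute_al_of_mem_coeffAlg (m := r + 2) h1 hb
  have e : Ypow P i d * b * Eg P i * (seg (Eg P) (i + 1) (r + 2) * γ)
      = al P (r + 2) i i d * (b * γ) := by
    rw [al_self, Ypow_zero, one_mul] at c1
    rw [al_self, mul_assoc _ (Eg P i), ← mul_assoc (Eg P i), ← seg_succ_left _ (by omega)]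
    linear_combination (norm := noncomm_ring) Ypow P i d * c1.eq * γ
  rw [e]
  exact al_mul_mem h1 le_rfl h3 (actCond_of_abs_le (hd.trans hc))
    (mul_mem (Bsub_mono (by omega) (coeffAlg_le i hb)) hγ)

theorem IsXE.mul_al_of_eq_of_lt (H : ∀ i, 1 ≤ i → i + 1 ≤ P.n → EYE P i) {i j : ℕ} (h1 : 1 ≤ i)
    (h2 : i < j) (h3 : j ≤ r + 1) (s : ℤ) :
    z i * al P (r + 2) i j s ∈ alSpan P r (ActCond i i s) (Bsub P r) := by
  have h4 : i + 1 ≤ P.n := by omega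
  obtain ⟨t, ht, e⟩ := Ypow_mul_Xg h1 h4 s
  have e' : z i * al P (r + 2) i j s = z i * Xg P i * al P (r + 2) (i + 1) j s
      + z i * t * al P (r + 2) (i + 1) j 0 := by
    rw [al_eq, al_eq (i := i + 1) (s := s), al_zero_succ (i := i) (by omega)]
    linear_combination (norm := noncomm_ring) z i * e * al P (r + 2) (i + 1) j 0
  rw [e']
  have hX := Xg_mul_al_succ hr h1 h2 h3 s
  have hE := isXE_Eg.mul_al_succ hr h1 h2 h3 s
  have habs : ∀ c d : ℤ, c + d = s → (s ≤ c ∧ c ≤ -1 ∨ 0 ≤ c ∧ c < s) → |c| ≤ |s| ∧ |d| ≤ |s| := by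
    grind
  refine add_mem ?_ (mul_mul_mem_of_mem_span ?_ ht)
  · obtain rfl | rfl := hz
    · have e2 := skein_rel h1 h4
      have e3 : Xg P i * Xg P i = 1 + P.delta • (Xg P i - P.lam • Eg P i) := by
        have h := congrArg (Xg P i * ·) e2
        simp only [mul_sub, mul_smul_comm, Xg_mul_Xgi, mul_one, Xg_mul_Eg h1 h4] at h
        rw [← sub_eq_iff_eq_add', h]
        rfl
      rw [e3, add_mul, one_mul, smul_mul_assoc, sub_mul]
      refine add_mem ?_ (Submodule.smul_mem _ _ (sub_mem hX ?_))
      · rw [← mul_one (al P (r + 2) (i + 1) j s)]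
        exact al_mul_mem (by omega) h2 h3 ⟨by omega, by omega, le_rfl, fun _ => by omega⟩
          (one_mem _)
      · have := Submodule.smul_mem _ (P.lam : R) hE
        rwa [← smul_mul_assoc] at this
    · rw [Eg_mul_Xg h1 h4, smul_mul_assoc]
      exact Submodule.smul_mem _ _ hE
  · rintro _ ⟨c, d, w, hw | hw, hcd, hC, rfl⟩
    · have c1 := commute_al_of_mem_Bsub (P := P) (m := r + 2) h1 (Ypow_mem h1 le_rfl c)
        (Nat.lt_succ_self i) h2 (by omega) d
      rw [hw, mul_one, mul_assoc, mul_assoc, ← al_eq, c1.eq, ← mul_assoc]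
      refine mul_mem_alSpan (alSpan_mono ?_ subset_rfl (hz.mul_al_succ hr h1 h2 h3 d))
        fun x hx => mul_mem hx (Ypow_mem h1 (by omega) c)
      intro i' s' _ _ ⟨h5, h6, h7, h8⟩
      exact ⟨h5, h6, h7.trans (habs c d hcd hC).2, fun h => by have := h8 h; omega⟩
    · obtain ⟨γ, hγ, e1⟩ := Eg_mul_al hr h1 h2 h3 d
      have e2 : z i * (Ypow P i c * w * Ypow P (i + 1) d) * al P (r + 2) (i + 1) j 0
          = z i * Ypow P i c * (al P (r + 2) i i 0 * γ) := by
        rw [← e1, hw, al_eq (s := d)]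
        noncomm_ring
      rw [e2]
      exact hz.mul_Ypow_al_mem hr H h1 (by omega) (habs c d hcd hC).1 hγ

theorem IsXE.mul_al_of_lt {i j a : ℕ} (h1 : 1 ≤ i) (h2 : i < a) (h3 : a < j) (h4 : j ≤ r + 1)
    (s : ℤ) : z a * al P (r + 2) i j s = al P (r + 2) i j s * z (a - 1) := by
  obtain ⟨b, rfl⟩ : ∃ b, a = b + 1 := ⟨a - 1, by omega⟩
  have c1 := hz.commute_Ypow_of_lt h2 h1 s
  have c2 := hz.shift_X (P := P) h1 (show i ≤ b by omega) (show b + 2 ≤ j by omega) (by omega)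
  have c3 : Commute (z b) (seg (Eg P) j (r + 2)) :=
    seg_commute fun _ _ _ => hz.commute isXE_Eg (by omega)
  rw [al, Nat.add_sub_cancel]
  linear_combination (norm := noncomm_ring)
    c1.eq * seg (Xg P) i j * seg (Eg P) j (r + 2) + Ypow P i s * c2 * seg (Eg P) j (r + 2)
    + Ypow P i s * seg (Xg P) i j * c3.eq

theorem IsXE.mul_al_of_gt {i j a : ℕ} (h1 : 1 ≤ i) (h2 : i ≤ j) (h3 : j + 2 ≤ a)
    (h4 : a ≤ r + 1) (s : ℤ) : z a * al P (r + 2) i j s = al P (r + 2) i j s * z (a - 2) := by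
  obtain ⟨b, rfl⟩ : ∃ b, a = b + 2 := ⟨a - 2, by omega⟩
  have c1 := hz.commute_Ypow_of_lt (show i < b + 2 by omega) h1 s
  have c2 : Commute (z (b + 2)) (seg (Xg P) i j) :=
    seg_commute fun _ _ _ => hz.commute isXE_Xg (by omega)
  have c3 := hz.shift_E (P := P) (show 1 ≤ j by omega) (show j ≤ b by omega)
    (show b + 3 ≤ r + 2 by omega) hr
  rw [al, Nat.add_sub_cancel]
  linear_combination (norm := noncomm_ring)
    c1.eq * seg (Xg P) i j * seg (Eg P) j (r + 2) + Ypow P i s * c2.eq * seg (Eg P) j (r + 2)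
    + Ypow P i s * seg (Xg P) i j * c3

end

theorem mul_al_self_mem {r b : ℕ} {C : ℕ → ℤ → Prop} {y : Alg P} (h1 : 1 ≤ b) (h2 : b ≤ r)
    (hy : y ∈ Bsub P b) (hC : C (b + 1) 0) :
    y * al P (r + 2) (b + 1) (b + 1) 0 ∈ alSpan P r C (Bsub P r) := by
  rw [(commute_al_zero_of_mem_Bsub h1 hy (Nat.lt_succ_self b) le_rfl).eq]
  exact al_mul_mem (by omega) le_rfl (by omega) hC (Bsub_mono h2 hy)

theorem Ypow_mul_seg_mem {i b : ℕ} (h1 : 1 ≤ i) (h2 : i ≤ b) (s : ℤ) :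
    Ypow P i s * seg (Xg P) i b ∈ Bsub P b :=
  mul_mem (Ypow_mem h1 h2 s) (seg_mem fun _ _ _ => Xg_mem (by omega) (by omega))

section
variable {r : ℕ} (hr : r + 2 ≤ P.n)
include hr

theorem IsXE.mul_al_of_eq {z : ℕ → Alg P} (hz : IsXE P z) {i b : ℕ} (h1 : 1 ≤ i) (h2 : i ≤ b)
    (h3 : b ≤ r) (s : ℤ) :
    z (b + 1) * al P (r + 2) i (b + 1) s ∈ alSpan P r (ActCond (b + 1) i s) (Bsub P r) := by
  have hab : b + 1 = b + 1 ∨ b = b + 1 + 1 := Or.inl rfl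
  have c1 := hz.commute_Ypow_of_lt (show i < b + 1 by omega) h1 s
  have c2 : Commute (z (b + 1)) (seg (Xg P) i b) :=
    seg_commute fun _ _ _ => hz.commute isXE_Xg (by omega)
  have e : z (b + 1) * al P (r + 2) i (b + 1) s = Ypow P i s * seg (Xg P) i b *
      (z (b + 1) * Xg P b * Eg P (b + 1)) * seg (Eg P) (b + 2) (r + 2) := by
    rw [al, seg_succ_right _ h2, seg_succ_left (Eg P) (by omega)]
    linear_combination (norm := noncomm_ring)
      c1.eq * seg (Xg P) i b * Xg P b * Eg P (b + 1) * seg (Eg P) (b + 2) (r + 2)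
      + Ypow P i s * c2.eq * Xg P b * Eg P (b + 1) * seg (Eg P) (b + 2) (r + 2)
  rw [e]
  obtain rfl | rfl := hz
  · rw [Xg_Xg_Eg (by omega) (by omega) (by omega) (by omega) (Or.inr rfl),
      ← mul_one (_ * seg (Eg P) (b + 2) (r + 2)), mul_assoc (Ypow P i s * _), mul_assoc (Eg P b),
      ← seg_succ_left _ (by omega), ← seg_succ_left _ (by omega), ← al]
    exact al_mul_mem h1 h2 (by omega) (ActCond.refl s) (one_mem _)
  · rw [Eg_Xg_Eg (by omega) (by omega) (by omega) (by omega) (Or.inl rfl), mul_smul_comm,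
      smul_mul_assoc, mul_assoc, ← seg_succ_left _ (by omega),
      show seg (Eg P) (b + 1) (r + 2) = al P (r + 2) (b + 1) (b + 1) 0 by
        rw [al_self, Ypow_zero, one_mul]]
    exact Submodule.smul_mem _ _ (mul_al_self_mem (by omega) h3
      (Ypow_mul_seg_mem h1 h2 s) (actCond_zero s))

theorem IsXE.mul_al_of_eq_succ {z : ℕ → Alg P} (hz : IsXE P z) {i j : ℕ} (h1 : 1 ≤ i) (h2 : i ≤ j)
    (h3 : j ≤ r) (s : ℤ) :
    z (j + 1) * al P (r + 2) i j s ∈ alSpan P r (ActCond (j + 1) i s) (Bsub P r) := by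
  have c1 := hz.commute_Ypow_of_lt (show i < j + 1 by omega) h1 s
  have c2 : Commute (z (j + 1)) (seg (Xg P) i j) :=
    seg_commute fun _ _ _ => hz.commute isXE_Xg (by omega)
  have e : z (j + 1) * al P (r + 2) i j s = Ypow P i s * seg (Xg P) i j *
      (z (j + 1) * Eg P j * Eg P (j + 1)) * seg (Eg P) (j + 2) (r + 2) := by
    rw [al, seg_succ_left (Eg P) (by omega), seg_succ_left (Eg P) (by omega)]
    linear_combination (norm := noncomm_ring)
      c1.eq * seg (Xg P) i j * Eg P j * Eg P (j + 1) * seg (Eg P) (j + 2) (r + 2)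
      + Ypow P i s * c2.eq * Eg P j * Eg P (j + 1) * seg (Eg P) (j + 2) (r + 2)
  have mem : Ypow P i s * seg (Xg P) i j * seg (Eg P) (j + 1) (r + 2)
      ∈ alSpan P r (ActCond (j + 1) i s) (Bsub P r) := by
    rw [show seg (Eg P) (j + 1) (r + 2) = al P (r + 2) (j + 1) (j + 1) 0 by
        rw [al_self, Ypow_zero, one_mul]]
    exact mul_al_self_mem (by omega) h3 (Ypow_mul_seg_mem h1 h2 s) (actCond_zero s)
  rw [e]
  obtain rfl | rfl := hz
  · obtain ⟨c, hc⟩ := Xgi_eq P j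
    have e2 : Ypow P i s * seg (Xg P) i j * (Xgi P j * Eg P (j + 1)) * seg (Eg P) (j + 2) (r + 2)
        = al P (r + 2) i (j + 1) s * 1 - c • (Ypow P i s * seg (Xg P) i j *
          seg (Eg P) (j + 1) (r + 2) - al P (r + 2) i j s * 1) := by
      rw [hc, al, al, seg_succ_right _ h2, seg_succ_left (Eg P) (show j < r + 2 by omega),
        seg_succ_left (Eg P) (show j + 1 < r + 2 by omega)]
      simp only [sub_mul, mul_sub, smul_mul_assoc, mul_smul_comm, one_mul, mul_one, mul_assoc]
    rw [Xg_Eg_Eg (by omega) (by omega) (by omega) (by omega) (Or.inl rfl), e2]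
    refine sub_mem (al_mul_mem h1 (by omega) (by omega) (ActCond.refl s) (one_mem _))
      (Submodule.smul_mem _ _ (sub_mem mem ?_))
    exact al_mul_mem h1 h2 (by omega) (ActCond.refl s) (one_mem _)
  · rw [Eg_Eg_Eg (by omega) (by omega) (by omega) (by omega) (Or.inr rfl), mul_assoc,
      ← seg_succ_left _ (by omega)]
    exact mem

theorem IsXE.mul_al_mem (H : ∀ i, 1 ≤ i → i + 1 ≤ P.n → EYE P i) {z : ℕ → Alg P} (hz : IsXE P z)
    {a i j : ℕ} (ha : 1 ≤ a) (ha' : a ≤ r + 1) (h1 : 1 ≤ i) (h2 : i ≤ j) (h3 : j ≤ r + 1)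
    (s : ℤ) : z a * al P (r + 2) i j s ∈ alSpan P r (ActCond a i s) (Bsub P r) := by
  obtain h | rfl | rfl | h : a + 2 ≤ i ∨ i = a + 1 ∨ a = i ∨ i < a := by omega
  · rw [(commute_al_of_mem_Bsub (t := a + 1) (by omega) (hz.mem ha le_rfl) (by omega) h2
      (by omega) s).eq]
    exact al_mul_mem h1 h2 h3 (ActCond.refl s) (hz.mem ha (by omega))
  · refine alSpan_mono ?_ subset_rfl (hz.mul_al_succ hr ha h2 h3 s)
    rintro i' c - - ⟨h4, h5, h6, h7⟩
    exact ⟨by omega, by omega, h6, h7⟩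
  · obtain h | rfl := Nat.lt_or_eq_of_le h2
    · exact hz.mul_al_of_eq_of_lt hr H h1 h h3 s
    · rw [al_eq, ← mul_assoc, ← mul_one (al P _ a a 0)]
      exact hz.mul_Ypow_al_mem hr H h1 h3 le_rfl (one_mem _)
  · obtain h4 | rfl | rfl | h4 : a < j ∨ a = j ∨ a = j + 1 ∨ j + 2 ≤ a := by omega
    · rw [hz.mul_al_of_lt hr h1 h h4 h3 s]
      exact al_mul_mem h1 h2 h3 (ActCond.refl s) (hz.mem (by omega) (by omega))
    · obtain ⟨b, rfl⟩ : ∃ b, a = b + 1 := ⟨a - 1, by omega⟩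
      exact hz.mul_al_of_eq hr h1 (by omega) (by omega) s
    · exact hz.mul_al_of_eq_succ hr h1 h2 (by omega) s
    · rw [hz.mul_al_of_gt hr h1 h2 h4 ha' s]
      exact al_mul_mem h1 h2 h3 (ActCond.refl s) (hz.mem (by omega) (by omega))

/-- If the constraint `C` absorbs the constraints produced by `z_a`, then `z_a` acts. -/
theorem IsXE.mul_mem_alSpan (H : ∀ i, 1 ≤ i → i + 1 ≤ P.n → EYE P i) {z : ℕ → Alg P}
    (hz : IsXE P z) {a : ℕ} (ha : 1 ≤ a) (ha' : a ≤ r + 1) {C C' : ℕ → ℤ → Prop}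
    {Q : Set (Alg P)} (hQ : ∀ b ∈ Bsub P r, ∀ x ∈ Q, b * x ∈ Q)
    (hC : ∀ i s i' c, 1 ≤ i' → C i s → ActCond a i s i' c → C' i' c) {x : Alg P}
    (hx : x ∈ alSpan P r C Q) : z a * x ∈ alSpan P r C' Q := by
  refine mem_mul_of_mem_span ?_ hx
  rintro _ ⟨i, j, s, b, hb, h1, h2, h3, h4, rfl⟩
  rw [← mul_assoc]
  refine CBMW.mul_mem_alSpan (alSpan_mono ?_ subset_rfl (hz.mul_al_mem hr H ha ha' h1 h2 h3 s))
    fun y hy => hQ y hy b hb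
  exact fun i' c h5 _ h6 => hC i s i' c h5 h4 h6

theorem segAlg_mul_mem_alSpan (H : ∀ i, 1 ≤ i → i + 1 ≤ P.n → EYE P i) {g : ℕ} (hg : 1 ≤ g)
    (d : ℤ) {β x : Alg P} (hβ : β ∈ segAlg P g (r + 2))
    (hx : x ∈ alSpan P r (fun i s => g ≤ i ∧ |s| ≤ d) (Bsub P r)) :
    β * x ∈ alSpan P r (fun i s => g ≤ i ∧ |s| ≤ d) (Bsub P r) := by
  have key : ∀ z, IsXE P z → ∀ a, g ≤ a → a + 1 ≤ r + 2 →
      z a ∈ lstab (alSpan P r (fun i s => g ≤ i ∧ |s| ≤ d) (Bsub P r)) := fun z hz a h1 h2 y hy =>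
    hz.mul_mem_alSpan hr H (by omega) (by omega) (fun b hb c hc => mul_mem hb hc)
      (fun i s i' c _ h3 h4 => ⟨by have := h4.1; omega, h4.2.2.1.trans h3.2⟩) hy
  exact segAlg_le (key _ isXE_Xg) (key _ isXE_Eg) hβ x hx

end

theorem Ypow_one_mem_span_Pset (hk : 1 ≤ P.k) (hq0 : P.qc 0 = (P.q0 : R)) (p : ℤ) :
    Ypow P 1 p ∈ Submodule.span R {z | ∃ s ∈ Pset P.k, z = Ypow P 1 s} := by
  refine Submodule.span_mono ?_ (Ypow_one_mem_span hk hq0 (↑(P.k / 2) - ((P.k : ℤ) - 1)) p)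
  rintro _ ⟨s, h1, h2, rfl⟩
  exact ⟨s, ⟨h1, by omega⟩, rfl⟩

theorem zero_mem_Pset {k : ℕ} (hk : 1 ≤ k) : (0 : ℤ) ∈ Pset k := by
  constructor <;> omega

theorem mem_Pset_of_hull {k : ℕ} (hk : 1 ≤ k) {s c : ℤ} (hs : s ∈ Pset k) (h1 : min 0 s ≤ c)
    (h2 : c ≤ max 0 s) : c ∈ Pset k := by
  obtain ⟨h3, h4⟩ := hs
  constructor <;> omega

section
variable (hk : 1 ≤ P.k) (hq0 : P.qc 0 = (P.q0 : R)) {r : ℕ} (hr : r + 2 ≤ P.n)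
include hk hq0 hr

theorem Bsub_mul_mem_alSpan_of_le {Q : Set (Alg P)} (hQ : ∀ b ∈ Bsub P r, ∀ x ∈ Q, b * x ∈ Q)
    {i : ℕ} (h1 : 1 ≤ i) (h2 : i ≤ r + 1) {b x : Alg P} (hb : b ∈ Bsub P i)
    (hx : x ∈ alSpan P r (fun i' s => i' ≤ i ∧ s ∈ Pset P.k) Q) :
    b * x ∈ alSpan P r (fun i' s => i' ≤ i ∧ s ∈ Pset P.k) Q := by
  have H : ∀ i, 1 ≤ i → i + 1 ≤ P.n → EYE P i := fun i h1 h2 => EYE_of_le hk hq0 h1 h2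
  induction i, h1 using Nat.le_induction generalizing b x with
  | base =>
    have key : ∀ p, Ypow P 1 p ∈ lstab (alSpan P r (fun i' s => i' ≤ 1 ∧ s ∈ Pset P.k) Q) := by
      intro p
      refine mem_lstab_span ?_
      rintro _ ⟨i, j, s, b, hb, h1, h2, h3, ⟨h4, h5⟩, rfl⟩
      obtain rfl : i = 1 := by omega
      rw [← mul_assoc, Ypow_mul_al, al_eq, mul_assoc]
      refine mul_mem_of_mem_span ?_ (Ypow_one_mem_span_Pset hk hq0 (p + s))
      rintro _ ⟨t, ht, rfl⟩
      rw [← mul_assoc, ← al_eq]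
      exact al_mul_mem h1 h2 h3 ⟨le_rfl, ht⟩ hb
    have hY := key 1
    have hYi := key (-1)
    rw [Ypow_one, Yp_one] at hY
    rw [Ypow_neg_one] at hYi
    exact Bsub_le hY (by simpa [YpInv, downXi, upXi] using hYi) (fun a _ _ => by omega)
      (fun a _ _ => by omega) hb x hx
  | succ i hi ih =>
    have mono : alSpan P r (fun i' s => i' ≤ i ∧ s ∈ Pset P.k) Q
        ≤ alSpan P r (fun i' s => i' ≤ i + 1 ∧ s ∈ Pset P.k) Q :=
      alSpan_mono (fun _ _ _ _ h => ⟨by omega, h.2⟩) subset_rfl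
    have small : ∀ b ∈ Bsub P i, b ∈ lstab (alSpan P r (fun i' s => i' ≤ i + 1 ∧ s ∈ Pset P.k) Q) := by
      intro b hb
      refine mem_lstab_span ?_
      rintro _ ⟨i', j, s, c, hc, h4, h5, h6, ⟨h7, h8⟩, rfl⟩
      obtain rfl | h := Nat.eq_or_lt_of_le h7
      · rw [← mul_assoc, (commute_al_of_mem_Bsub hi hb (by omega) h5 (by omega) s).eq, mul_assoc]
        exact al_mul_mem h4 h5 h6 ⟨le_rfl, h8⟩ (hQ b (Bsub_mono (by omega) hb) c hc)
      · exact mono (ih (by omega) hb (al_mul_mem h4 h5 h6 ⟨by omega, h8⟩ hc))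
    have key : ∀ z, IsXE P z →
        z i ∈ lstab (alSpan P r (fun i' s => i' ≤ i + 1 ∧ s ∈ Pset P.k) Q) := by
      intro z hz
      refine mem_lstab_span ?_
      rintro _ ⟨i', j, s, c, hc, h4, h5, h6, ⟨h7, h8⟩, rfl⟩
      have h9 := hz.mul_mem_alSpan hr H hi (by omega) hQ
        (C := fun i₁ t => i₁ ≤ i + 1 ∧ t ∈ Pset P.k)
        (C' := fun i₁ t => i₁ ≤ i + 1 ∧ (i < i₁ → t ∈ Pset P.k))
        (fun i₁ s₁ i₂ c _ h h' => ⟨by have := h'.2.1; omega, fun h10 =>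
          have := h'.2.2.2 h10
          mem_Pset_of_hull hk h.2 this.1 this.2⟩) (al_mul_mem h4 h5 h6 ⟨h7, h8⟩ hc)
      refine Submodule.span_le.2 ?_ h9
      rintro _ ⟨i₁, j₁, t, c₁, hc₁, h10, h11, h12, ⟨h13, h14⟩, rfl⟩
      obtain h | h := Nat.lt_or_ge i i₁
      · exact al_mul_mem h10 h11 h12 ⟨h13, h14 h⟩ hc₁
      · rw [al_eq, mul_assoc]
        exact mono (ih (by omega) (Ypow_mem h10 h t)
          (al_mul_mem h10 h11 h12 ⟨h, zero_mem_Pset hk⟩ hc₁))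
    have key' : ∀ z, IsXE P z → ∀ a, 1 ≤ a → a + 1 ≤ i + 1 →
        z a ∈ lstab (alSpan P r (fun i' s => i' ≤ i + 1 ∧ s ∈ Pset P.k) Q) := by
      intro z hz a h3 h4
      obtain h | rfl := Nat.lt_or_eq_of_le (Nat.le_of_succ_le_succ h4)
      · exact small _ (hz.mem h3 h)
      · exact key z hz
    exact Bsub_le (small _ (Yg_mem _)) (small _ (Ygi_mem _)) (key' _ isXE_Xg) (key' _ isXE_Eg)
      hb x hx

theorem Bsub_mul_mem_alSpan {Q : Set (Alg P)} (hQ : ∀ b ∈ Bsub P r, ∀ x ∈ Q, b * x ∈ Q)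
    {b x : Alg P} (hb : b ∈ Bsub P (r + 2))
    (hx : x ∈ alSpan P r (fun _ s => s ∈ Pset P.k) Q) :
    b * x ∈ alSpan P r (fun _ s => s ∈ Pset P.k) Q := by
  have H : ∀ i, 1 ≤ i → i + 1 ≤ P.n → EYE P i := fun i h1 h2 => EYE_of_le hk hq0 h1 h2
  have to_le : alSpan P r (fun _ s => s ∈ Pset P.k) Q
      ≤ alSpan P r (fun i s => i ≤ r + 1 ∧ s ∈ Pset P.k) Q :=
    alSpan_mono (fun i s _ h h' => ⟨h, h'⟩) subset_rfl
  have of_le : alSpan P r (fun i s => i ≤ r + 1 ∧ s ∈ Pset P.k) Q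
      ≤ alSpan P r (fun _ s => s ∈ Pset P.k) Q :=
    alSpan_mono (fun i s _ _ h' => h'.2) subset_rfl
  have small : ∀ b ∈ Bsub P (r + 1), b ∈ lstab (alSpan P r (fun _ s => s ∈ Pset P.k) Q) :=
    fun b hb y hy => of_le (Bsub_mul_mem_alSpan_of_le hk hq0 hr hQ (by omega) le_rfl hb (to_le hy))
  have key' : ∀ z, IsXE P z → ∀ a, 1 ≤ a → a + 1 ≤ r + 2 →
      z a ∈ lstab (alSpan P r (fun _ s => s ∈ Pset P.k) Q) := by
    intro z hz a h3 h4 y hy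
    have h9 := hz.mul_mem_alSpan hr H h3 (by omega) hQ
      (C' := fun i₁ t => (a < i₁ → t ∈ Pset P.k))
      (fun i₁ s₁ i₂ c _ h h' h10 =>
        have := h'.2.2.2 h10
        mem_Pset_of_hull hk h this.1 this.2) hy
    refine Submodule.span_le.2 ?_ h9
    rintro _ ⟨i₁, j₁, t, c₁, hc₁, h10, h11, h12, h13, rfl⟩
    rw [al_eq, mul_assoc]
    exact small _ (Ypow_mem h10 (by omega) t) _ (al_mul_mem h10 h11 h12 (zero_mem_Pset hk) hc₁)
  exact Bsub_le (small _ (Yg_mem _)) (small _ (Ygi_mem _)) (key' _ isXE_Xg) (key' _ isXE_Eg) hb x hx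

end

theorem seg_shift {A : Type*} [Monoid A] {f : ℕ → A} {y : A} {t i j : ℕ} (hij : i ≤ j)
    (h : ∀ a, i ≤ a → a < j → f (a + t) * y = y * f a) :
    seg f (i + t) (j + t) * y = y * seg f i j := by
  induction j, hij using Nat.le_induction with
  | base => simp
  | succ j hij ih =>
    rw [seg_succ_right f hij, show j + 1 + t = j + t + 1 by omega, seg_succ_right f (by omega),
      mul_assoc, h j hij (by omega), ← mul_assoc, ih fun a h1 h2 => h a h1 (by omega), mul_assoc]

theorem Ypow_shift_E {j g m : ℕ} (h1 : 1 ≤ j) (h2 : j ≤ g) (h3 : g + 2 ≤ m) (hm : m ≤ P.n) (c : ℤ) :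
    Ypow P (g + 2) c * seg (Eg P) j m = seg (Eg P) j m * Ypow P g c := by
  have h4 : 1 ≤ g := by omega
  have c1 : Commute (Ypow P (g + 2) c) (seg (Eg P) j (g + 1)) :=
    seg_commute fun a _ _ => (isXE_Eg.commute_Ypow_of_gt (by omega) (by omega) (by omega) c).symm
  have c2 : Commute (Ypow P g c) (seg (Eg P) (g + 1) m) :=
    seg_commute fun a _ _ => (isXE_Eg.commute_Ypow_of_lt (by omega) h4 c).symm
  have e1 := Ypow_succ_mul_Eg (P := P) (i := g + 1) (by omega) (by omega) c
  have e2 := Eg_mul_Ypow_succ (P := P) h4 (by omega) (-c)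
  rw [neg_neg] at e2
  rw [← seg_mul_seg (Eg P) (show j ≤ g + 1 by omega) (show g + 1 ≤ m by omega)]
  rw [seg_succ_left _ (show g + 1 < m by omega), seg_succ_right _ h2] at *
  linear_combination (norm := noncomm_ring)
    c1.eq * Eg P (g + 1) * seg (Eg P) (g + 1 + 1) m
    + seg (Eg P) j g * Eg P g * e1 * seg (Eg P) (g + 1 + 1) m
    + seg (Eg P) j g * e2 * Eg P (g + 1) * seg (Eg P) (g + 1 + 1) m
    + seg (Eg P) j g * Eg P g * c2.eq

theorem seg_E_mul_seg_E {j h m : ℕ} (h1 : 1 ≤ j) (h2 : j ≤ h) (h3 : h + 1 ≤ m) (hm : m + 2 ≤ P.n) :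
    seg (Eg P) j (m + 2) * seg (Eg P) h m = seg (Eg P) (h + 2) (m + 2) * seg (Eg P) j m := by
  rw [← seg_shift (by omega) fun a _ _ => isXE_Eg.shift_E h1 (by omega) (by omega) hm,
    seg_succ_right _ (show h + 2 ≤ m + 1 by omega), seg_succ_right _ (show j ≤ m + 1 by omega),
    seg_succ_right _ (show j ≤ m by omega)]
  have e := Eg_Eg_Eg (P := P) (i := m + 1) (j := m) (by omega) (by omega) (by omega) (by omega)
    (by omega)
  have c : Commute (Eg P (m + 1)) (seg (Eg P) j m) :=
    seg_commute fun _ _ _ => commute_Eg_Eg P (by omega)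
  linear_combination (norm := noncomm_ring)
    seg (Eg P) (h + 2) (m + 1) * (c.eq * Eg P m * Eg P (m + 1) + seg (Eg P) j m * e - c.eq)

theorem seg_E_mul_al {j g h m : ℕ} (h1 : 1 ≤ j) (h2 : j ≤ g) (h3 : g ≤ h) (h4 : h + 1 ≤ m)
    (hm : m + 2 ≤ P.n) (c : ℤ) :
    seg (Eg P) j (m + 2) * al P m g h c = al P (m + 2) (g + 2) (h + 2) c * seg (Eg P) j m := by
  have e1 := Ypow_shift_E (P := P) h1 h2 (show g + 2 ≤ m + 2 by omega) hm c
  have e2 : seg (Xg P) (g + 2) (h + 2) * seg (Eg P) j (m + 2)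
      = seg (Eg P) j (m + 2) * seg (Xg P) g h :=
    seg_shift h3 fun a _ _ => isXE_Xg.shift_E h1 (by omega) (by omega) hm
  have e3 := seg_E_mul_seg_E (P := P) h1 (h2.trans h3) h4 hm
  rw [al, al]
  linear_combination (norm := noncomm_ring)
    - e1 * seg (Xg P) g h * seg (Eg P) h m - Ypow P (g + 2) c * e2 * seg (Eg P) h m
    + Ypow P (g + 2) c * seg (Xg P) (g + 2) (h + 2) * e3

theorem seg_X_mul_seg_E {i u m : ℕ} (hi : 1 ≤ i) (h1 : i ≤ u) (h2 : u + 1 ≤ m) (hm : m + 2 ≤ P.n) :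
    seg (Xg P) i (u + 2) * seg (Eg P) (u + 2) (m + 2) * seg (Eg P) u m
      = seg (Eg P) (u + 1) (m + 2) * al P m i u 0 := by
  have e := Xg_Xg_Eg (P := P) (i := u) (j := u + 1) (by omega) (by omega) (by omega) (by omega)
    (Or.inl rfl)
  have c1 : Commute (Eg P u) (seg (Eg P) (u + 2) (m + 2)) :=
    seg_commute fun _ _ _ => commute_Eg_Eg P (by omega)
  have c2 : Commute (seg (Xg P) i u) (seg (Eg P) (u + 1) (m + 2)) :=
    seg_commute fun a _ _ => (seg_commute fun b _ _ => (commute_Xg_Eg P (by omega)).symm).symm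
  rw [al_zero, seg_succ_right _ (show i ≤ u + 1 by omega), seg_succ_right _ h1,
    seg_succ_left _ (show u < m by omega)]
  rw [seg_succ_left _ (show u + 1 < m + 2 by omega), show u + 1 + 1 = u + 2 from rfl] at *
  linear_combination (norm := noncomm_ring)
    (seg (Xg P) i u * Xg P u * Xg P (u + 1) * c1.symm.eq
      + seg (Xg P) i u * e * seg (Eg P) (u + 2) (m + 2)
      + seg (Xg P) i u * Eg P (u + 1) * c1.eq + c2.eq * Eg P u) * seg (Eg P) (u + 1) m

theorem commute_seg_E_of_lt {j g h m : ℕ} {z : ℕ → Alg P} (hz : IsXE P z) (h1 : h + 1 ≤ j) :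
    Commute (seg z g h) (seg (Eg P) j m) :=
  seg_commute fun _ _ _ => (seg_commute fun _ _ _ => isXE_Eg.commute hz (by omega)).symm

theorem al_mul_al_zero_of_add_two_le {i j g h m : ℕ} (hi : 1 ≤ i) (h1 : i ≤ g) (h2 : g ≤ h)
    (h3 : h + 2 ≤ j) (h4 : j ≤ m + 1) (hm : m + 2 ≤ P.n) :
    al P (m + 2) i j 0 * al P m g h 0
      = al P (m + 2) (g + 1) (h + 1) 0 * al P m i (j - 2) 0 := by
  obtain ⟨u, rfl⟩ : ∃ u, j = u + 2 := ⟨j - 2, by omega⟩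
  have c1 := commute_seg_E_of_lt (P := P) (g := g) (h := h) (j := u + 2) (m := m + 2) isXE_Xg
    (by omega)
  have c2 := commute_seg_E_of_lt (P := P) (g := h) (h := u) (j := u + 2) (m := m + 2) isXE_Eg
    (by omega)
  have e1 : seg (Xg P) (g + 1) (h + 1) * seg (Xg P) i (u + 2)
      = seg (Xg P) i (u + 2) * seg (Xg P) g h :=
    seg_shift h2 fun a _ _ => isXE_Xg.shift_X hi (by omega) (by omega) (by omega)
  have e2 : seg (Eg P) (h + 1) (u + 1) * seg (Xg P) i (u + 2)
      = seg (Xg P) i (u + 2) * seg (Eg P) h u :=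
    seg_shift (by omega) fun a _ _ => isXE_Eg.shift_X hi (by omega) (by omega) (by omega)
  have e3 := seg_X_mul_seg_E (P := P) hi (show i ≤ u by omega) (show u + 1 ≤ m by omega) hm
  rw [Nat.add_sub_cancel]
  simp only [al_zero] at *
  rw [← seg_mul_seg (Eg P) (show h ≤ u by omega) (show u ≤ m by omega),
    ← seg_mul_seg (Eg P) (show h + 1 ≤ u + 1 by omega) (show u + 1 ≤ m + 2 by omega)]
  linear_combination (norm := noncomm_ring)
    seg (Xg P) i (u + 2) * c1.symm.eq * seg (Eg P) h u * seg (Eg P) u m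
    - e1 * seg (Eg P) (u + 2) (m + 2) * seg (Eg P) h u * seg (Eg P) u m
    - seg (Xg P) (g + 1) (h + 1) * seg (Xg P) i (u + 2) * c2.eq * seg (Eg P) u m
    - seg (Xg P) (g + 1) (h + 1) * e2 * seg (Eg P) (u + 2) (m + 2) * seg (Eg P) u m
    + seg (Xg P) (g + 1) (h + 1) * seg (Eg P) (h + 1) (u + 1) * e3

theorem al_mul_al_zero_of_le {i u g h m : ℕ} (hi : 1 ≤ i) (h1 : i ≤ g) (h2 : g ≤ u)
    (h3 : u ≤ h) (h4 : h + 1 ≤ m) (hm : m + 2 ≤ P.n) :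
    al P (m + 2) i (u + 1) 0 * al P m g h 0
      = seg (Xg P) (g + 1) (u + 1) * Xgi P (u + 1) * al P (m + 2) (u + 2) (h + 2) 0
        * al P m i u 0 := by
  have c1 := commute_seg_E_of_lt (P := P) (g := g) (h := u) (j := u + 1) (m := m + 2) isXE_Xg
    (by omega)
  have e1 : seg (Xg P) (g + 1) (u + 1) * seg (Xg P) i (u + 1)
      = seg (Xg P) i (u + 1) * seg (Xg P) g u :=
    seg_shift h2 fun a _ _ => isXE_Xg.shift_X hi (by omega) (by omega) (by omega)
  have e2 := Xg_Eg_eq (P := P) (i := u + 1) (j := u) (by omega) (by omega) (by omega) (by omega)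
    (Or.inr rfl)
  have e3 := seg_E_mul_al (P := P) (j := u) (g := u) (by omega) le_rfl h3 h4 hm 0
  have c2 : Commute (seg (Xg P) i u) (Xgi P (u + 1)) :=
    commute_Xgi_of_commute P (seg_commute fun _ _ _ => commute_Xg_Xg P (by omega)).symm
  have c3 := commute_al_zero_of_mem_Bsub (P := P) (m := m + 2) (j := h + 2) (t := u) (by omega)
    (seg_mem (S := Bsub P u) (f := Xg P) (i := i) (j := u) fun _ _ _ => Xg_mem (by omega) (by omega))
    (show u < u + 2 by omega) (by omega)
  rw [seg_succ_left _ (show u < m + 2 by omega), al_zero m] at e3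
  rw [al_zero _ i, al_zero _ i, al_zero m, ← seg_mul_seg (Xg P) h2 h3]
  rw [seg_succ_right (Xg P) (h1.trans h2)] at e1 ⊢
  rw [seg_succ_left _ (show u + 1 < m + 2 by omega), show u + 1 + 1 = u + 2 from rfl] at c1 e3 ⊢
  linear_combination (norm := noncomm_ring)
    seg (Xg P) i u * Xg P u * c1.symm.eq * seg (Xg P) u h * seg (Eg P) h m
    - e1 * Eg P (u + 1) * seg (Eg P) (u + 2) (m + 2) * seg (Xg P) u h * seg (Eg P) h m
    + seg (Xg P) (g + 1) (u + 1) * (seg (Xg P) i u * e2 * seg (Eg P) (u + 2) (m + 2)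
      * seg (Xg P) u h * seg (Eg P) h m + seg (Xg P) i u * Xgi P (u + 1) * e3
      + c2.eq * al P (m + 2) (u + 2) (h + 2) 0 * seg (Eg P) u m
      + Xgi P (u + 1) * c3.eq * seg (Eg P) u m)

/-- The span of the chains `α_{i,j,r+1}^s` with `s` in the exponent set, times `B_r`. -/
abbrev stdSpan (P : Params R) (r : ℕ) : Submodule R (Alg P) :=
  alSpan P r (fun _ s => s ∈ Pset P.k) (Bsub P r)

theorem commute_Ypow_seg_X {i g : ℕ} (hi : 1 ≤ i) (hg : g + 1 ≤ P.n) (p : ℤ) :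
    Commute (Ypow P (g + 1) p) (seg (Xg P) i g) :=
  seg_commute fun _ _ _ => (isXE_Xg.commute_Ypow_of_gt (by omega) (by omega) hg p).symm

section
variable (hk : 1 ≤ P.k) (hq0 : P.qc 0 = (P.q0 : R)) {r : ℕ} (hr : r + 4 ≤ P.n)
include hk

theorem al_zero_mem_stdSpan {i j : ℕ} (h1 : 1 ≤ i) (h2 : i ≤ j) (h3 : j ≤ r + 1) :
    al P (r + 2) i j 0 ∈ stdSpan P r := by
  rw [← mul_one (al P (r + 2) i j 0)]
  exact al_mul_mem h1 h2 h3 (zero_mem_Pset hk) (one_mem _)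

include hr hq0

theorem mul_mem_stdSpan {b x : Alg P} (hb : b ∈ Bsub P (r + 2)) (hx : x ∈ stdSpan P r) :
    b * x ∈ stdSpan P r :=
  Bsub_mul_mem_alSpan hk hq0 (by omega) (fun _ hb _ hx => mul_mem hb hx) hb hx

/-- Moving `e_g ⋯` past a chain that starts at or after `g` raises its starting index by two. -/
theorem Eg_mul_al_mul_mem {i j g h : ℕ} {a b p : ℤ} (hi : 1 ≤ i) (h1 : i ≤ g) (h2 : g ≤ h)
    (h3 : h ≤ r + 1) (h4 : g < j) (h5 : j ≤ r + 3) (hp : p ∈ Pset P.k) (hab : a + b = p)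
    (ha : 1 ≤ a ∧ a ≤ p ∨ p < a ∧ a ≤ 0) :
    Ypow P (g + 1) a * seg (Xg P) i g * (Eg P g * al P (r + 2 + 2) (g + 1) j 0)
      * al P (r + 2) g h b
      ∈ alSpan P (r + 2) (fun i' s => i < i' ∧ s ∈ Pset P.k) (stdSpan P r) := by
  obtain ⟨β, hβ, e⟩ := Eg_mul_al_succ (P := P) (m := r + 2 + 2) (i := g) (j := j) (by omega) h4
    (by omega) hr
  have hx := segAlg_mul_mem_alSpan (r := r) (by omega) (fun i h1 h2 => EYE_of_le hk hq0 h1 h2)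
    (show 1 ≤ g by omega) |b| hβ
    (x := al P (r + 2) g h b) (by
      rw [← mul_one (al P (r + 2) g h b)]
      exact al_mul_mem (by omega) h2 h3 ⟨le_rfl, le_rfl⟩ (one_mem _))
  rw [e, mul_assoc _ (_ * β), mul_assoc _ β, ← mul_assoc _ (al P (r + 2 + 2) g g 0)]
  refine mem_mul_of_mem_span ?_ hx
  rintro _ ⟨g', h', b', c, hc, h6, h7, h8, ⟨h9, h10⟩, rfl⟩
  have hb' : b' ∈ Pset P.k := by
    obtain ⟨h11, h12⟩ := hp
    have := abs_le.1 h10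
    constructor <;> grind
  have e1 := seg_E_mul_al (P := P) (j := g) (m := r + 2) (by omega) h9 h7 (by omega) hr b'
  have hy : Ypow P (g + 1) a * seg (Xg P) i g ∈ Bsub P (g + 1) :=
    mul_mem (Ypow_mem (by omega) le_rfl a) (seg_mem fun _ _ _ => Xg_mem (by omega) (by omega))
  have c1 := commute_al_of_mem_Bsub (m := r + 2 + 2) (j := h' + 2) (by omega) hy
    (show g + 1 < g' + 2 by omega) (by omega) (by omega) b'
  have e2 : Ypow P (g + 1) a * seg (Xg P) i g * al P (r + 2 + 2) g g 0 *
      (al P (r + 2) g' h' b' * c) = al P (r + 2 + 2) (g' + 2) (h' + 2) b' *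
      (Ypow P (g + 1) a * seg (Xg P) i g * (al P (r + 2) g g 0 * c)) := by
    rw [al_self _ g, al_self _ g, Ypow_zero, one_mul, one_mul]
    linear_combination (norm := noncomm_ring)
      Ypow P (g + 1) a * seg (Xg P) i g * e1 * c + c1.eq * seg (Eg P) g (r + 2) * c
  rw [e2]
  exact al_mul_mem (by omega) (by omega) (by omega) ⟨by omega, hb'⟩
    (mul_mem_stdSpan hk hq0 hr (Bsub_mono (by omega) hy)
      (al_mul_mem (by omega) le_rfl (by omega) (zero_mem_Pset hk) hc))

theorem Ypow_mul_al_mul_al_mem {i j g h : ℕ} {p : ℤ} (hi : 1 ≤ i) (h1 : i ≤ g) (h2 : g ≤ h)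
    (h3 : h ≤ r + 1) (h4 : g < j) (h5 : j ≤ r + 3) (hp : p ∈ Pset P.k) :
    Ypow P (g + 1) p * (al P (r + 2 + 2) i j 0 * al P (r + 2) g h 0)
      ∈ alSpan P (r + 2) (fun i' s => i < i' ∧ s ∈ Pset P.k) (stdSpan P r) := by
  by_cases h6 : h + 2 ≤ j
  · rw [al_mul_al_zero_of_add_two_le hi h1 h2 h6 (by omega) hr, ← mul_assoc, ← al_eq]
    exact al_mul_mem (by omega) (by omega) (by omega) ⟨by omega, hp⟩
      (al_zero_mem_stdSpan hk hi (by omega) (by omega))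
  obtain ⟨u, rfl⟩ : ∃ u, j = u + 1 := ⟨j - 1, by omega⟩
  have hW : al P (r + 2) i u 0 ∈ stdSpan P r := al_zero_mem_stdSpan hk hi (by omega) (by omega)
  have hy : Ypow P (g + 1) p * seg (Xg P) (g + 1) (u + 1) ∈ Bsub P (u + 1) :=
    Ypow_mul_seg_mem (by omega) (by omega) p
  obtain ⟨c, hc⟩ := Xgi_eq P (u + 1)
  rw [al_mul_al_zero_of_le hi h1 (by omega) (by omega) (by omega) hr, hc]
  have hX : Ypow P (g + 1) p * (seg (Xg P) (g + 1) (u + 1) * Xg P (u + 1) *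
      al P (r + 2 + 2) (u + 2) (h + 2) 0 * al P (r + 2) i u 0)
      = al P (r + 2 + 2) (g + 1) (h + 2) p * al P (r + 2) i u 0 := by
    rw [al_eq _ (g + 1), al_zero _ (u + 2), al_zero _ (g + 1),
      ← seg_mul_seg (Xg P) (show g + 1 ≤ u + 1 by omega) (show u + 1 ≤ h + 2 by omega),
      seg_succ_left _ (show u + 1 < h + 2 by omega)]
    noncomm_ring
  have h1' : Ypow P (g + 1) p * (seg (Xg P) (g + 1) (u + 1) *
      al P (r + 2 + 2) (u + 2) (h + 2) 0 * al P (r + 2) i u 0)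
      = al P (r + 2 + 2) (u + 2) (h + 2) 0 *
        (Ypow P (g + 1) p * seg (Xg P) (g + 1) (u + 1) * al P (r + 2) i u 0) := by
    have := commute_al_zero_of_mem_Bsub (m := r + 2 + 2) (j := h + 2) (by omega) hy
      (show u + 1 < u + 2 by omega) (by omega)
    linear_combination (norm := noncomm_ring) this.eq * al P (r + 2) i u 0
  obtain ⟨β, hβ, e⟩ := Eg_mul_al_succ (P := P) (m := r + 2 + 2) (i := u + 1) (j := h + 2)
    (by omega) (by omega) (by omega) hr
  have hE : Ypow P (g + 1) p * (seg (Xg P) (g + 1) (u + 1) * Eg P (u + 1) *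
      al P (r + 2 + 2) (u + 2) (h + 2) 0 * al P (r + 2) i u 0)
      = al P (r + 2 + 2) (g + 1) (u + 1) p * (β * al P (r + 2) i u 0) := by
    have e' : al P (r + 2 + 2) (g + 1) (u + 1) p = Ypow P (g + 1) p * seg (Xg P) (g + 1) (u + 1) *
        al P (r + 2 + 2) (u + 1) (u + 1) 0 := by
      rw [al_self, Ypow_zero, one_mul, al]
    rw [e']
    linear_combination (norm := noncomm_ring)
      Ypow P (g + 1) p * seg (Xg P) (g + 1) (u + 1) * e * al P (r + 2) i u 0
  have split : Ypow P (g + 1) p * (seg (Xg P) (g + 1) (u + 1) *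
        (Xg P (u + 1) - c • (1 - Eg P (u + 1))) *
      al P (r + 2 + 2) (u + 2) (h + 2) 0 * al P (r + 2) i u 0)
      = al P (r + 2 + 2) (g + 1) (h + 2) p * al P (r + 2) i u 0
        - c • (al P (r + 2 + 2) (u + 2) (h + 2) 0 *
          (Ypow P (g + 1) p * seg (Xg P) (g + 1) (u + 1) * al P (r + 2) i u 0)
        - al P (r + 2 + 2) (g + 1) (u + 1) p * (β * al P (r + 2) i u 0)) := by
    rw [← hX, ← h1', ← hE]
    simp only [mul_sub, sub_mul, mul_smul_comm, smul_mul_assoc, mul_one]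
  rw [split]
  refine Submodule.sub_mem _ ?_ (Submodule.smul_mem _ _ (Submodule.sub_mem _ ?_ ?_))
  · exact al_mul_mem (by omega) (by omega) (by omega) ⟨by omega, hp⟩ hW
  · exact al_mul_mem (by omega) (by omega) (by omega) ⟨by omega, zero_mem_Pset hk⟩
      (mul_mem_stdSpan hk hq0 hr (Bsub_mono (by omega) hy) hW)
  · exact al_mul_mem (by omega) (by omega) (by omega) ⟨by omega, hp⟩
      (mul_mem_stdSpan hk hq0 hr (segAlg_le_Bsub (by omega) hβ) hW)

theorem al_zero_mul_al_mem {i j g h : ℕ} {p : ℤ} (hi : 1 ≤ i) (hij : i ≤ j) (h5 : j ≤ r + 3)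
    (h1 : i ≤ g) (h2 : g ≤ h) (h3 : h ≤ r + 1) (hp : p ∈ Pset P.k) :
    al P (r + 2 + 2) i j 0 * al P (r + 2) g h p
      ∈ alSpan P (r + 2) (fun i' s => i < i' ∧ s ∈ Pset P.k) (stdSpan P r) := by
  obtain h4 | h4 := Nat.lt_or_ge g j
  · obtain ⟨s, hs, e⟩ := Xg_mul_Ypow (P := P) (g := g) (by omega) (by omega) p
    have c1 := commute_al_zero_of_mem_Bsub (P := P) (m := r + 2 + 2) (j := j) (t := g) (by omega)
      (Ypow_mem (by omega) le_rfl p) (show g < g + 1 by omega) (by omega)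
    have c2 := commute_Ypow_seg_X (P := P) (g := g) hi (by omega) p
    have e1 : al P (r + 2 + 2) i j 0 = seg (Xg P) i g * Xg P g * al P (r + 2 + 2) (g + 1) j 0 := by
      rw [al_zero, al_zero, ← seg_mul_seg (Xg P) (show i ≤ g + 1 by omega) (show g + 1 ≤ j by omega),
        seg_succ_right _ h1, mul_assoc]
    have e2 : al P (r + 2 + 2) i j 0 * al P (r + 2) g h p
        = Ypow P (g + 1) p * (al P (r + 2 + 2) i j 0 * al P (r + 2) g h 0)
          + seg (Xg P) i g * s * (al P (r + 2 + 2) (g + 1) j 0 * al P (r + 2) g h 0) := by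
      rw [al_eq _ g, e1]
      linear_combination (norm := noncomm_ring)
        seg (Xg P) i g * Xg P g * c1.symm.eq * al P (r + 2) g h 0
        + seg (Xg P) i g * e * al P (r + 2 + 2) (g + 1) j 0 * al P (r + 2) g h 0
        + c2.symm.eq * Xg P g * al P (r + 2 + 2) (g + 1) j 0 * al P (r + 2) g h 0
    rw [e2]
    refine Submodule.add_mem _ (Ypow_mul_al_mul_al_mem hk hq0 hr hi h1 h2 h3 h4 h5 hp)
      (mul_mul_mem_of_mem_span ?_ hs)
    rintro _ ⟨a, b, w, hw, hab, ha, rfl⟩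
    have c3 := commute_al_zero_of_mem_Bsub (P := P) (m := r + 2 + 2) (j := j) (t := g) (by omega)
      (Ypow_mem (by omega) le_rfl b) (show g < g + 1 by omega) (by omega)
    have c4 := commute_Ypow_seg_X (P := P) (g := g) hi (by omega) a
    obtain rfl | rfl := hw
    · have c5 := commute_al_zero_of_mem_Bsub (P := P) (m := r + 2 + 2) (j := j) (t := g) (by omega)
        (seg_mem (S := Bsub P g) (f := Xg P) (i := i) (j := g)
          fun _ _ _ => Xg_mem (by omega) (by omega)) (show g < g + 1 by omega) (by omega)
      have e3 : seg (Xg P) i g * (Ypow P (g + 1) a * 1 * Ypow P g b) *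
          (al P (r + 2 + 2) (g + 1) j 0 * al P (r + 2) g h 0)
          = al P (r + 2 + 2) (g + 1) j a * (seg (Xg P) i g * Ypow P g b * al P (r + 2) g h 0) := by
        rw [al_eq _ (g + 1) j a]
        linear_combination (norm := noncomm_ring)
          seg (Xg P) i g * Ypow P (g + 1) a * c3.eq * al P (r + 2) g h 0
          + c4.symm.eq * al P (r + 2 + 2) (g + 1) j 0 * Ypow P g b * al P (r + 2) g h 0
          + Ypow P (g + 1) a * c5.eq * Ypow P g b * al P (r + 2) g h 0
      rw [e3]
      refine al_mul_mem (by omega) (by omega) (by omega)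
        ⟨by omega, mem_Pset_of_hull hk hp (by omega) (by omega)⟩
        (mul_mem_stdSpan hk hq0 hr (mul_mem (seg_mem fun _ _ _ => Xg_mem (by omega) (by omega))
          (Ypow_mem (by omega) (by omega) b)) (al_zero_mem_stdSpan hk (by omega) h2 h3))
    · have e3 : seg (Xg P) i g * (Ypow P (g + 1) a * Eg P g * Ypow P g b) *
          (al P (r + 2 + 2) (g + 1) j 0 * al P (r + 2) g h 0)
          = Ypow P (g + 1) a * seg (Xg P) i g * (Eg P g * al P (r + 2 + 2) (g + 1) j 0)
            * al P (r + 2) g h b := by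
        rw [al_eq _ g h b]
        linear_combination (norm := noncomm_ring)
          seg (Xg P) i g * Ypow P (g + 1) a * Eg P g * c3.eq * al P (r + 2) g h 0
          + c4.symm.eq * Eg P g * al P (r + 2 + 2) (g + 1) j 0 * Ypow P g b * al P (r + 2) g h 0
      rw [e3]
      exact Eg_mul_al_mul_mem hk hq0 hr hi h1 h2 h3 h4 h5 hp hab ha
  · have e1 := seg_E_mul_al (P := P) (j := j) (m := r + 2) (by omega) h4 h2 (by omega) hr p
    have hy : seg (Xg P) i j ∈ Bsub P j := seg_mem fun _ _ _ => Xg_mem (by omega) (by omega)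
    have c1 := commute_al_of_mem_Bsub (m := r + 2 + 2) (j := h + 2) (by omega) hy
      (show j < g + 2 by omega) (by omega) (by omega) p
    have e2 : al P (r + 2 + 2) i j 0 * al P (r + 2) g h p
        = al P (r + 2 + 2) (g + 2) (h + 2) p * al P (r + 2) i j 0 := by
      rw [al_zero, al_zero]
      linear_combination (norm := noncomm_ring)
        seg (Xg P) i j * e1 + c1.eq * seg (Eg P) j (r + 2)
    rw [e2]
    exact al_mul_mem (by omega) (by omega) (by omega) ⟨by omega, hp⟩
      (al_zero_mem_stdSpan hk hi hij (by omega))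

/-- Two chains whose starting indices are in the wrong order can be sorted. -/
theorem al_mul_al_mem {i j g h : ℕ} {s p : ℤ} (hi : 1 ≤ i) (hij : i ≤ j) (h5 : j ≤ r + 3)
    (h1 : i ≤ g) (h2 : g ≤ h) (h3 : h ≤ r + 1) (hp : p ∈ Pset P.k) :
    al P (r + 2 + 2) i j s * al P (r + 2) g h p
      ∈ alSpan P (r + 2) (fun i' s => i < i' ∧ s ∈ Pset P.k) (stdSpan P r) := by
  rw [al_eq, mul_assoc]
  refine mem_mul_of_mem_span ?_ (al_zero_mul_al_mem hk hq0 hr hi hij h5 h1 h2 h3 hp)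
  rintro _ ⟨i', j', s', b, hb, h6, h7, h8, ⟨h9, h10⟩, rfl⟩
  rw [← mul_assoc, (commute_al_of_mem_Bsub hi (Ypow_mem hi le_rfl s) h9 h7 (by omega) s').eq,
    mul_assoc]
  exact al_mul_mem h6 h7 h8 ⟨h9, h10⟩
    (mul_mem_stdSpan hk hq0 hr (Ypow_mem hi (by omega) s) hb)

end

/-- Products `α₁ ⋯ α_m b` of `m` chains with decreasing starting indices, all below `u`, and an
element `b` of `B_r`. -/
def sortedSet (P : Params R) (r : ℕ) : ℕ → ℕ → Set (Alg P)
  | 0, _ => Bsub P r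
  | m + 1, u => {z | ∃ i j : ℕ, ∃ s : ℤ, ∃ x ∈ sortedSet P r m i, 1 ≤ i ∧ i ≤ j ∧
      j ≤ r + 2 * m + 1 ∧ i < u ∧ s ∈ Pset P.k ∧ z = al P (r + 2 * m + 2) i j s * x}

theorem sortedSet_subset {r : ℕ} (m u : ℕ) :
    sortedSet P r m u ⊆ sortedSet P r m (r + 2 * m) := by
  cases m with
  | zero => exact subset_rfl
  | succ m =>
    rintro _ ⟨i, j, s, x, hx, h1, h2, h3, -, h5, rfl⟩
    exact ⟨i, j, s, x, hx, h1, h2, h3, by omega, h5, rfl⟩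

/-- The span of the sorted products. -/
abbrev sortedSpan (P : Params R) (r m : ℕ) : Submodule R (Alg P) :=
  Submodule.span R (sortedSet P r m (r + 2 * m))

theorem al_mul_mem_sortedSpan_of_lt {r m i j u : ℕ} {s : ℤ} {x : Alg P} (h1 : 1 ≤ i) (h2 : i ≤ j)
    (h3 : j ≤ r + 2 * m + 1) (hs : s ∈ Pset P.k) (hx : x ∈ sortedSet P r m u) (hu : u ≤ i) :
    al P (r + 2 * m + 2) i j s * x ∈ sortedSpan P r (m + 1) := by
  refine Submodule.subset_span ⟨i, j, s, x, ?_, h1, h2, h3, by omega, hs, rfl⟩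
  cases m with
  | zero => exact hx
  | succ m =>
    obtain ⟨i', j', s', x', h⟩ := hx
    exact ⟨i', j', s', x', h.1, h.2.1, h.2.2.1, h.2.2.2.1, h.2.2.2.2.1.trans_le hu, h.2.2.2.2.2⟩

theorem Bsub_mul_mem_and_al_mul_mem_sortedSpan (hk : 1 ≤ P.k) (hq0 : P.qc 0 = (P.q0 : R))
    (r m : ℕ) :
    (r + 2 * m ≤ P.n → ∀ b ∈ Bsub P (r + 2 * m), ∀ x ∈ sortedSpan P r m, b * x ∈ sortedSpan P r m) ∧
    (r + 2 * m + 2 ≤ P.n → ∀ i j s, 1 ≤ i → i ≤ j → j ≤ r + 2 * m + 1 → s ∈ Pset P.k →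
      ∀ x ∈ sortedSpan P r m, al P (r + 2 * m + 2) i j s * x ∈ sortedSpan P r (m + 1)) := by
  induction m with
  | zero =>
    refine ⟨fun _ b hb x hx => ?_, fun _ i j s h1 h2 h3 hs x hx => ?_⟩
    · exact mem_mul_of_mem_span (fun z hz => Submodule.subset_span (mul_mem hb hz)) hx
    · exact mem_mul_of_mem_span (fun z hz =>
        al_mul_mem_sortedSpan_of_lt (m := 0) h1 h2 h3 hs hz (Nat.zero_le i)) hx
  | succ m ih =>
    refine ⟨fun hn b hb x hx => ?_, fun hn i j s h1 h2 h3 hs x hx => ?_⟩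
    · have e : sortedSpan P r (m + 1)
          = alSpan P (r + 2 * m) (fun _ s => s ∈ Pset P.k) (sortedSpan P r m) := by
        refine le_antisymm (Submodule.span_le.2 ?_) (Submodule.span_le.2 ?_)
        · rintro _ ⟨i, j, s, x, hx, h1, h2, h3, -, h5, rfl⟩
          exact al_mul_mem h1 h2 h3 h5 (Submodule.subset_span (sortedSet_subset m i hx))
        · rintro _ ⟨i, j, s, x, hx, h1, h2, h3, h4, rfl⟩
          exact ih.2 (by omega) i j s h1 h2 h3 h4 x hx
      rw [e] at hx ⊢
      exact Bsub_mul_mem_alSpan hk hq0 (by omega) (ih.1 (by omega)) hb hx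
    · obtain ⟨d, hd⟩ : ∃ d, d = r + 2 * m + 3 - i := ⟨_, rfl⟩
      induction d using Nat.strong_induction_on generalizing i j s x with
      | _ d ihd =>
      refine mem_mul_of_mem_span ?_ hx
      rintro _ ⟨g, h, p, y, hy, h4, h5, h6, h7, hp, rfl⟩
      obtain hgi | hgi := Nat.lt_or_ge g i
      · exact al_mul_mem_sortedSpan_of_lt (m := m + 1) h1 h2 h3 hs
          ⟨g, h, p, y, hy, h4, h5, h6, Nat.lt_succ_self g, hp, rfl⟩ hgi
      · rw [← mul_assoc]
        have h8 := al_mul_al_mem (r := r + 2 * m) (s := s) hk hq0 (by omega) h1 h2 h3 hgi h5 h6 hp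
        have h9 := mul_mem_alSpan (Q' := (sortedSpan P r (m + 1) : Set (Alg P))) (b := y) h8
          fun c hc => mul_mem_of_mem_span (by
            rintro _ ⟨g', h', p', b, hb, h10, h11, h12, h13, rfl⟩
            rw [mul_assoc]
            exact ih.2 (by omega) g' h' p' h10 h11 h12 h13 _
              (ih.1 (by omega) b hb y (Submodule.subset_span (sortedSet_subset m g hy)))) hc
        refine Submodule.span_le.2 ?_ h9
        rintro _ ⟨i', j', s', c, hc, h10, h11, h12, ⟨h13, h14⟩, rfl⟩
        exact ihd _ (by omega) i' j' s' h10 h11 h12 h14 c hc rfl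

theorem alphaChain_succ' (l : ℕ) (ii jj : ℕ → ℕ) (ss : ℕ → ℤ) (m : ℕ) :
    alphaChain P (l + 2) ii jj ss (m + 1) = alpha P (ii 1) (jj 1) (l + 1) (ss 1)
      * alphaChain P l (fun t => ii (t + 1)) (fun t => jj (t + 1)) (fun t => ss (t + 1)) m := by
  induction m with
  | zero => simp [alphaChain]
  | succ m ih =>
    rw [alphaChain, ih, alphaChain, mul_assoc,
      show l + 2 + 1 - 2 * (m + 1 + 1) = l + 1 - 2 * (m + 1) by omega]

theorem alphaChain_congr {l m : ℕ} {ii jj ii' jj' : ℕ → ℕ} {ss ss' : ℕ → ℤ}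
    (h : ∀ t, 1 ≤ t → t ≤ m → ii t = ii' t ∧ jj t = jj' t ∧ ss t = ss' t) :
    alphaChain P l ii jj ss m = alphaChain P l ii' jj' ss' m := by
  induction m with
  | zero => rfl
  | succ m ih =>
    obtain ⟨h1, h2, h3⟩ := h (m + 1) (by omega) le_rfl
    rw [alphaChain, alphaChain, ih fun t ht ht' => h t ht (by omega), h1, h2, h3]

theorem alphaChainBar_congr {l m : ℕ} {ii jj ii' jj' : ℕ → ℕ} {ss ss' : ℕ → ℤ}
    (h : ∀ t, 1 ≤ t → t ≤ m → ii t = ii' t ∧ jj t = jj' t ∧ ss t = ss' t) :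
    alphaChainBar P l ii jj ss m = alphaChainBar P l ii' jj' ss' m := by
  induction m with
  | zero => rfl
  | succ m ih =>
    obtain ⟨h1, h2, h3⟩ := h (m + 1) (by omega) le_rfl
    rw [alphaChainBar, alphaChainBar, ih fun t ht ht' => h t ht (by omega), h1, h2, h3]

theorem exists_alphaChain_of_mem_sortedSet {r m u : ℕ} {x : Alg P} (hx : x ∈ sortedSet P r m u) :
    ∃ ii jj : ℕ → ℕ, ∃ ss : ℕ → ℤ, ∃ b ∈ Bsub P r,
      (∀ t, 1 ≤ t → t ≤ m →
        1 ≤ ii t ∧ ii t ≤ jj t ∧ jj t ≤ r + 2 * m + 1 - 2 * t ∧ ss t ∈ Pset P.k) ∧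
      (∀ t, 1 ≤ t → t + 1 ≤ m → ii (t + 1) < ii t) ∧ (1 ≤ m → ii 1 < u) ∧
      x = alphaChain P (r + 2 * m) ii jj ss m * b := by
  induction m generalizing u x with
  | zero =>
    exact ⟨fun _ => 0, fun _ => 0, fun _ => 0, x, hx, fun t h1 h2 => by omega,
      fun t h1 h2 => by omega, fun h => by omega, by rw [alphaChain, one_mul]⟩
  | succ m ih =>
    obtain ⟨i, j, s, y, hy, h1, h2, h3, h4, hs, rfl⟩ := hx
    obtain ⟨ii, jj, ss, b, hb, h5, h6, h7, rfl⟩ := ih hy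
    refine ⟨fun t => if t ≤ 1 then i else ii (t - 1), fun t => if t ≤ 1 then j else jj (t - 1),
      fun t => if t ≤ 1 then s else ss (t - 1), b, hb, fun t ht ht' => ?_, fun t ht ht' => ?_,
      fun _ => by simpa using h4, ?_⟩
    · obtain h | h := Nat.lt_or_ge 1 t
      · simp only [h.not_ge, if_false]
        have := h5 (t - 1) (by omega) (by omega)
        exact ⟨this.1, this.2.1, by omega, this.2.2.2⟩
      · simp only [h, if_true]
        exact ⟨h1, h2, by omega, hs⟩
    · obtain h | h := Nat.lt_or_ge 1 t
      · simp only [h.not_ge, if_false, show ¬ t + 1 ≤ 1 by omega]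
        have := h6 (t - 1) (by omega) (by omega)
        rwa [show t - 1 + 1 = t + 1 - 1 by omega] at this
      · obtain rfl : t = 1 := by omega
        simpa using h7 (by omega)
    · rw [show r + 2 * (m + 1) = r + 2 * m + 2 by omega, alphaChain_succ', mul_assoc]
      refine congrArg₂ _ rfl (congrArg (· * b) (alphaChain_congr fun t ht _ => ?_))
      simp [show ¬ t = 0 by omega]

theorem sortedSpan_le {r m l : ℕ} (h : r + 2 * m = l) :
    sortedSpan P r m ≤ Submodule.span R (V P l m) * Subalgebra.toSubmodule (Bsub P r) := by
  subst h
  refine Submodule.span_le.2 fun x hx => ?_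
  obtain ⟨ii, jj, ss, b, hb, h1, h2, -, rfl⟩ := exists_alphaChain_of_mem_sortedSet hx
  exact Submodule.mul_mem_mul (Submodule.subset_span ⟨ii, jj, ss, h1, h2, rfl⟩) hb

theorem alphaChain_mul_mem_sortedSpan (hk : 1 ≤ P.k) (hq0 : P.qc 0 = (P.q0 : R)) {r m M l : ℕ}
    (h : r + 2 * m + 2 * M = l) (hl : l ≤ P.n) {ii jj : ℕ → ℕ} {ss : ℕ → ℤ}
    (hc : ∀ t, 1 ≤ t → t ≤ M →
      1 ≤ ii t ∧ ii t ≤ jj t ∧ jj t ≤ l + 1 - 2 * t ∧ ss t ∈ Pset P.k)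
    {x : Alg P} (hx : x ∈ sortedSpan P r m) :
    alphaChain P l ii jj ss M * x ∈ sortedSpan P r (m + M) := by
  induction M generalizing m x with
  | zero => simpa [alphaChain] using hx
  | succ M ih =>
    rw [alphaChain, mul_assoc, show m + (M + 1) = m + 1 + M by omega]
    refine ih (by omega) (fun t h1 h2 => hc t h1 (by omega)) ?_
    obtain ⟨h1, h2, h3, h4⟩ := hc (M + 1) (by omega) le_rfl
    rw [alpha_eq_al, show l + 1 - 2 * (M + 1) + 1 = r + 2 * m + 2 by omega]
    exact (Bsub_mul_mem_and_al_mul_mem_sortedSpan hk hq0 r m).2 (by omega) _ _ _ h1 h2 (by omega) h4 x hx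

theorem commute_Echain {l m : ℕ} (h : 2 * m + 1 ≤ l) {b : Alg P} (hb : b ∈ Bsub P (l - 2 * m)) :
    Commute (Echain P l m) b := by
  induction m with
  | zero => exact Commute.one_left b
  | succ m ih =>
    rw [Echain]
    exact (ih (by omega) (Bsub_mono (by omega) hb)).mul_left
      (commute_Eg_of_mem_Bsub (m := l - 2 * (m + 1)) (by omega) (by omega) hb)

theorem al_succ_eq {m i j : ℕ} (h : j ≤ m) (s : ℤ) :
    al P (m + 1) i j s = al P m i j s * Eg P m := by
  rw [al, al, seg_succ_right _ h, ← mul_assoc]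

theorem alphaChain_eq_mul_Echain {l m : ℕ} (h : 2 * m ≤ l) {ii jj : ℕ → ℕ} {ss : ℕ → ℤ}
    (hc : ∀ t, 1 ≤ t → t ≤ m →
      1 ≤ ii t ∧ ii t ≤ jj t ∧ jj t ≤ l + 1 - 2 * t ∧ ss t ∈ Pset P.k) :
    alphaChain P l ii jj ss m = alphaChainBar P l ii jj ss m * Echain P l m := by
  induction m with
  | zero => rw [alphaChain, alphaChainBar, Echain, one_mul]
  | succ m ih =>
    obtain ⟨h1, h2, h3, -⟩ := hc (m + 1) (by omega) le_rfl
    rw [alphaChain, alphaChainBar, Echain, ih (by omega) fun t h1 h2 => hc t h1 (by omega),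
      alpha_eq_al, alpha_eq_al, al_succ_eq h3,
      show l + 1 - 2 * (m + 1) = l - 2 * (m + 1) + 1 by omega]
    have c := commute_Echain (P := P) (l := l) (m := m) (by omega)
      (Bsub_mono (by omega) (al_mem (P := P) (m := l - 2 * (m + 1) + 1) h1 h2 (by omega)
        (ss (m + 1))))
    linear_combination (norm := noncomm_ring)
      alphaChainBar P l ii jj ss m * c.eq * Eg P (l - 2 * (m + 1) + 1)

/-- The span of `V_{l,m}`. -/
abbrev spanV (P : Params R) (l m : ℕ) : Submodule R (Alg P) := Submodule.span R (V P l m)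

/-- The span of `V̄_{l,m}`. -/
abbrev spanVbar (P : Params R) (l m : ℕ) : Submodule R (Alg P) := Submodule.span R (Vbar P l m)

/-- `B_r` as a submodule. -/
abbrev Bmod (P : Params R) (r : ℕ) : Submodule R (Alg P) := Subalgebra.toSubmodule (Bsub P r)

/-- The span of the chains `α_{i,j,r}^s`. -/
abbrev spanAl (P : Params R) (r : ℕ) : Submodule R (Alg P) :=
  Submodule.span R {z | ∃ i j : ℕ, ∃ s ∈ Pset P.k, 1 ≤ i ∧ i ≤ j ∧ j ≤ r + 1 ∧
    z = al P (r + 1) i j s}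

theorem Bmod_mul_Bmod_le {r r' r'' : ℕ} (h : r ≤ r'') (h' : r' ≤ r'') :
    Bmod P r * Bmod P r' ≤ Bmod P r'' :=
  Submodule.mul_le.2 fun _ hx _ hy => (Bsub P r'').mul_mem (Bsub_mono h hx) (Bsub_mono h' hy)

open scoped Pointwise in
theorem V_eq {l m : ℕ} (h : 2 * m ≤ l) : V P l m = Vbar P l m * {Echain P l m} := by
  ext x
  rw [Set.mul_singleton, Set.mem_image]
  constructor
  · rintro ⟨ii, jj, ss, h1, h2, rfl⟩
    exact ⟨_, ⟨ii, jj, ss, h1, h2, rfl⟩, (alphaChain_eq_mul_Echain h h1).symm⟩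
  · rintro ⟨_, ⟨ii, jj, ss, h1, h2, rfl⟩, rfl⟩
    exact ⟨ii, jj, ss, h1, h2, (alphaChain_eq_mul_Echain h h1).symm⟩

theorem spanV_eq {l m : ℕ} (h : 2 * m ≤ l) :
    spanV P l m = spanVbar P l m * Submodule.span R {Echain P l m} := by
  rw [spanV, V_eq h, Submodule.span_mul_span]

theorem spanV_succ_le {r m l : ℕ} (h : r + 2 + 2 * m = l) :
    spanV P l (m + 1) ≤ spanV P l m * Bmod P (r + 2) := by
  refine Submodule.span_le.2 ?_
  rintro _ ⟨ii, jj, ss, h1, h2, rfl⟩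
  obtain ⟨h3, h4, h5, -⟩ := h1 (m + 1) (by omega) le_rfl
  rw [alphaChain, alpha_eq_al, show l + 1 - 2 * (m + 1) + 1 = r + 2 by omega]
  exact Submodule.mul_mem_mul (Submodule.subset_span
    ⟨ii, jj, ss, fun t ht ht' => h1 t ht (by omega), fun t ht ht' => h2 t ht (by omega), rfl⟩)
    (al_mem h3 h4 (by omega) _)

theorem spanVbar_succ_le {r m l : ℕ} (h : r + 2 + 2 * m = l) :
    spanVbar P l (m + 1) ≤ spanVbar P l m * Bmod P (r + 2) := by
  refine Submodule.span_le.2 ?_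
  rintro _ ⟨ii, jj, ss, h1, h2, rfl⟩
  obtain ⟨h3, h4, h5, -⟩ := h1 (m + 1) (by omega) le_rfl
  rw [alphaChainBar, alpha_eq_al]
  exact Submodule.mul_mem_mul (Submodule.subset_span
    ⟨ii, jj, ss, fun t ht ht' => h1 t ht (by omega), fun t ht ht' => h2 t ht (by omega), rfl⟩)
    (Bsub_mono (by omega) (al_mem (m := l - 2 * (m + 1) + 1) h3 h4 (by omega) _))

theorem Echain_comm {l m r : ℕ} (h : r + 2 * m = l) (hr : 1 ≤ r) {N : Submodule R (Alg P)}
    (hN : N ≤ Bmod P r) :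
    Submodule.span R {Echain P l m} * N = N * Submodule.span R {Echain P l m} := by
  have c : ∀ b ∈ N, Commute (Echain P l m) b := fun b hb =>
    commute_Echain (by omega) (by rw [show l - 2 * m = r by omega]; exact hN hb)
  refine le_antisymm (Submodule.mul_le.2 fun x hx y hy => ?_) (Submodule.mul_le.2 fun y hy x hx => ?_)
  all_goals
    obtain ⟨a, rfl⟩ := Submodule.mem_span_singleton.1 hx
    have hE := Submodule.smul_mem _ a (Submodule.mem_span_singleton_self (R := R) (Echain P l m))
  · rw [smul_mul_assoc, (c y hy).eq, ← mul_smul_comm]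
    exact Submodule.mul_mem_mul hy hE
  · rw [mul_smul_comm, ← (c y hy).eq, ← smul_mul_assoc]
    exact Submodule.mul_mem_mul hE hy

theorem span_Echain_succ {r m l : ℕ} (h : r + 2 + 2 * m = l) :
    Submodule.span R {Echain P l (m + 1)}
      = Submodule.span R {Echain P l m} * Submodule.span R {Eg P (r + 1)} := by
  rw [Submodule.span_mul_span, Set.singleton_mul_singleton, Echain,
    show l + 1 - 2 * (m + 1) = r + 1 by omega]

section
variable (hk : 1 ≤ P.k) (hq0 : P.qc 0 = (P.q0 : R))
include hk hq0

theorem Bsub_zero_mul_mem {b x : Alg P} (hb : b ∈ Bsub P 0) (hx : x ∈ spanAl P 0) :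
    b * x ∈ spanAl P 0 := by
  have key : ∀ p, Ypow P 1 p ∈ lstab (spanAl P 0) := by
    intro p
    refine mem_lstab_span ?_
    rintro _ ⟨i, j, s, hs, h1, h2, h3, rfl⟩
    obtain rfl : j = 1 := by omega
    obtain rfl : i = 1 := by omega
    rw [al_self, seg_self, mul_one, ← Ypow_add]
    refine Submodule.span_mono ?_ (Ypow_one_mem_span_Pset hk hq0 (p + s))
    rintro _ ⟨t, ht, rfl⟩
    exact ⟨1, 1, t, ht, le_rfl, le_rfl, le_rfl, by rw [al_self, seg_self, mul_one]⟩
  have hY := key 1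
  have hYi := key (-1)
  rw [Ypow_one, Yp_one] at hY
  rw [Ypow_neg_one] at hYi
  exact Bsub_le hY (by simpa [YpInv, downXi, upXi] using hYi) (fun a _ _ => by omega)
    (fun a _ _ => by omega) hb x hx

theorem Ypow_one_mul_mem {b : Alg P} (hb : b ∈ Bsub P 0) {s : ℤ} (hs : s ∈ Pset P.k) :
    Ypow P 1 s * b ∈ Submodule.span R {z | ∃ t ∈ Pset P.k, z = Ypow P 1 t} := by
  have c : Commute (Ypow P 1 s) b := by
    refine commute_of_mem_Bsub ?_ (fun a _ _ => by omega) (fun a _ _ => by omega) hb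
    rw [← Yp_one, ← Ypow_one]
    exact (Ypow_add P 1 s 1).symm.trans ((congrArg _ (add_comm _ _)).trans (Ypow_add P 1 1 s))
  rw [c.eq]
  have h := Bsub_zero_mul_mem hk hq0 hb (Submodule.subset_span
    ⟨1, 1, s, hs, le_rfl, le_rfl, le_rfl, rfl⟩)
  rw [al_self, seg_self, mul_one] at h
  refine Submodule.span_mono ?_ h
  rintro _ ⟨i, j, t, ht, h1, h2, h3, rfl⟩
  obtain rfl : j = 1 := by omega
  obtain rfl : i = 1 := by omega
  exact ⟨t, ht, by rw [al_self, seg_self, mul_one]⟩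

theorem spanAl_zero_mul_le : spanAl P 0 * Bmod P 0 ≤ spanAl P 0 := by
  refine Submodule.mul_le.2 fun x hx b hb => mul_mem_of_mem_span ?_ hx
  rintro _ ⟨i, j, s, hs, h1, h2, h3, rfl⟩
  obtain rfl : j = 1 := by omega
  obtain rfl : i = 1 := by omega
  rw [al_self, seg_self, mul_one]
  refine Submodule.span_mono ?_ (Ypow_one_mul_mem hk hq0 hb hs)
  rintro _ ⟨t, ht, rfl⟩
  exact ⟨1, 1, t, ht, le_rfl, le_rfl, le_rfl, by rw [al_self, seg_self, mul_one]⟩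

theorem spanVbar_mul_Bmod_zero_le (m : ℕ) :
    spanVbar P (2 * (m + 1)) (m + 1) * Bmod P 0 ≤ spanVbar P (2 * (m + 1)) (m + 1) := by
  refine Submodule.mul_le.2 fun x hx b hb => mul_mem_of_mem_span ?_ hx
  rintro _ ⟨ii, jj, ss, h1, h2, rfl⟩
  obtain ⟨h3, h4, h5, h6⟩ := h1 (m + 1) (by omega) le_rfl
  rw [alphaChainBar, mul_assoc, alpha_eq_al, show jj (m + 1) = 1 by omega,
    show ii (m + 1) = 1 by omega, Nat.sub_self, al_self, seg_self, mul_one]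
  refine mem_mul_of_mem_span ?_ (Ypow_one_mul_mem hk hq0 hb h6)
  rintro _ ⟨t, ht, rfl⟩
  refine Submodule.subset_span ⟨ii, jj, fun u => if u = m + 1 then t else ss u,
    fun u hu hu' => ?_, h2, ?_⟩
  · obtain ⟨h7, h8, h9, h10⟩ := h1 u hu hu'
    refine ⟨h7, h8, h9, ?_⟩
    dsimp only
    split_ifs
    exacts [ht, h10]
  · have e := alphaChainBar_congr (P := P) (l := 2 * (m + 1)) (m := m) (ii := ii) (jj := jj)
      (ii' := ii) (jj' := jj) (ss := ss) (ss' := fun u => if u = m + 1 then t else ss u)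
      fun u _ hu => ⟨rfl, rfl, (if_neg (by omega)).symm⟩
    rw [alphaChainBar, alpha_eq_al, show jj (m + 1) = 1 by omega,
      show ii (m + 1) = 1 by omega, Nat.sub_self, al_self, seg_self, mul_one, if_pos rfl, e]

theorem Bmod_mul_Eg_le {r : ℕ} (hr : r + 2 ≤ P.n) :
    Bmod P (r + 2) * Submodule.span R {Eg P (r + 1)}
      ≤ spanAl P r * Submodule.span R {Eg P (r + 1)} * Bmod P r := by
  refine Submodule.mul_le.2 fun b hb x hx => ?_
  obtain ⟨a, rfl⟩ := Submodule.mem_span_singleton.1 hx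
  rw [mul_smul_comm]
  refine Submodule.smul_mem _ _ ?_
  have e : Eg P (r + 1) = al P (r + 2) (r + 1) (r + 1) 0 * 1 := by
    rw [mul_one, al_self, seg_succ_left _ (Nat.lt_succ_self _), seg_self, mul_one, Ypow_zero, one_mul]
  have h := Bsub_mul_mem_alSpan (Q := Bsub P r) hk hq0 hr (fun _ hb _ hx => mul_mem hb hx) hb
    (al_mul_mem (i := r + 1) (j := r + 1) (by omega) le_rfl le_rfl (zero_mem_Pset hk) (one_mem _))
  rw [← e] at h
  refine Submodule.span_le.2 ?_ h
  rintro _ ⟨i, j, s, c, hc, h1, h2, h3, hs, rfl⟩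
  rw [al_succ_eq h3]
  exact Submodule.mul_mem_mul (Submodule.mul_mem_mul
    (Submodule.subset_span ⟨i, j, s, hs, h1, h2, h3, rfl⟩) (Submodule.mem_span_singleton_self _)) hc

theorem spanV_mul_spanAl_le {r m l : ℕ} (h : r + 2 + 2 * m = l) (hl : l ≤ P.n) :
    spanV P l m * spanAl P r * Submodule.span R {Eg P (r + 1)}
      ≤ spanV P l (m + 1) * Bmod P r := by
  rw [mul_assoc, Submodule.span_mul_span, Submodule.span_mul_span]
  refine Submodule.span_le.2 ?_
  rintro _ ⟨_, ⟨ii, jj, ss, h1, h2, rfl⟩, _, ⟨_, ⟨i, j, s, hs, h3, h4, h5, rfl⟩, _, rfl, rfl⟩, rfl⟩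
  refine sortedSpan_le (m := m + 1) (by omega) ?_
  rw [add_comm m 1]
  refine alphaChain_mul_mem_sortedSpan (m := 1) hk hq0 (by omega) hl h1 ?_
  have := (Bsub_mul_mem_and_al_mul_mem_sortedSpan hk hq0 r 0).2 (by omega) i j s h3 h4 h5 hs 1
    (Submodule.subset_span (one_mem (Bsub P r)))
  rw [mul_one] at this
  exact (congrArg (· ∈ sortedSpan P r 1) (al_succ_eq h5 s)).mp this

end

section
variable {st : Alg P →ₗ[R] Alg P} (hst1 : st 1 = 1)
  (hstmul : ∀ a b : Alg P, st (a * b) = st b * st a)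
  (hstY : st (Yg P) = Yg P) (hstYi : st (Ygi P) = Ygi P)
  (hstX : ∀ i, st (Xg P i) = Xg P i) (hstXi : ∀ i, st (Xgi P i) = Xgi P i)
  (hstE : ∀ i, st (Eg P i) = Eg P i)

include hstmul in
theorem map_st_mul (N N' : Submodule R (Alg P)) :
    (N * N').map st = N'.map st * N.map st := by
  refine le_antisymm (Submodule.map_le_iff_le_comap.2 (Submodule.mul_le.2 fun x hx y hy => ?_))
    (Submodule.mul_le.2 ?_)
  · rw [Submodule.mem_comap, hstmul]
    exact Submodule.mul_mem_mul (Submodule.mem_map_of_mem hy) (Submodule.mem_map_of_mem hx)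
  · rintro _ ⟨y, hy, rfl⟩ _ ⟨x, hx, rfl⟩
    rw [← hstmul]
    exact Submodule.mem_map_of_mem (Submodule.mul_mem_mul hx hy)

include hst1 hstmul hstE in
theorem st_Echain {l m : ℕ} (h : 2 * m ≤ l) : st (Echain P l m) = Echain P l m := by
  induction m with
  | zero => exact hst1
  | succ m ih =>
    rw [Echain, hstmul, hstE, ih (by omega)]
    exact (commute_Echain (by omega) (Eg_mem (by omega) (by omega))).eq.symm

include hst1 hstmul hstY hstYi hstX hstXi hstE

theorem st_mem_and_st_st {r : ℕ} {b : Alg P} (hb : b ∈ Bsub P r) :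
    st b ∈ Bsub P r ∧ st (st b) = b := by
  induction hb using Algebra.adjoin_induction with
  | mem x hx =>
    have hs : st x = x := by
      rcases hx with (rfl | rfl) | ⟨i, -, -, rfl | rfl | rfl⟩
      exacts [hstY, hstYi, hstX i, hstXi i, hstE i]
    rw [hs, hs]
    exact ⟨Algebra.subset_adjoin hx, rfl⟩
  | algebraMap c =>
    rw [Algebra.algebraMap_eq_smul_one, map_smul, hst1, map_smul, hst1]
    exact ⟨Subalgebra.smul_mem _ (one_mem _) c, rfl⟩
  | add x y _ _ hx hy =>
    rw [map_add, map_add, hx.2, hy.2]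
    exact ⟨add_mem hx.1 hy.1, rfl⟩
  | mul x y _ _ hx hy =>
    rw [hstmul, hstmul, hx.2, hy.2]
    exact ⟨mul_mem hy.1 hx.1, rfl⟩

theorem map_st_Bmod (r : ℕ) : (Bmod P r).map st = Bmod P r := by
  have h := fun (b : Alg P) (hb : b ∈ Bsub P r) =>
    st_mem_and_st_st hst1 hstmul hstY hstYi hstX hstXi hstE hb
  refine le_antisymm (Submodule.map_le_iff_le_comap.2 fun b hb => (h b hb).1) fun b hb => ?_
  exact ⟨st b, (h b hb).1, (h b hb).2⟩

theorem Eg_mul_Bmod_le (hk : 1 ≤ P.k) (hq0 : P.qc 0 = (P.q0 : R)) {r : ℕ} (hr : r + 2 ≤ P.n) :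
    Submodule.span R {Eg P (r + 1)} * Bmod P (r + 2)
      ≤ Bmod P r * (Submodule.span R {Eg P (r + 1)} * (spanAl P r).map st) := by
  have h := Submodule.map_mono (f := st) (Bmod_mul_Eg_le hk hq0 hr)
  simpa only [map_st_mul hstmul, map_st_Bmod hst1 hstmul hstY hstYi hstX hstXi hstE,
    Submodule.map_span, Set.image_singleton, hstE] using h

end

theorem spanAl_le_Bmod (r : ℕ) : spanAl P r ≤ Bmod P (r + 1) := by
  refine Submodule.span_le.2 ?_
  rintro _ ⟨i, j, s, -, h1, h2, h3, rfl⟩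
  exact al_mem h1 h2 h3 s

theorem spanVbar_mul_spanAl_le (hk : 1 ≤ P.k) (hq0 : P.qc 0 = (P.q0 : R)) {r m l : ℕ}
    (h : r + 2 + 2 * m = l) (hl : l ≤ P.n) :
    spanVbar P l m * spanAl P r * Submodule.span R {Echain P l (m + 1)}
      ≤ spanV P l (m + 1) * Bmod P r := by
  refine le_trans (le_of_eq ?_) (spanV_mul_spanAl_le hk hq0 h hl)
  rw [span_Echain_succ h, spanV_eq (by omega), mul_assoc, ← mul_assoc (spanAl P r),
    ← Echain_comm h (by omega) ((spanAl_le_Bmod r).trans (Bsub_mono (by omega)))]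
  simp only [mul_assoc]

section
variable {st : Alg P →ₗ[R] Alg P} (hst1 : st 1 = 1)
  (hstmul : ∀ a b : Alg P, st (a * b) = st b * st a)
  (hstY : st (Yg P) = Yg P) (hstYi : st (Ygi P) = Ygi P)
  (hstX : ∀ i, st (Xg P i) = Xg P i) (hstXi : ∀ i, st (Xgi P i) = Xgi P i)
  (hstE : ∀ i, st (Eg P i) = Eg P i)
include hst1 hstmul hstY hstYi hstX hstXi hstE

/-- The product `E_{l,m+1} B_r (V̄_{l,m} α_r)*` folds into `V̄_{l,m+1}*`. -/
theorem spanV_succ_mul_Bmod_mul_map_le (hk : 1 ≤ P.k) (hq0 : P.qc 0 = (P.q0 : R)) {r m l : ℕ}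
    (h : r + 2 + 2 * m = l) (hl : l ≤ P.n) :
    spanV P l (m + 1) * Bmod P r * (spanVbar P l m * spanAl P r).map st
      ≤ spanV P l (m + 1) * Bmod P r * (spanVbar P l (m + 1)).map st := by
  have hB : (Bmod P r).map st = Bmod P r := map_st_Bmod hst1 hstmul hstY hstYi hstX hstXi hstE r
  have hE : (Submodule.span R {Echain P l (m + 1)}).map st
      = Submodule.span R {Echain P l (m + 1)} := by
    rw [Submodule.map_span, Set.image_singleton, st_Echain hst1 hstmul hstE (by omega)]
  have hV := spanV_eq (P := P) (l := l) (m := m + 1) (by omega)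
  have key : Submodule.span R {Echain P l (m + 1)} * (spanVbar P l m * spanAl P r).map st
      ≤ Bmod P r * (Submodule.span R {Echain P l (m + 1)} * (spanVbar P l (m + 1)).map st) := by
    have h1 := Submodule.map_mono (f := st) (spanVbar_mul_spanAl_le hk hq0 h hl)
    rw [hV] at h1
    simpa only [map_st_mul hstmul, hB, hE] using h1
  have hBB : Bmod P r * Bmod P r ≤ Bmod P r := Bmod_mul_Bmod_le le_rfl le_rfl
  rcases Nat.eq_zero_or_pos r with rfl | hr
  · obtain rfl : l = 2 * (m + 1) := by omega
    have h0 : Bmod P 0 * (spanVbar P (2 * (m + 1)) m * spanAl P 0).map st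
        ≤ (spanVbar P (2 * (m + 1)) m * spanAl P 0).map st := by
      have h2 := Submodule.map_mono (f := st)
        (mul_le_mul_right (spanAl_zero_mul_le hk hq0) (spanVbar P (2 * (m + 1)) m))
      rw [← mul_assoc, map_st_mul hstmul _ (Bmod P 0), hB] at h2
      exact h2
    have h1B : (1 : Submodule R (Alg P)) ≤ Bmod P 0 := Submodule.one_le.2 (one_mem (Bsub P 0))
    calc _ ≤ spanV P (2 * (m + 1)) (m + 1)
            * (spanVbar P (2 * (m + 1)) m * spanAl P 0).map st := by
          rw [mul_assoc]; exact mul_le_mul_right h0 _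
      _ ≤ spanVbar P (2 * (m + 1)) (m + 1) * (Bmod P 0 *
            (Submodule.span R {Echain P (2 * (m + 1)) (m + 1)}
              * (spanVbar P (2 * (m + 1)) (m + 1)).map st)) := by
          rw [hV, mul_assoc]; exact mul_le_mul_right key _
      _ ≤ spanVbar P (2 * (m + 1)) (m + 1) *
            (Submodule.span R {Echain P (2 * (m + 1)) (m + 1)}
              * (spanVbar P (2 * (m + 1)) (m + 1)).map st) := by
          rw [← mul_assoc]; exact mul_le_mul_left (spanVbar_mul_Bmod_zero_le hk hq0 m) _
      _ = spanV P (2 * (m + 1)) (m + 1) * 1 * (spanVbar P (2 * (m + 1)) (m + 1)).map st := by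
          rw [hV, mul_one, mul_assoc]
      _ ≤ _ := mul_le_mul_left (mul_le_mul_right h1B _) _
  · have hc := Echain_comm (P := P) (l := l) (m := m + 1) (by omega) hr (le_refl (Bmod P r))
    rw [hV, mul_assoc _ _ (Bmod P r), hc]
    calc _ = spanVbar P l (m + 1) * Bmod P r * (Submodule.span R {Echain P l (m + 1)}
            * (spanVbar P l m * spanAl P r).map st) := by simp only [mul_assoc]
      _ ≤ spanVbar P l (m + 1) * Bmod P r * (Bmod P r * (Submodule.span R {Echain P l (m + 1)}
            * (spanVbar P l (m + 1)).map st)) := mul_le_mul_right key _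
      _ = spanVbar P l (m + 1) * (Bmod P r * Bmod P r) * (Submodule.span R {Echain P l (m + 1)}
            * (spanVbar P l (m + 1)).map st) := by simp only [mul_assoc]
      _ ≤ spanVbar P l (m + 1) * Bmod P r * (Submodule.span R {Echain P l (m + 1)}
            * (spanVbar P l (m + 1)).map st) := mul_le_mul_left (mul_le_mul_right hBB _) _
      _ = _ := by simp only [mul_assoc]

/-- `V_{l,m} B e B V̄_{l,m}* ⊆ V_{l,m+1} B V̄_{l,m+1}*`. -/
theorem spanV_mul_ideal_mul_map_le (hk : 1 ≤ P.k) (hq0 : P.qc 0 = (P.q0 : R)) {r m l : ℕ}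
    (h : r + 2 + 2 * m = l) (hl : l ≤ P.n) :
    spanV P l m * (Bmod P (r + 2) * Submodule.span R {Eg P (r + 1)} * Bmod P (r + 2))
        * (spanVbar P l m).map st
      ≤ spanV P l (m + 1) * Bmod P r * (spanVbar P l (m + 1)).map st := by
  refine le_trans ?_
    (spanV_succ_mul_Bmod_mul_map_le hst1 hstmul hstY hstYi hstX hstXi hstE hk hq0 h hl)
  have he := Eg_mul_Bmod_le hst1 hstmul hstY hstYi hstX hstXi hstE hk hq0 (r := r) (by omega)
  have hBB : Bmod P (r + 2) * Bmod P r ≤ Bmod P (r + 2) := Bmod_mul_Bmod_le le_rfl (by omega)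
  have hCC : Bmod P r * Bmod P r ≤ Bmod P r := Bmod_mul_Bmod_le le_rfl le_rfl
  rw [map_st_mul hstmul]
  set W := (spanVbar P l m).map st
  set D := (spanAl P r).map st
  set e := Submodule.span R {Eg P (r + 1)}
  calc _ = spanV P l m * Bmod P (r + 2) * (e * Bmod P (r + 2)) * W := by simp only [mul_assoc]
    _ ≤ spanV P l m * Bmod P (r + 2) * (Bmod P r * (e * D)) * W :=
        mul_le_mul_left (mul_le_mul_right he _) _
    _ = spanV P l m * (Bmod P (r + 2) * Bmod P r) * (e * D * W) := by simp only [mul_assoc]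
    _ ≤ spanV P l m * Bmod P (r + 2) * (e * D * W) :=
        mul_le_mul_left (mul_le_mul_right hBB _) _
    _ = spanV P l m * (Bmod P (r + 2) * e) * (D * W) := by simp only [mul_assoc]
    _ ≤ spanV P l m * (spanAl P r * e * Bmod P r) * (D * W) :=
        mul_le_mul_left (mul_le_mul_right (Bmod_mul_Eg_le hk hq0 (by omega)) _) _
    _ = spanV P l m * spanAl P r * e * (Bmod P r * (D * W)) := by simp only [mul_assoc]
    _ ≤ spanV P l (m + 1) * Bmod P r * (Bmod P r * (D * W)) :=
        mul_le_mul_left (spanV_mul_spanAl_le hk hq0 h hl) _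
    _ = spanV P l (m + 1) * (Bmod P r * Bmod P r) * (D * W) := by simp only [mul_assoc]
    _ ≤ _ := mul_le_mul_left (mul_le_mul_right hCC _) _

theorem spanV_succ_mul_Bmod_mul_le {r m l : ℕ} (h : r + 2 + 2 * m = l) :
    spanV P l (m + 1) * Bmod P r * (spanVbar P l (m + 1)).map st
      ≤ spanV P l m * Bmod P (r + 2) * (spanVbar P l m).map st := by
  have hW := Submodule.map_mono (f := st) (spanVbar_succ_le (P := P) h)
  rw [map_st_mul hstmul, map_st_Bmod hst1 hstmul hstY hstYi hstX hstXi hstE] at hW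
  have h1 : Bmod P (r + 2) * Bmod P r ≤ Bmod P (r + 2) := Bmod_mul_Bmod_le le_rfl (by omega)
  have h2 : Bmod P (r + 2) * Bmod P (r + 2) ≤ Bmod P (r + 2) := Bmod_mul_Bmod_le le_rfl le_rfl
  calc _ ≤ spanV P l m * Bmod P (r + 2) * Bmod P r
          * (Bmod P (r + 2) * (spanVbar P l m).map st) :=
        mul_le_mul' (mul_le_mul_left (spanV_succ_le h) _) hW
    _ = spanV P l m * (Bmod P (r + 2) * Bmod P r * Bmod P (r + 2))
          * (spanVbar P l m).map st := by simp only [mul_assoc]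
    _ ≤ _ := mul_le_mul_left (mul_le_mul_right ((mul_le_mul_left h1 _).trans h2) _) _

end

end

end CBMW


/-- Lemma 12(c) of the paper. `I_{l,M} = Σ_{m ≥ M} V_{l,m} Ã_{l-2m} V̄_{l,m}*`. -/
theorem statement12 {R : Type} [CommRing R] (P : Params R)
    (hn : 1 ≤ P.n) (hk : 1 ≤ P.k) (hq0 : P.qc 0 = (P.q0 : R))
    (hcomp : (P.lam : R) - P.laminv = P.delta * (1 - P.A 0))
    (st : Alg P →ₗ[R] Alg P) (hst1 : st 1 = 1)
    (hstmul : ∀ a b : Alg P, st (a * b) = st b * st a)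
    (hstY : st (Yg P) = Yg P) (hstYi : st (Ygi P) = Ygi P)
    (hstX : ∀ i, st (Xg P i) = Xg P i) (hstXi : ∀ i, st (Xgi P i) = Xgi P i)
    (hstE : ∀ i, st (Eg P i) = Eg P i)
    (At : ℕ → Submodule R (Alg P))
    (hAt0 : At 0 = Subalgebra.toSubmodule (Bsub P 0))
    (hAt1 : At 1 = Subalgebra.toSubmodule (Bsub P 1))
    (hAtle : ∀ l, l ≤ P.n → At l ≤ Subalgebra.toSubmodule (Bsub P l))
    (hAtsplit : ∀ l, 2 ≤ l → l ≤ P.n →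
      Subalgebra.toSubmodule (Bsub P l)
        = At l ⊔ Submodule.span R
            {z : Alg P | ∃ b b', b ∈ Bsub P l ∧ b' ∈ Bsub P l ∧ z = b * Eg P (l - 1) * b'})
    (M l : ℕ) (hml : 2 * M ≤ l) (hln : l ≤ P.n) :
    Submodule.span R
        {z : Alg P | ∃ v b w, v ∈ Vbar P l M ∧ b ∈ Bsub P (l - 2 * M) ∧
          w ∈ Vbar P l M ∧ z = v * Echain P l M * b * st w}
      = ∑ m ∈ Finset.Icc M (l / 2),
          Submodule.span R
            {z : Alg P | ∃ v χ w, v ∈ V P l m ∧ χ ∈ At (l - 2 * m) ∧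
              w ∈ Vbar P l m ∧ z = v * χ * st w} := by
  have hst := fun (r : ℕ) => map_st_Bmod hst1 hstmul hstY hstYi hstX hstXi hstE r
  set I : ℕ → Submodule R (Alg P) := fun m =>
    spanV P l m * Bmod P (l - 2 * m) * (spanVbar P l m).map st with hI
  set T : ℕ → Submodule R (Alg P) := fun m =>
    spanV P l m * At (l - 2 * m) * (spanVbar P l m).map st with hT
  have hL : Submodule.span R
      {z : Alg P | ∃ v b w, v ∈ Vbar P l M ∧ b ∈ Bsub P (l - 2 * M) ∧
        w ∈ Vbar P l M ∧ z = v * Echain P l M * b * st w} = I M := by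
    rw [hI]
    dsimp only
    rw [spanV_eq hml, Submodule.map_span, ← Submodule.span_eq (Bmod P (l - 2 * M)),
      Submodule.span_mul_span, Submodule.span_mul_span, Submodule.span_mul_span]
    congr 1
    ext z
    constructor
    · rintro ⟨v, b, w, hv, hb, hw, rfl⟩
      exact ⟨_, ⟨_, ⟨v, hv, _, rfl, rfl⟩, b, hb, rfl⟩, _, ⟨w, hw, rfl⟩, rfl⟩
    · rintro ⟨_, ⟨_, ⟨v, hv, _, rfl, rfl⟩, b, hb, rfl⟩, _, ⟨w, hw, rfl⟩, rfl⟩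
      exact ⟨v, b, w, hv, hb, hw, rfl⟩
  have hR : ∀ m, Submodule.span R
      {z : Alg P | ∃ v χ w, v ∈ V P l m ∧ χ ∈ At (l - 2 * m) ∧
        w ∈ Vbar P l m ∧ z = v * χ * st w} = T m := by
    intro m
    rw [hT]
    dsimp only
    rw [Submodule.map_span, ← Submodule.span_eq (At (l - 2 * m)),
      Submodule.span_mul_span, Submodule.span_mul_span, Submodule.span_eq]
    congr 1
    ext z
    constructor
    · rintro ⟨v, b, w, hv, hb, hw, rfl⟩
      exact ⟨_, ⟨v, hv, b, hb, rfl⟩, _, ⟨w, hw, rfl⟩, rfl⟩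
    · rintro ⟨_, ⟨v, hv, b, hb, rfl⟩, _, ⟨w, hw, rfl⟩, rfl⟩
      exact ⟨v, b, w, hv, hb, hw, rfl⟩
  rw [hL, Finset.sum_congr rfl fun m _ => hR m]
  have hTI : ∀ m, T m ≤ I m := fun m =>
    mul_le_mul_left (mul_le_mul_right (hAtle _ (by omega)) _) _
  have hsub : ∀ m, 2 * (m + 1) ≤ l → I (m + 1) ≤ I m := by
    intro m hm
    obtain ⟨r, rfl⟩ : ∃ r, l = r + 2 + 2 * m := ⟨l - 2 * (m + 1), by omega⟩
    have := spanV_succ_mul_Bmod_mul_le hst1 hstmul hstY hstYi hstX hstXi hstE (P := P)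
      (rfl : r + 2 + 2 * m = _)
    rw [hI]
    dsimp only
    rwa [show r + 2 + 2 * m - 2 * (m + 1) = r by omega, Nat.add_sub_cancel]
  have hstep : ∀ m, 2 * (m + 1) ≤ l → I m ≤ T m ⊔ I (m + 1) := by
    intro m hm
    obtain ⟨r, rfl⟩ : ∃ r, l = r + 2 + 2 * m := ⟨l - 2 * (m + 1), by omega⟩
    have hB : Bmod P (r + 2) = At (r + 2)
        ⊔ Bmod P (r + 2) * Submodule.span R {Eg P (r + 1)} * Bmod P (r + 2) := by
      refine (hAtsplit (r + 2) (by omega) (by omega)).trans (congrArg _ ?_)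
      conv_rhs => rw [← Submodule.span_eq (Bmod P (r + 2))]
      rw [Submodule.span_mul_span, Submodule.span_mul_span]
      congr 1
      ext z
      constructor
      · rintro ⟨b, b', hb, hb', rfl⟩
        exact ⟨_, ⟨b, hb, _, rfl, rfl⟩, b', hb', rfl⟩
      · rintro ⟨_, ⟨b, hb, _, rfl, rfl⟩, b', hb', rfl⟩
        exact ⟨b, b', hb, hb', rfl⟩
    have := spanV_mul_ideal_mul_map_le hst1 hstmul hstY hstYi hstX hstXi hstE hk hq0
      (rfl : r + 2 + 2 * m = _) hln
    rw [hI, hT]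
    dsimp only
    rw [show r + 2 + 2 * m - 2 * (m + 1) = r by omega, Nat.add_sub_cancel, hB,
      Submodule.mul_sup, Submodule.sup_mul]
    exact sup_le_sup_left this _
  have hbase : ∀ m, l - 2 * m < 2 → I m = T m := by
    intro m hm
    rw [hI, hT]
    dsimp only
    rcases (by omega : l - 2 * m = 0 ∨ l - 2 * m = 1) with h | h <;> rw [h]
    exacts [by rw [hAt0], by rw [hAt1]]
  have hTS : ∀ m, M ≤ m → m ≤ l / 2 → T m ≤ ∑ m ∈ Finset.Icc M (l / 2), T m :=
    fun m h1 h2 => Finset.single_le_sum (f := T) (fun _ _ => bot_le)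
      (Finset.mem_Icc.2 ⟨h1, h2⟩)
  have hIS : ∀ d m, M ≤ m → m + d = l / 2 → I m ≤ ∑ m ∈ Finset.Icc M (l / 2), T m := by
    intro d
    induction d with
    | zero => exact fun m h1 h2 => (hbase m (by omega)).le.trans (hTS m h1 (by omega))
    | succ d ih =>
      exact fun m h1 h2 => (hstep m (by omega)).trans
        (sup_le (hTS m h1 (by omega)) (ih (m + 1) (by omega) (by omega)))
  have hIM : ∀ d, 2 * (M + d) ≤ l → I (M + d) ≤ I M := by
    intro d
    induction d with
    | zero => exact fun _ => le_rfl
    | succ d ih => exact fun h => (hsub (M + d) h).trans (ih (by omega))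
  refine le_antisymm (hIS (l / 2 - M) M le_rfl (by omega)) ?_
  refine Finset.sum_induction _ (fun N => N ≤ I M) (fun _ _ => sup_le) bot_le fun m hm => ?_
  obtain ⟨h1, h2⟩ := Finset.mem_Icc.1 hm
  obtain ⟨d, rfl⟩ := Nat.exists_eq_add_of_le h1
  exact (hTI _).trans (hIM d (by omega))
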